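/- Bulk universality for products of Ginibre matrices: Fix an integer M ≥ 1 and integers ν_1, …, ν_M ≥ 0. Let x0 ∈ (0, (M+1)^{M+1}/M^M) and let φ ∈ (0, π/(M+1)) satisfy x0 = v(φ). Then, as n → ∞, the rescaled kernel e^{−π(ξ−η)·cot φ} · (n^{M−1}/ρ(φ)) · K_n( n^M·(x0 + ξ/(n·ρ(φ))), n^M·(x0 + η/(n·ρ(φ))) ) converges to the sine kernel K_sin(ξ, η) = sin(π(ξ−η))/(π(ξ−η)) (interpreted as 1 when ξ = η), uniformly for (ξ, η) in any compact subset of ℝ². -/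

import Mathlib

open Complex Real Set Filter MeasureTheory

/-- The point on the vertical contour `𝒞`: `s = -1/2 + iσ`. -/
noncomputable def sC (σ : ℝ) : ℂ := -(1/2) + σ * Complex.I

/-- The point on the circular contour `Σ` (center `(n-1)/2`, radius `n/2 - 1/8`). -/
noncomputable def tC (n : ℕ) (θ : ℝ) : ℂ :=
  ((n : ℂ) - 1) / 2 + ((n : ℂ) / 2 - 1/8) * Complex.exp (θ * Complex.I)

/-- The integrand of the double contour integral defining the kernel. -/
noncomputable def integrand (M : ℕ) (ν : ℕ → ℕ) (n : ℕ) (x y : ℝ) (s t : ℂ) : ℂ :=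
  (∏ j ∈ Finset.range (M + 1),
      Complex.Gamma (s + (ν j : ℂ) + 1) / Complex.Gamma (t + (ν j : ℂ) + 1)) *
    (Complex.Gamma (t - (n : ℂ) + 1) / Complex.Gamma (s - (n : ℂ) + 1)) *
    Complex.exp (t * Real.log x) * Complex.exp (-(s + 1) * Real.log y) / (s - t)

/-- The correlation kernel `K_n(x,y)` for products of `M` Ginibre matrices,
written as an iterated parametrized integral: `ds = i dσ`,
`dt = (n/2 - 1/8) i e^{iθ} dθ`. -/
noncomputable def Kn (M : ℕ) (ν : ℕ → ℕ) (n : ℕ) (x y : ℝ) : ℂ :=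
  (1 / (2 * (Real.pi : ℂ) * Complex.I) ^ 2) *
    ∫ σ : ℝ, Complex.I *
      ∫ θ in (0 : ℝ)..(2 * Real.pi),
        (((n : ℂ) / 2 - 1/8) * Complex.I * Complex.exp (θ * Complex.I)) *
          integrand M ν n x y (sC σ) (tC n θ)

/-- The parametrization `v(φ)` of the spectral variable. -/
noncomputable def v (M : ℕ) (φ : ℝ) : ℝ :=
  Real.sin ((M + 1) * φ) ^ (M + 1) / (Real.sin φ * Real.sin (M * φ) ^ M)

/-- The density `ρ(φ)`. -/
noncomputable def ρbulk (M : ℕ) (φ : ℝ) : ℝ :=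
  (1 / Real.pi) * Real.sin φ ^ 2 * Real.sin (M * φ) ^ (M - 1) /
    Real.sin ((M + 1) * φ) ^ M

/-- The sine kernel, interpreted as `1` on the diagonal. -/
noncomputable def Ksin (ξ η : ℝ) : ℝ :=
  if ξ = η then 1 else Real.sin (Real.pi * (ξ - η)) / (Real.pi * (ξ - η))

/-- The real part of `z log z`. -/
noncomputable def xlogRe (z : ℂ) : ℝ := (z * Complex.log z).re

lemma xlogRe_eq (z : ℂ) : xlogRe z = z.re * Real.log ‖z‖ - z.im * Complex.arg z := by
  simp [xlogRe, Complex.mul_re, Complex.log_re, Complex.log_im]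

lemma continuous_im_mul_arg : Continuous fun z : ℂ => z.im * Complex.arg z := by
  rw [continuous_iff_continuousAt]
  intro z
  by_cases hz : z ∈ Complex.slitPlane
  · exact Complex.continuous_im.continuousAt.mul (Complex.continuousAt_arg hz)
  · have him : z.im = 0 := by
      by_contra h
      exact hz (Complex.mem_slitPlane_iff.2 (Or.inr h))
    rw [ContinuousAt, him, zero_mul]
    have h0 : Tendsto (fun w : ℂ => |w.im| * Real.pi) (nhds z) (nhds 0) := by
      have : Continuous fun w : ℂ => |w.im| * Real.pi := by fun_prop
      simpa [him] using this.tendsto z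
    refine squeeze_zero_norm (fun w => ?_) h0
    rw [norm_mul, Real.norm_eq_abs, Real.norm_eq_abs]
    exact mul_le_mul_of_nonneg_left (Complex.abs_arg_le_pi w) (abs_nonneg _)

lemma continuous_re_mul_log_norm : Continuous fun z : ℂ => z.re * Real.log ‖z‖ := by
  rw [continuous_iff_continuousAt]
  intro z
  by_cases hz : z = 0
  · subst hz
    rw [ContinuousAt]
    have h0 : Tendsto (fun w : ℂ => ‖‖w‖ * Real.log ‖w‖‖) (nhds 0) (nhds 0) := by
      have : Continuous fun w : ℂ => ‖‖w‖ * Real.log ‖w‖‖ :=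
        (Real.continuous_mul_log.comp continuous_norm).norm
      simpa using this.tendsto 0
    simp only [Complex.zero_re, zero_mul]
    refine squeeze_zero_norm (fun w => ?_) h0
    rw [norm_mul, norm_mul]
    refine mul_le_mul_of_nonneg_right ?_ (norm_nonneg _)
    rw [Real.norm_eq_abs, Real.norm_eq_abs, abs_norm]
    exact Complex.abs_re_le_norm w
  · exact Complex.continuous_re.continuousAt.mul
      (continuous_norm.continuousAt.log (norm_ne_zero_iff.2 hz))

lemma continuous_xlogRe : Continuous xlogRe := by
  have : xlogRe = fun z => z.re * Real.log ‖z‖ - z.im * Complex.arg z := by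
    ext z; exact xlogRe_eq z
  rw [this]
  exact continuous_re_mul_log_norm.sub continuous_im_mul_arg

/-- The defect in the recursion `Γ(u+b+1) = (u+b) Γ(u+b)` for the Stirling approximation. -/
noncomputable def stirlingDefect (b : ℝ) (u : ℂ) : ℝ :=
  Real.log ‖u + b‖ - xlogRe (u + 1) + xlogRe u + 1
    - (b - 1 / 2) * (Real.log ‖u + 2‖ - Real.log ‖u + 1‖)

lemma log_add_eq {u : ℂ} (hu : 0 ≤ u.re) (hu0 : u ≠ 0) {a : ℝ} (ha : 0 ≤ a) :
    Complex.log (u + a) = Complex.log u + Complex.log (1 + a * u⁻¹) := by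
  have h1 : u + a = u * (1 + a * u⁻¹) := by field_simp
  have hre : 0 < (1 + (a : ℂ) * u⁻¹).re := by
    have : 0 ≤ (u⁻¹).re := by
      rw [Complex.inv_re]; exact div_nonneg hu (Complex.normSq_nonneg _)
    simp only [Complex.add_re, Complex.one_re, Complex.re_ofReal_mul]
    nlinarith [mul_nonneg ha this]
  have hne : (1 + (a : ℂ) * u⁻¹) ≠ 0 := by
    intro h; rw [h] at hre; simp at hre
  rw [h1, Complex.log_mul hu0 hne]
  have h2 := abs_le.1 (Complex.abs_arg_le_pi_div_two_iff.2 hu)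
  have h3 := abs_lt.1 (Complex.abs_arg_lt_pi_div_two_iff.2 (Or.inl hre))
  constructor <;> linarith [h2.1, h2.2, h3.1, h3.2]

lemma norm_log_one_add_sub_le_sq {z : ℂ} (hz : ‖z‖ ≤ 1 / 2) :
    ‖Complex.log (1 + z) - z‖ ≤ ‖z‖ ^ 2 := by
  refine (Complex.norm_log_one_add_sub_self_le (by linarith)).trans ?_
  have : (1 - ‖z‖)⁻¹ ≤ 2 := by
    rw [inv_le_comm₀ (by linarith) two_pos]; linarith
  nlinarith [sq_nonneg ‖z‖]

lemma norm_log_one_add_sub_le_cube {z : ℂ} (hz : ‖z‖ ≤ 1 / 2) :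
    ‖Complex.log (1 + z) - z + z ^ 2 / 2‖ ≤ ‖z‖ ^ 3 := by
  have h := Complex.norm_log_sub_logTaylor_le 2 (z := z) (by linarith)
  have h2 : Complex.log (1 + z) - z + z ^ 2 / 2 =
      Complex.log (1 + z) - Complex.logTaylor (2 + 1) z := by
    simp [Complex.logTaylor_succ, Complex.logTaylor_zero]; ring
  rw [h2]
  refine h.trans ?_
  have : (1 - ‖z‖)⁻¹ ≤ 2 := by
    rw [inv_le_comm₀ (by linarith) two_pos]; linarith
  have h3 : 0 ≤ ‖z‖ ^ 3 := by positivity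
  norm_num
  nlinarith

lemma abs_stirlingDefect_le_of_large {b : ℝ} (hb : 0 ≤ b) {u : ℂ} (hu : 0 ≤ u.re)
    (hbu : 4 + 2 * b ≤ ‖u‖) :
    |stirlingDefect b u| ≤ (3 + b ^ 2 + 5 * |b - 1 / 2|) * (‖u‖⁻¹) ^ 2 := by
  have hu0 : u ≠ 0 := by
    rintro rfl; simp at hbu; linarith
  have hun : 0 < ‖u‖ := norm_pos_iff.2 hu0
  set z := u⁻¹ with hz
  have hzn : ‖z‖ = ‖u‖⁻¹ := norm_inv u
  have hz4 : ‖z‖ * (4 + 2 * b) ≤ 1 := by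
    rw [hzn, inv_mul_le_iff₀ hun]; linarith
  have hz0 : 0 ≤ ‖z‖ := norm_nonneg z
  have huz : u * z = 1 := mul_inv_cancel₀ hu0
  set e1 : ℂ := Complex.log (1 + b * z) - b * z with he1
  set e2 : ℂ := Complex.log (1 + (2 : ℝ) * z) - (2 : ℝ) * z with he2
  set e3 : ℂ := Complex.log (1 + (1 : ℝ) * z) - (1 : ℝ) * z with he3
  set e4 : ℂ := Complex.log (1 + z) - z + z ^ 2 / 2 with he4
  have key : stirlingDefect b u =
      (z ^ 2 / 2 + e1 - (u + 1) * e4 - (b - 1 / 2) * (e2 - e3)).re := by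
    have hl : ∀ a : ℝ, 0 ≤ a → Real.log ‖u + a‖ = (Complex.log u + Complex.log (1 + a * z)).re := by
      intro a ha
      rw [← log_add_eq hu hu0 ha, Complex.log_re]
    have h1 : Real.log ‖u + 1‖ = (Complex.log u + Complex.log (1 + (1 : ℝ) * z)).re := by
      rw [← hl 1 zero_le_one]; simp
    have h2 : Real.log ‖u + 2‖ = (Complex.log u + Complex.log (1 + (2 : ℝ) * z)).re := by
      rw [← hl 2 zero_le_two]; simp
    have h3 : Complex.log (u + 1) = Complex.log u + Complex.log (1 + z) := by
      have := log_add_eq hu hu0 (zero_le_one)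
      simpa using this
    rw [stirlingDefect, hl b hb, h1, h2, xlogRe, xlogRe, h3]
    have hcast : (b - 1 / 2 : ℂ) = ((b - 1 / 2 : ℝ) : ℂ) := by push_cast; ring
    have e : Complex.log u + Complex.log (1 + b * z)
        - (u + 1) * (Complex.log u + Complex.log (1 + z))
        + u * Complex.log u + 1 - ((b - 1 / 2 : ℝ) : ℂ) *
          ((Complex.log u + Complex.log (1 + (2 : ℝ) * z))
          - (Complex.log u + Complex.log (1 + (1 : ℝ) * z))) =
        z ^ 2 / 2 + e1 - (u + 1) * e4 - (b - 1 / 2) * (e2 - e3) := by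
      rw [he1, he2, he3, he4]
      push_cast
      linear_combination (-1 + z / 2) * huz
    rw [← e]
    simp only [Complex.add_re, Complex.sub_re, Complex.one_re, Complex.re_ofReal_mul]
  rw [key]
  refine (Complex.abs_re_le_norm _).trans ?_
  rw [← hzn]
  have n1 : ‖e1‖ ≤ b ^ 2 * ‖z‖ ^ 2 := by
    have := norm_log_one_add_sub_le_sq (z := b * z) (by
      rw [norm_mul, Complex.norm_of_nonneg hb]; nlinarith)
    rw [norm_mul, Complex.norm_of_nonneg hb, mul_pow] at this
    exact this
  have n2 : ‖e2‖ ≤ 4 * ‖z‖ ^ 2 := by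
    have := norm_log_one_add_sub_le_sq (z := (2 : ℝ) * z) (by
      rw [norm_mul, Complex.norm_of_nonneg zero_le_two]; nlinarith)
    rw [norm_mul, Complex.norm_of_nonneg zero_le_two, mul_pow] at this
    norm_num at this
    simpa [he2] using this
  have n3 : ‖e3‖ ≤ ‖z‖ ^ 2 := by
    have := norm_log_one_add_sub_le_sq (z := (1 : ℝ) * z) (by
      rw [norm_mul, Complex.norm_of_nonneg zero_le_one]; nlinarith)
    rw [norm_mul, Complex.norm_of_nonneg zero_le_one, mul_pow] at this
    norm_num at this
    simpa [he3] using this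
  have n4 : ‖(u + 1) * e4‖ ≤ 2 * ‖z‖ ^ 2 := by
    have := norm_log_one_add_sub_le_cube (z := z) (by nlinarith)
    have h1 : ‖u + 1‖ ≤ ‖u‖ + 1 := by simpa using norm_add_le u 1
    have h2 : ‖u‖ * ‖z‖ = 1 := by rw [← norm_mul, huz, norm_one]
    have h3 : (‖u‖ + 1) * ‖z‖ ≤ 2 := by nlinarith
    rw [norm_mul]
    calc ‖u + 1‖ * ‖e4‖ ≤ (‖u‖ + 1) * ‖z‖ ^ 3 := by gcongr
      _ = ((‖u‖ + 1) * ‖z‖) * ‖z‖ ^ 2 := by ring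
      _ ≤ 2 * ‖z‖ ^ 2 := by gcongr
  have n5 : ‖((b : ℂ) - 1 / 2) * (e2 - e3)‖ ≤ |b - 1 / 2| * (5 * ‖z‖ ^ 2) := by
    have hcast : (b - 1 / 2 : ℂ) = ((b - 1 / 2 : ℝ) : ℂ) := by push_cast; ring
    rw [hcast, norm_mul, Complex.norm_real, Real.norm_eq_abs]
    gcongr
    refine (norm_sub_le _ _).trans ?_
    linarith
  have n6 : ‖z ^ 2 / 2‖ = ‖z‖ ^ 2 / 2 := by simp
  calc _ ≤ ‖z ^ 2 / 2‖ + ‖e1‖ + ‖(u + 1) * e4‖ + ‖((b : ℂ) - 1 / 2) * (e2 - e3)‖ := by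
        refine (norm_sub_le _ _).trans ?_
        gcongr
        refine (norm_sub_le _ _).trans ?_
        gcongr
        exact norm_add_le _ _
    _ ≤ _ := by nlinarith [sq_nonneg ‖z‖]

lemma re_add_real_pos {u : ℂ} (hu : 0 ≤ u.re) {b : ℝ} (hb : 0 < b) : u + b ≠ 0 := by
  intro h
  have := congrArg Complex.re h
  simp at this
  linarith

lemma continuousOn_stirlingDefect {b : ℝ} (hb : 0 < b) :
    ContinuousOn (stirlingDefect b) {u | 0 ≤ u.re} := by
  have hl : ∀ a : ℝ, 0 < a → ContinuousOn (fun u : ℂ => Real.log ‖u + a‖) {u | 0 ≤ u.re} := by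
    intro a ha
    refine ContinuousOn.log (by fun_prop) ?_
    intro u hu
    exact norm_ne_zero_iff.2 (re_add_real_pos hu ha)
  have h1 := hl 1 one_pos
  have h2 := hl 2 two_pos
  have hk := continuous_xlogRe
  have hk1 : Continuous fun u : ℂ => xlogRe (u + 1) := hk.comp (by fun_prop)
  push_cast at h1 h2
  unfold stirlingDefect
  exact ((((hl b hb).sub hk1.continuousOn).add hk.continuousOn).add continuousOn_const).sub
    (continuousOn_const.mul (h2.sub h1))

lemma exists_abs_stirlingDefect_le {b : ℝ} (hb : 0 < b) :
    ∃ C, 0 ≤ C ∧ ∀ u : ℂ, 0 ≤ u.re → |stirlingDefect b u| ≤ C * (1 / (1 + ‖u‖) ^ 2) := by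
  set R := 4 + 2 * b
  have hc : IsCompact (Metric.closedBall (0 : ℂ) R ∩ {u | 0 ≤ u.re}) :=
    (isCompact_closedBall _ _).inter_right (isClosed_le continuous_const Complex.continuous_re)
  obtain ⟨C₁, hC₁⟩ := hc.exists_bound_of_continuousOn
    ((continuousOn_stirlingDefect hb).mono inter_subset_right)
  set C₂ := 3 + b ^ 2 + 5 * |b - 1 / 2|
  have hC₂ : 0 ≤ C₂ := by positivity
  refine ⟨|C₁| * (1 + R) ^ 2 + C₂ * 4, by positivity, fun u hu => ?_⟩
  rcases le_total ‖u‖ R with h | h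
  · have h1 := hC₁ u ⟨by simpa using h, hu⟩
    rw [Real.norm_eq_abs] at h1
    have h2 : (1 + ‖u‖) ^ 2 ≤ (1 + R) ^ 2 := by gcongr
    have h3 : 0 < (1 + ‖u‖) ^ 2 := by positivity
    calc |stirlingDefect b u| ≤ |C₁| := h1.trans (le_abs_self _)
      _ ≤ (|C₁| * (1 + R) ^ 2) * (1 / (1 + ‖u‖) ^ 2) := by
        rw [mul_one_div, le_div_iff₀ h3]; gcongr
      _ ≤ _ := by gcongr; nlinarith
  · have h1 := abs_stirlingDefect_le_of_large hb.le hu h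
    have hu1 : 1 ≤ ‖u‖ := by linarith
    have h2 : (‖u‖⁻¹) ^ 2 ≤ 4 * (1 / (1 + ‖u‖) ^ 2) := by
      rw [inv_pow, mul_one_div, inv_eq_one_div, div_le_div_iff₀ (by positivity) (by positivity)]
      nlinarith
    calc |stirlingDefect b u| ≤ C₂ * (4 * (1 / (1 + ‖u‖) ^ 2)) := h1.trans (by gcongr)
      _ ≤ _ := by
        rw [← mul_assoc]; gcongr
        have : 0 ≤ |C₁| * (1 + R) ^ 2 := by positivity
        linarith

lemma tendsto_log_one_add_div_nat (a : ℂ) :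
    Tendsto (fun N : ℕ => Complex.log (1 + a / N)) atTop (nhds 0) := by
  have h1 : Tendsto (fun N : ℕ => 1 + a / (N : ℂ)) atTop (nhds 1) := by
    simpa using (tendsto_const_nhds (x := (1 : ℂ))).add (tendsto_const_div_atTop_nhds_zero_nat a)
  have := (continuousAt_clog (x := 1) (by simp)).tendsto.comp h1
  rw [Complex.log_one] at this
  exact this

lemma tendsto_nat_mul_log_one_add_div (a : ℂ) :
    Tendsto (fun N : ℕ => (N : ℂ) * Complex.log (1 + a / N)) atTop (nhds a) := by
  apply Complex.tendsto_nat_mul_log_one_add_of_tendsto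
  refine tendsto_nhds_of_eventually_eq ?_
  filter_upwards [eventually_ne_atTop 0] with N hN
  field_simp

lemma log_add_nat {a : ℂ} {N : ℕ} (hN : 0 < N) (h : a + N ≠ 0) :
    Complex.log (a + N) = Real.log N + Complex.log (1 + a / N) := by
  have hN' : (N : ℂ) ≠ 0 := by exact_mod_cast hN.ne'
  have h1 : a + N = ((N : ℝ) : ℂ) * (1 + a / N) := by
    push_cast; field_simp; ring
  have h2 : (1 + a / (N : ℂ)) ≠ 0 := by
    intro h0; rw [h1, h0, mul_zero] at h; exact h rfl
  rw [h1, Complex.log_ofReal_mul (by exact_mod_cast hN) h2]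

/-- The leading part of Stirling's approximation of `log |Γ(u+b)|`. -/
noncomputable def stirlingMain (b : ℝ) (u : ℂ) : ℝ :=
  xlogRe u - u.re + (b - 1 / 2) * Real.log ‖u + 1‖

lemma log_norm_eq_stirlingMain_sub (b : ℝ) (u : ℂ) :
    Real.log ‖u + b‖ = stirlingMain b (u + 1) - stirlingMain b u + stirlingDefect b u := by
  have : u + 1 + 1 = u + 2 := by ring
  simp only [stirlingMain, stirlingDefect, this, Complex.add_re, Complex.one_re]
  ring

lemma sum_log_norm_eq (b : ℝ) (u : ℂ) (N : ℕ) :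
    ∑ j ∈ Finset.range N, Real.log ‖u + b + j‖ =
      stirlingMain b (u + N) - stirlingMain b u +
        ∑ j ∈ Finset.range N, stirlingDefect b (u + j) := by
  induction N with
  | zero => simp
  | succ N ih =>
    rw [Finset.sum_range_succ, Finset.sum_range_succ, ih]
    have h := log_norm_eq_stirlingMain_sub b (u + N)
    have e1 : u + b + N = u + N + b := by ring
    have e2 : u + ((N + 1 : ℕ) : ℂ) = u + N + 1 := by push_cast; ring
    rw [e1, h, e2]
    ring

lemma tendsto_log_factorial_sub :
    Tendsto (fun N : ℕ => Real.log (N.factorial) - (N + 1 / 2) * Real.log N + N) atTop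
      (nhds (Real.log (√Real.pi) + 1 / 2 * Real.log 2)) := by
  have h1 : Tendsto (fun N => Real.log (Stirling.stirlingSeq N)) atTop
      (nhds (Real.log (√Real.pi))) :=
    (Real.continuousAt_log (by positivity)).tendsto.comp Stirling.tendsto_stirlingSeq_sqrt_pi
  refine (h1.add_const (1 / 2 * Real.log 2)).congr' ?_
  filter_upwards [eventually_gt_atTop 0] with N hN
  have hN' : (N : ℝ) ≠ 0 := by exact_mod_cast hN.ne'
  rw [Stirling.log_stirlingSeq_formula, Real.log_mul two_ne_zero hN',
    Real.log_div hN' (Real.exp_pos 1).ne', Real.log_exp]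
  ring

lemma tendsto_stirling_remainder (b : ℝ) {u : ℂ} (hu : 0 ≤ u.re) :
    Tendsto (fun N : ℕ => (u.re + b) * Real.log N + Real.log (N.factorial)
      - stirlingMain b (u + (N + 1 : ℕ))) atTop
      (nhds (Real.log (√Real.pi) + 1 / 2 * Real.log 2)) := by
  have h1 := tendsto_log_one_add_div_nat (u + 1)
  have h2 := tendsto_nat_mul_log_one_add_div (u + 1)
  have h3 := tendsto_log_one_add_div_nat (u + 2)
  have h4 : Tendsto (fun N : ℕ => (-((u + 1) * Complex.log (1 + (u + 1) / N)
      + (N : ℂ) * Complex.log (1 + (u + 1) / N) - (u + 1)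
      + (b - 1 / 2) * Complex.log (1 + (u + 2) / N))).re) atTop (nhds 0) := by
    have := ((((h1.const_mul (u + 1)).add h2).sub_const (u + 1)).add
      (h3.const_mul ((b : ℂ) - 1 / 2))).neg
    have := (Complex.continuous_re.tendsto _).comp this
    rw [mul_zero, mul_zero, zero_add, add_zero, sub_self, neg_zero, Complex.zero_re] at this
    exact this
  have h5 := tendsto_log_factorial_sub.add h4
  rw [add_zero] at h5
  refine h5.congr' ?_
  filter_upwards [eventually_gt_atTop 0] with N hN
  have hne : ∀ a : ℂ, 0 ≤ a.re → a + N ≠ 0 := by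
    intro a ha h
    have := congrArg Complex.re h
    simp at this
    have : (0 : ℝ) < N := by exact_mod_cast hN
    linarith
  have e1 : u + ((N + 1 : ℕ) : ℂ) = (u + 1) + N := by push_cast; ring
  have e2 : u + ((N + 1 : ℕ) : ℂ) + 1 = (u + 2) + N := by push_cast; ring
  have l1 := log_add_nat hN (hne (u + 1) (by simp; linarith))
  have l2 := log_add_nat hN (hne (u + 2) (by simp; linarith))
  rw [stirlingMain, xlogRe, e2, e1, l1, ← Complex.log_re, l2]
  have e3 : (u + 1 + N) * (Real.log N + Complex.log (1 + (u + 1) / N)) =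
    ((Real.log N : ℝ) : ℂ) * (u + 1 + N) + ((u + 1) * Complex.log (1 + (u + 1) / N)
      + (N : ℂ) * Complex.log (1 + (u + 1) / N)) := by ring
  have hcast : (b - 1 / 2 : ℂ) = ((b - 1 / 2 : ℝ) : ℂ) := by push_cast; ring
  rw [e3, hcast]
  simp only [Complex.neg_re, Complex.add_re, Complex.sub_re, Complex.re_ofReal_mul, Complex.one_re,
    Complex.ofReal_re, Complex.natCast_re]
  ring

lemma log_norm_GammaSeq {b : ℝ} (hb : 0 < b) {u : ℂ} (hu : 0 ≤ u.re) {N : ℕ} (hN : 0 < N) :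
    Real.log ‖Complex.GammaSeq (u + b) N‖ = (u.re + b) * Real.log N + Real.log (N.factorial)
      - ∑ j ∈ Finset.range (N + 1), Real.log ‖u + b + j‖ := by
  have hN' : (0 : ℝ) < N := by exact_mod_cast hN
  have hne : ∀ j : ℕ, u + b + j ≠ 0 := by
    intro j h
    have := congrArg Complex.re h
    simp at this
    have : (0 : ℝ) ≤ j := j.cast_nonneg
    linarith
  rw [Complex.GammaSeq, norm_div, norm_mul, norm_prod]
  have h1 : ‖(N : ℂ) ^ (u + b)‖ = (N : ℝ) ^ (u.re + b) := by
    rw [Complex.norm_natCast_cpow_of_pos hN]; simp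
  have h2 : ‖((N.factorial : ℕ) : ℂ)‖ = N.factorial := Complex.norm_natCast _
  have h3 : (0 : ℝ) < N.factorial := by exact_mod_cast N.factorial_pos
  rw [h1, h2, Real.log_div, Real.log_mul, Real.log_rpow hN', Real.log_prod]
  · intro j _
    exact norm_ne_zero_iff.2 (hne j)
  · positivity
  · positivity
  · positivity
  · exact Finset.prod_ne_zero_iff.2 fun j _ => norm_ne_zero_iff.2 (hne j)

lemma exists_abs_log_norm_Gamma_sub_stirlingMain_le {b : ℝ} (hb : 0 < b) :
    ∃ C, ∀ u : ℂ, 0 ≤ u.re → |Real.log ‖Complex.Gamma (u + b)‖ - stirlingMain b u| ≤ C := by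
  obtain ⟨C, hC0, hC⟩ := exists_abs_stirlingDefect_le hb
  have hsum : Summable fun j : ℕ => 1 / ((1 : ℝ) + j) ^ 2 := by
    have := (summable_nat_add_iff 1).2 (Real.summable_one_div_nat_pow.2 (one_lt_two))
    refine this.congr fun j => ?_
    push_cast; ring_nf
  set L := Real.log (√Real.pi) + 1 / 2 * Real.log 2
  refine ⟨|L| + C * ∑' j : ℕ, 1 / ((1 : ℝ) + j) ^ 2, fun u hu => ?_⟩
  have hΓ : Complex.Gamma (u + b) ≠ 0 := by
    apply Complex.Gamma_ne_zero_of_re_pos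
    simp; linarith
  have hlim1 : Tendsto (fun N => Real.log ‖Complex.GammaSeq (u + b) N‖ - stirlingMain b u) atTop
      (nhds (Real.log ‖Complex.Gamma (u + b)‖ - stirlingMain b u)) :=
    (((Complex.GammaSeq_tendsto_Gamma (u + b)).norm).log (norm_ne_zero_iff.2 hΓ)).sub_const _
  have hlim2 := tendsto_stirling_remainder b hu
  have hlim3 := (hlim1.sub hlim2).abs
  have hle : |Real.log ‖Complex.Gamma (u + b)‖ - stirlingMain b u - L| ≤
      C * ∑' j : ℕ, 1 / ((1 : ℝ) + j) ^ 2 := by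
    refine le_of_tendsto hlim3 ?_
    filter_upwards [eventually_gt_atTop 0] with N hN
    rw [log_norm_GammaSeq hb hu hN, sum_log_norm_eq]
    have e : (u.re + b) * Real.log N + Real.log (N.factorial) -
        (stirlingMain b (u + (N + 1 : ℕ)) - stirlingMain b u
          + ∑ j ∈ Finset.range (N + 1), stirlingDefect b (u + j)) - stirlingMain b u
        - ((u.re + b) * Real.log N + Real.log (N.factorial) - stirlingMain b (u + (N + 1 : ℕ))) =
        - ∑ j ∈ Finset.range (N + 1), stirlingDefect b (u + j) := by ring
    rw [e, abs_neg]
    refine (Finset.abs_sum_le_sum_abs _ _).trans ?_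
    refine (Finset.sum_le_sum (g := fun j : ℕ => C * (1 / ((1 : ℝ) + j) ^ 2))
      fun j _ => ?_).trans ?_
    · refine (hC (u + j) (by simp; positivity)).trans ?_
      have h1 : (j : ℝ) ≤ ‖u + j‖ := by
        refine le_trans ?_ (Complex.re_le_norm _)
        simp; exact hu
      gcongr
    · rw [← Finset.mul_sum]
      gcongr
      exact hsum.sum_le_tsum _ fun j _ => by positivity
  have := abs_sub_le_iff.1 hle
  rw [abs_le]
  have h1 := neg_abs_le L
  have h2 := le_abs_self L
  constructor <;> linarith [this.1, this.2]

lemma abs_log_norm_add_one_sub_le {u : ℂ} (hu : 0 ≤ u.re) :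
    |Real.log ‖u + 1‖ - Real.log (1 + ‖u‖)| ≤ Real.log 2 := by
  have h0 : 0 < ‖u + 1‖ := by
    have := re_add_real_pos hu one_pos
    push_cast at this
    exact norm_pos_iff.2 this
  have h1 : ‖u + 1‖ ≤ 1 + ‖u‖ := by
    rw [add_comm 1]; simpa using norm_add_le u 1
  have h2 : 1 + ‖u‖ ≤ 2 * ‖u + 1‖ := by
    have a1 : 1 ≤ ‖u + 1‖ := le_trans (by simp; linarith) (Complex.re_le_norm (u + 1))
    have a2 : ‖u‖ ≤ ‖u + 1‖ := by
      rw [← sq_le_sq₀ (norm_nonneg _) (norm_nonneg _), Complex.sq_norm, Complex.sq_norm,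
        Complex.normSq_apply, Complex.normSq_apply]
      simp; nlinarith
    linarith
  have h3 := Real.log_le_log h0 h1
  have h4 := Real.log_le_log (by positivity) h2
  rw [Real.log_mul two_ne_zero h0.ne'] at h4
  rw [abs_le]
  have := Real.log_nonneg (one_le_two)
  constructor <;> linarith

/-- The approximation of `log |Γ(u+b)|` given by Stirling's formula. -/
noncomputable def stirlingApprox (b : ℝ) (u : ℂ) : ℝ :=
  xlogRe u - u.re + (b - 1 / 2) * Real.log (1 + ‖u‖)

/-- Stirling's formula with bounded error, uniformly in the closed right half plane. -/
lemma exists_abs_log_norm_Gamma_sub_le {b : ℝ} (hb : 0 < b) :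
    ∃ C, ∀ u : ℂ, 0 ≤ u.re → |Real.log ‖Complex.Gamma (u + b)‖ - stirlingApprox b u| ≤ C := by
  obtain ⟨C, hC⟩ := exists_abs_log_norm_Gamma_sub_stirlingMain_le hb
  refine ⟨C + |b - 1 / 2| * Real.log 2, fun u hu => ?_⟩
  have e : Real.log ‖Complex.Gamma (u + b)‖ - stirlingApprox b u =
      (Real.log ‖Complex.Gamma (u + b)‖ - stirlingMain b u)
        + (b - 1 / 2) * (Real.log ‖u + 1‖ - Real.log (1 + ‖u‖)) := by
    rw [stirlingApprox, stirlingMain]; ring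
  rw [e]
  refine (abs_add_le _ _).trans (add_le_add (hC u hu) ?_)
  rw [abs_mul]
  gcongr
  exact abs_log_norm_add_one_sub_le hu

/-- Stirling's formula with bounded error, in multiplicative form. -/
lemma exists_norm_Gamma_bounds {b : ℝ} (hb : 0 < b) :
    ∃ C, 0 < C ∧ ∀ u : ℂ, 0 ≤ u.re →
      ‖Complex.Gamma (u + b)‖ ≤ C * Real.exp (stirlingApprox b u) ∧
      Real.exp (stirlingApprox b u) ≤ C * ‖Complex.Gamma (u + b)‖ := by
  obtain ⟨C, hC⟩ := exists_abs_log_norm_Gamma_sub_le hb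
  refine ⟨Real.exp C, Real.exp_pos _, fun u hu => ?_⟩
  have hΓ : Complex.Gamma (u + b) ≠ 0 := by
    apply Complex.Gamma_ne_zero_of_re_pos
    simp; linarith
  have hpos := norm_pos_iff.2 hΓ
  have h := abs_le.1 (hC u hu)
  constructor
  · rw [← Real.exp_add, ← Real.log_le_iff_le_exp hpos]; linarith [h.2]
  · rw [← Real.log_le_log_iff (Real.exp_pos _) (by positivity), Real.log_mul (Real.exp_pos _).ne'
      hpos.ne', Real.log_exp, Real.log_exp]
    linarith [h.1]

/-- The polynomial `t (t-1) ⋯ (t-n+1)`. -/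
noncomputable def fallingPoly (n : ℕ) (t : ℂ) : ℂ := ∏ k ∈ Finset.range n, (t - k)

lemma Gamma_add_one_eq_fallingPoly_mul (n : ℕ) {t : ℂ} (ht : ∀ k < n, t ≠ k) :
    Complex.Gamma (t + 1) = fallingPoly n t * Complex.Gamma (t - n + 1) := by
  induction n with
  | zero => simp [fallingPoly]
  | succ n ih =>
    rw [ih fun k hk => ht k (by omega), fallingPoly, fallingPoly, Finset.prod_range_succ,
      Complex.Gamma_add_one _ (sub_ne_zero.2 (ht n (by omega)))]
    have : t - (n + 1 : ℕ) + 1 = t - n := by push_cast; ring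
    rw [this]
    ring

lemma norm_fallingPoly_mul_pi (n : ℕ) {t : ℂ} (ht : ∀ k : ℤ, t ≠ k) :
    ‖fallingPoly n t‖ * Real.pi =
      ‖Complex.Gamma (t + 1)‖ * ‖Complex.Gamma (n - t)‖ * ‖Complex.sin (Real.pi * t)‖ := by
  have h1 := Gamma_add_one_eq_fallingPoly_mul n (t := t) fun k _ => by simpa using ht k
  have h2 := Complex.Gamma_mul_Gamma_one_sub (t - n + 1)
  have e1 : 1 - (t - n + 1) = n - t := by ring
  have e2 : Complex.sin (Real.pi * (t - n + 1)) = -((-1) ^ n * Complex.sin (Real.pi * t)) := by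
    have : (Real.pi : ℂ) * (t - n + 1) = Real.pi * t - n * Real.pi + Real.pi := by ring
    rw [this, Complex.sin_add_pi, Complex.sin_antiperiodic.sub_nat_mul_eq n]
  have hs : Complex.sin (Real.pi * t) ≠ 0 := by
    intro h
    obtain ⟨k, hk⟩ := Complex.sin_eq_zero_iff.1 h
    have hpi : (Real.pi : ℂ) ≠ 0 := by exact_mod_cast Real.pi_ne_zero
    exact ht k (mul_left_cancel₀ hpi (by rw [hk]; ring))
  rw [e1, e2] at h2
  have h3 := congrArg norm h2
  rw [norm_mul, norm_div, norm_neg, norm_mul, norm_pow, norm_neg, norm_one, one_pow, one_mul,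
    Complex.norm_real, Real.norm_eq_abs, abs_of_pos Real.pi_pos,
    eq_div_iff (norm_ne_zero_iff.2 hs)] at h3
  rw [h1, norm_mul]
  linear_combination (-‖fallingPoly n t‖) * h3

lemma arg_neg_mul_im (z : ℂ) : z.im * (Complex.arg (-z) - Complex.arg z) = -(Real.pi * |z.im|) := by
  rcases lt_trichotomy z.im 0 with h | h | h
  · rw [Complex.arg_neg_eq_arg_add_pi_of_im_neg h, abs_of_neg h]; ring
  · simp [h]
  · rw [Complex.arg_neg_eq_arg_sub_pi_of_im_pos h, abs_of_pos h]; ring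

lemma xlogRe_neg (z : ℂ) : xlogRe (-z) = -xlogRe z - Real.pi * |z.im| := by
  rw [xlogRe_eq, xlogRe_eq, norm_neg, Complex.neg_re, Complex.neg_im]
  linarith [arg_neg_mul_im z]

lemma norm_sin_le_exp (z : ℂ) : ‖Complex.sin z‖ ≤ Real.exp |z.im| := by
  have h1 : ‖Complex.exp (-z * I)‖ ≤ Real.exp |z.im| := by
    rw [Complex.norm_exp]; simp; exact le_abs_self _
  have h2 : ‖Complex.exp (z * I)‖ ≤ Real.exp |z.im| := by
    rw [Complex.norm_exp]; simp; exact neg_le_abs _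
  rw [Complex.sin, norm_div, norm_mul, Complex.norm_I, mul_one, Complex.norm_two,
    div_le_iff₀ two_pos]
  refine (norm_sub_le _ _).trans ?_
  linarith

lemma sinh_abs_im_le_norm_sin (z : ℂ) : Real.sinh |z.im| ≤ ‖Complex.sin z‖ := by
  have h1 : ‖Complex.exp (-z * I)‖ = Real.exp z.im := by
    rw [Complex.norm_exp]; simp
  have h2 : ‖Complex.exp (z * I)‖ = Real.exp (-z.im) := by
    rw [Complex.norm_exp]; simp
  rw [Complex.sin, norm_div, norm_mul, Complex.norm_I, mul_one, Complex.norm_two, Real.sinh_eq]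
  gcongr
  have h := abs_norm_sub_norm_le (Complex.exp (-z * I)) (Complex.exp (z * I))
  rw [h1, h2] at h
  refine le_trans ?_ h
  rcases abs_cases z.im with ⟨ha, _⟩ | ⟨ha, _⟩ <;> rw [ha]
  · exact le_abs_self _
  · rw [neg_neg]; exact (by linarith [neg_abs_le (Real.exp z.im - Real.exp (-z.im))])

lemma exp_abs_im_le_of_le_norm_sin {κ : ℝ} (hκ : 0 < κ) {z : ℂ} (hz : κ ≤ ‖Complex.sin z‖) :
    Real.exp |z.im| ≤ (2 + 1 / κ) * ‖Complex.sin z‖ := by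
  have h1 := sinh_abs_im_le_norm_sin z
  have h2 : Real.exp |z.im| = 2 * Real.sinh |z.im| + Real.exp (-|z.im|) := by
    rw [Real.sinh_eq]; ring
  have h3 : Real.exp (-|z.im|) ≤ 1 := by
    rw [Real.exp_le_one_iff]; simp
  have h4 : 1 ≤ 1 / κ * ‖Complex.sin z‖ := by
    rw [one_div, ← div_eq_inv_mul, le_div_iff₀ hκ]; linarith
  linarith

/-- The approximation of `log |fallingPoly n (u - 1/4)|`. -/
noncomputable def fallingApprox (n : ℕ) (u : ℂ) : ℝ :=
  xlogRe u - xlogRe (u - n) - n + 1 / 4 * Real.log (1 + ‖u‖) - 1 / 4 * Real.log (1 + ‖u - n‖)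

lemma fallingApprox_eq_of_sub (n : ℕ) (u : ℂ) :
    fallingApprox n u = stirlingApprox (3 / 4) u + stirlingApprox (1 / 4) (n - u)
      + Real.pi * |u.im| := by
  have e : (n : ℂ) - u = -(u - n) := by ring
  rw [stirlingApprox, stirlingApprox, e, xlogRe_neg, norm_neg, fallingApprox]
  simp
  ring

lemma fallingApprox_eq_of_add (n : ℕ) (u : ℂ) :
    fallingApprox n u = stirlingApprox (3 / 4) u - stirlingApprox (3 / 4) (u - n) := by
  rw [stirlingApprox, stirlingApprox, fallingApprox]
  simp
  ring

lemma fallingPoly_norm_of_le {n : ℕ} {u : ℂ} (hn : n ≤ u.re) :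
    ‖Complex.Gamma (u + (3 / 4 : ℝ))‖ = ‖fallingPoly n (u - 1 / 4)‖ *
      ‖Complex.Gamma ((u - n) + (3 / 4 : ℝ))‖ := by
  have h := Gamma_add_one_eq_fallingPoly_mul n (t := u - 1 / 4) (by
    intro k hk h
    have := congrArg Complex.re h
    simp at this
    have hk' : (k : ℝ) + 1 ≤ n := by exact_mod_cast hk
    linarith)
  have e1 : u - 1 / 4 + 1 = u + (3 / 4 : ℝ) := by push_cast; ring
  have e2 : u - 1 / 4 - n + 1 = (u - n) + (3 / 4 : ℝ) := by push_cast; ring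
  rw [e1, e2] at h
  rw [h, norm_mul]

lemma fallingPoly_norm_of_lt {n : ℕ} {u : ℂ} (ht : ∀ k : ℤ, u - 1 / 4 ≠ k) :
    ‖fallingPoly n (u - 1 / 4)‖ * Real.pi = ‖Complex.Gamma (u + (3 / 4 : ℝ))‖ *
      ‖Complex.Gamma ((n - u) + (1 / 4 : ℝ))‖ * ‖Complex.sin (Real.pi * (u - 1 / 4))‖ := by
  have h := norm_fallingPoly_mul_pi n ht
  have e1 : u - 1 / 4 + 1 = u + (3 / 4 : ℝ) := by push_cast; ring
  have e2 : n - (u - 1 / 4) = (n - u) + (1 / 4 : ℝ) := by push_cast; ring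
  rwa [e1, e2] at h

lemma exists_norm_fallingPoly_le :
    ∃ C, 0 < C ∧ ∀ (n : ℕ) (u : ℂ), 0 ≤ u.re →
      ‖fallingPoly n (u - 1 / 4)‖ ≤ C * Real.exp (fallingApprox n u) := by
  obtain ⟨C₁, hC₁, h₁⟩ := exists_norm_Gamma_bounds (b := 3 / 4) (by norm_num)
  obtain ⟨C₂, hC₂, h₂⟩ := exists_norm_Gamma_bounds (b := 1 / 4) (by norm_num)
  refine ⟨C₁ * C₁ + C₁ * C₂, by positivity, fun n u hu => ?_⟩
  rcases le_or_gt (n : ℝ) u.re with hn | hn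
  · have e := fallingPoly_norm_of_le hn
    have a1 := (h₁ u hu).1
    have a2 := (h₁ (u - n) (by simpa using hn)).2
    rw [fallingApprox_eq_of_add, Real.exp_sub, mul_div_assoc', le_div_iff₀ (Real.exp_pos _)]
    calc _ ≤ ‖fallingPoly n (u - 1 / 4)‖ * (C₁ * ‖Complex.Gamma ((u - n) + (3 / 4 : ℝ))‖) := by
          gcongr
      _ = C₁ * ‖Complex.Gamma (u + (3 / 4 : ℝ))‖ := by rw [e]; ring
      _ ≤ C₁ * (C₁ * Real.exp (stirlingApprox (3 / 4) u)) := by gcongr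
      _ ≤ _ := by
        have := mul_pos (mul_pos hC₁ hC₂) (Real.exp_pos (stirlingApprox (3 / 4) u))
        nlinarith
  · by_cases ht : ∀ k : ℤ, u - 1 / 4 ≠ k
    · have e := fallingPoly_norm_of_lt (n := n) ht
      have a1 := (h₁ u hu).1
      have a2 := (h₂ (n - u) (by simpa using hn.le)).1
      have a3 := norm_sin_le_exp (Real.pi * (u - 1 / 4))
      have a4 : |((Real.pi : ℂ) * (u - 1 / 4)).im| = Real.pi * |u.im| := by
        have : ((Real.pi : ℂ) * (u - 1 / 4)).im = Real.pi * u.im := by simp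
        rw [this, abs_mul, abs_of_pos Real.pi_pos]
      rw [a4] at a3
      have a5 : ‖fallingPoly n (u - 1 / 4)‖ ≤ ‖fallingPoly n (u - 1 / 4)‖ * Real.pi := by
        have := Real.pi_gt_three
        nlinarith [norm_nonneg (fallingPoly n (u - 1 / 4))]
      refine a5.trans ?_
      rw [e, fallingApprox_eq_of_sub, Real.exp_add, Real.exp_add]
      calc _ ≤ (C₁ * Real.exp (stirlingApprox (3 / 4) u)) *
            (C₂ * Real.exp (stirlingApprox (1 / 4) (n - u)))
            * Real.exp (Real.pi * |u.im|) := by gcongr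
        _ = C₁ * C₂ * (Real.exp (stirlingApprox (3 / 4) u) *
            Real.exp (stirlingApprox (1 / 4) (n - u))
            * Real.exp (Real.pi * |u.im|)) := by ring
        _ ≤ _ := by
          gcongr
          have := mul_pos hC₁ hC₁
          linarith
    · push Not at ht
      obtain ⟨k, hk⟩ := ht
      have hre := congrArg Complex.re hk
      simp at hre
      have hk0 : 0 ≤ k := by
        have : (-1 : ℝ) < k := by linarith
        have : (-1 : ℤ) < k := by exact_mod_cast this
        omega
      have hkn : k < n := by
        have : (k : ℝ) < n := by linarith
        exact_mod_cast this
      have : fallingPoly n (u - 1 / 4) = 0 := by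
        refine Finset.prod_eq_zero (i := k.toNat) (Finset.mem_range.2 (by omega)) ?_
        rw [hk, sub_eq_zero]
        obtain ⟨m, rfl⟩ := Int.eq_ofNat_of_zero_le hk0
        simp
      rw [this, norm_zero]
      positivity

lemma exists_le_norm_fallingPoly {κ : ℝ} (hκ : 0 < κ) :
    ∃ C, 0 < C ∧ ∀ (n : ℕ) (u : ℂ), 0 ≤ u.re →
      (n ≤ u.re ∨ κ ≤ ‖Complex.sin (Real.pi * (u - 1 / 4))‖) →
      Real.exp (fallingApprox n u) ≤ C * ‖fallingPoly n (u - 1 / 4)‖ := by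
  obtain ⟨C₁, hC₁, h₁⟩ := exists_norm_Gamma_bounds (b := 3 / 4) (by norm_num)
  obtain ⟨C₂, hC₂, h₂⟩ := exists_norm_Gamma_bounds (b := 1 / 4) (by norm_num)
  set K := 2 + 1 / κ
  have hK : 0 < K := by positivity
  refine ⟨C₁ * C₁ + C₁ * C₂ * K * Real.pi, by positivity, fun n u hu hu2 => ?_⟩
  have hP := norm_nonneg (fallingPoly n (u - 1 / 4))
  rcases le_or_gt (n : ℝ) u.re with hn | hn
  · have e := fallingPoly_norm_of_le hn
    have a1 := (h₁ u hu).2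
    have a2 := (h₁ (u - n) (by simpa using hn)).1
    rw [fallingApprox_eq_of_add, Real.exp_sub, div_le_iff₀ (Real.exp_pos _)]
    calc _ ≤ C₁ * ‖Complex.Gamma (u + (3 / 4 : ℝ))‖ := a1
      _ = C₁ * (‖fallingPoly n (u - 1 / 4)‖ * ‖Complex.Gamma ((u - n) + (3 / 4 : ℝ))‖) := by rw [e]
      _ ≤ C₁ * (‖fallingPoly n (u - 1 / 4)‖ *
          (C₁ * Real.exp (stirlingApprox (3 / 4) (u - n)))) := by
        gcongr
      _ = C₁ * C₁ * ‖fallingPoly n (u - 1 / 4)‖ * Real.exp (stirlingApprox (3 / 4) (u - n)) := by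
        ring
      _ ≤ _ := by
        gcongr
        have : 0 < C₁ * C₂ * K * Real.pi := by positivity
        linarith
  · have hs := hu2.resolve_left (not_le.2 hn)
    have ht : ∀ k : ℤ, u - 1 / 4 ≠ k := by
      intro k hk
      rw [hk, mul_comm, Complex.sin_int_mul_pi, norm_zero] at hs
      linarith
    have e := fallingPoly_norm_of_lt (n := n) ht
    have a1 := (h₁ u hu).2
    have a2 := (h₂ (n - u) (by simpa using hn.le)).2
    have a3 := exp_abs_im_le_of_le_norm_sin hκ hs
    have a4 : |((Real.pi : ℂ) * (u - 1 / 4)).im| = Real.pi * |u.im| := by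
      have : ((Real.pi : ℂ) * (u - 1 / 4)).im = Real.pi * u.im := by simp
      rw [this, abs_mul, abs_of_pos Real.pi_pos]
    rw [a4] at a3
    rw [fallingApprox_eq_of_sub, Real.exp_add, Real.exp_add]
    calc _ ≤ (C₁ * ‖Complex.Gamma (u + (3 / 4 : ℝ))‖) *
            (C₂ * ‖Complex.Gamma ((n - u) + (1 / 4 : ℝ))‖)
            * (K * ‖Complex.sin (Real.pi * (u - 1 / 4))‖) := by gcongr
      _ = C₁ * C₂ * K * (‖Complex.Gamma (u + (3 / 4 : ℝ))‖ * ‖Complex.Gamma ((n - u) + (1 / 4 : ℝ))‖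
            * ‖Complex.sin (Real.pi * (u - 1 / 4))‖) := by ring
      _ = C₁ * C₂ * K * Real.pi * ‖fallingPoly n (u - 1 / 4)‖ := by rw [← e]; ring
      _ ≤ _ := by
        gcongr
        have : 0 < C₁ * C₁ := by positivity
        linarith

/-- The product of the Gamma functions attached to `ν 1, …, ν M`. -/
noncomputable def gammaProd (M : ℕ) (ν : ℕ → ℕ) (t : ℂ) : ℂ :=
  ∏ j ∈ Finset.range M, Complex.Gamma (t + ν (j + 1) + 1)

/-- The function `F` for which the kernel integrand is `F(s)/F(t) x^t y^{-s-1}/(s-t)`. -/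
noncomputable def weightF (M : ℕ) (ν : ℕ → ℕ) (n : ℕ) (t : ℂ) : ℂ :=
  gammaProd M ν t * fallingPoly n t

lemma exists_gammaProd_bounds (M : ℕ) (ν : ℕ → ℕ) :
    ∃ C, 0 < C ∧ ∀ u : ℂ, 0 ≤ u.re →
      ‖gammaProd M ν (u - 1 / 4)‖ ≤
        C * Real.exp (∑ j ∈ Finset.range M, stirlingApprox (ν (j + 1) + 3 / 4) u) ∧
      Real.exp (∑ j ∈ Finset.range M, stirlingApprox (ν (j + 1) + 3 / 4) u) ≤
        C * ‖gammaProd M ν (u - 1 / 4)‖ := by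
  have h : ∀ j : ℕ, ∃ C, 0 < C ∧ ∀ u : ℂ, 0 ≤ u.re →
      ‖Complex.Gamma (u - 1 / 4 + ν (j + 1) + 1)‖ ≤
        C * Real.exp (stirlingApprox (ν (j + 1) + 3 / 4) u) ∧
      Real.exp (stirlingApprox (ν (j + 1) + 3 / 4) u) ≤
        C * ‖Complex.Gamma (u - 1 / 4 + ν (j + 1) + 1)‖ := by
    intro j
    obtain ⟨C, hC, h⟩ := exists_norm_Gamma_bounds (b := ν (j + 1) + 3 / 4) (by positivity)
    refine ⟨C, hC, fun u hu => ?_⟩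
    have e : u - 1 / 4 + ν (j + 1) + 1 = u + ((ν (j + 1) + 3 / 4 : ℝ) : ℂ) := by push_cast; ring
    rw [e]
    exact h u hu
  choose C hC hb using h
  refine ⟨∏ j ∈ Finset.range M, C j, Finset.prod_pos fun j _ => hC j, fun u hu => ?_⟩
  rw [gammaProd, norm_prod, Real.exp_sum, ← Finset.prod_mul_distrib, ← Finset.prod_mul_distrib]
  constructor
  · exact Finset.prod_le_prod (fun j _ => norm_nonneg _) fun j _ => (hb j u hu).1
  · exact Finset.prod_le_prod (fun j _ => (Real.exp_pos _).le) fun j _ => (hb j u hu).2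

/-- The approximation of `log |F(u - 1/4)|`. -/
noncomputable def weightApprox (M : ℕ) (ν : ℕ → ℕ) (n : ℕ) (u : ℂ) : ℝ :=
  (∑ j ∈ Finset.range M, stirlingApprox (ν (j + 1) + 3 / 4) u) + fallingApprox n u

lemma exists_norm_weightF_le (M : ℕ) (ν : ℕ → ℕ) :
    ∃ C, 0 < C ∧ ∀ (n : ℕ) (u : ℂ), 0 ≤ u.re →
      ‖weightF M ν n (u - 1 / 4)‖ ≤ C * Real.exp (weightApprox M ν n u) := by
  obtain ⟨C₁, hC₁, h₁⟩ := exists_gammaProd_bounds M ν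
  obtain ⟨C₂, hC₂, h₂⟩ := exists_norm_fallingPoly_le
  refine ⟨C₁ * C₂, by positivity, fun n u hu => ?_⟩
  rw [weightF, norm_mul, weightApprox, Real.exp_add, mul_mul_mul_comm]
  have := (h₁ u hu).1
  have := h₂ n u hu
  gcongr

lemma exists_le_norm_weightF (M : ℕ) (ν : ℕ → ℕ) {κ : ℝ} (hκ : 0 < κ) :
    ∃ C, 0 < C ∧ ∀ (n : ℕ) (u : ℂ), 0 ≤ u.re →
      (n ≤ u.re ∨ κ ≤ ‖Complex.sin (Real.pi * (u - 1 / 4))‖) →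
      Real.exp (weightApprox M ν n u) ≤ C * ‖weightF M ν n (u - 1 / 4)‖ := by
  obtain ⟨C₁, hC₁, h₁⟩ := exists_gammaProd_bounds M ν
  obtain ⟨C₂, hC₂, h₂⟩ := exists_le_norm_fallingPoly hκ
  refine ⟨C₁ * C₂, by positivity, fun n u hu hu2 => ?_⟩
  rw [weightF, norm_mul, weightApprox, Real.exp_add, mul_mul_mul_comm]
  have := (h₁ u hu).2
  have := h₂ n u hu hu2
  gcongr

/-- The real part of the phase function. -/
noncomputable def phase (M : ℕ) (x0 : ℝ) (z : ℂ) : ℝ :=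
  (M + 1) * xlogRe z - xlogRe (z - 1) - M * z.re - z.re * Real.log x0

lemma xlogRe_natCast_mul {n : ℕ} (hn : 0 < n) (z : ℂ) :
    xlogRe (n * z) = n * (z.re * Real.log n + xlogRe z) := by
  have hn' : (0 : ℝ) < n := by exact_mod_cast hn
  by_cases hz : z = 0
  · simp [hz, xlogRe]
  have e : (n : ℂ) * z = ((n : ℝ) : ℂ) * z := by simp
  rw [xlogRe, xlogRe, e, Complex.log_ofReal_mul hn' hz, mul_assoc, Complex.re_ofReal_mul]
  congr 1
  rw [mul_add, Complex.add_re, mul_comm z, Complex.re_ofReal_mul]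
  ring

/-- The total exponent of the algebraic prefactor. -/
noncomputable def prefactorExp (M : ℕ) (ν : ℕ → ℕ) : ℝ :=
  (∑ j ∈ Finset.range M, ((ν (j + 1) : ℝ) + 1 / 4)) + 1 / 4

lemma prefactorExp_pos (M : ℕ) (ν : ℕ → ℕ) : 0 < prefactorExp M ν := by
  unfold prefactorExp
  have : 0 ≤ ∑ j ∈ Finset.range M, ((ν (j + 1) : ℝ) + 1 / 4) :=
    Finset.sum_nonneg fun j _ => by positivity
  linarith

lemma weightApprox_natCast_mul (M : ℕ) (ν : ℕ → ℕ) (x0 : ℝ) {n : ℕ} (hn : 0 < n) (z : ℂ) :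
    weightApprox M ν n (n * z) = n * phase M x0 z
      + n * z.re * (M * Real.log n + Real.log x0) + n * Real.log n - n
      + prefactorExp M ν * Real.log (1 + n * ‖z‖) - 1 / 4 * Real.log (1 + n * ‖z - 1‖) := by
  have e1 : (n : ℂ) * z - n = n * (z - 1) := by ring
  have e2 : ∀ z : ℂ, ‖(n : ℂ) * z‖ = n * ‖z‖ := by intro z; simp
  have e3 : ((n : ℂ) * z).re = n * z.re := by simp
  have e4 : ∑ j ∈ Finset.range M, stirlingApprox (ν (j + 1) + 3 / 4) (n * z) =
      M * (xlogRe (n * z) - n * z.re)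
        + (∑ j ∈ Finset.range M, ((ν (j + 1) : ℝ) + 1 / 4)) * Real.log (1 + n * ‖z‖) := by
    simp only [stirlingApprox, e2, e3]
    rw [Finset.sum_add_distrib, Finset.sum_const, Finset.card_range, nsmul_eq_mul, Finset.sum_mul]
    congr 1
    refine Finset.sum_congr rfl fun j _ => ?_
    ring
  rw [weightApprox, e4, fallingApprox, e1, e2, e2, xlogRe_natCast_mul hn, xlogRe_natCast_mul hn,
    phase, prefactorExp]
  simp only [Complex.sub_re, Complex.one_re]
  ring

section

lemma contDiff_eval (p : Polynomial ℝ) {k : ℕ} : ContDiff ℝ k fun x : ℝ => p.eval x := by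
  simpa using p.contDiff_aeval (𝕜 := ℝ) k

lemma mul_cos_mul_sin_sub_neg {a b : ℝ} (hb : 0 < b) (hab : b < a) {θ : ℝ} (hθ : 0 < θ)
    (hθ' : a * θ ≤ Real.pi) :
    a * Real.cos (a * θ) * Real.sin (b * θ) - b * Real.sin (a * θ) * Real.cos (b * θ) < 0 := by
  have ha : 0 < a := hb.trans hab
  let D : ℝ → ℝ := fun x =>
    a * Real.cos (a * x) * Real.sin (b * x) - b * Real.sin (a * x) * Real.cos (b * x)
  have hD : ∀ x, HasDerivAt D (-(a ^ 2 - b ^ 2) * (Real.sin (a * x) * Real.sin (b * x))) x := by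
    intro x
    have h1 : HasDerivAt (fun x : ℝ => a * x) a x := by simpa using (hasDerivAt_id x).const_mul a
    have h2 : HasDerivAt (fun x : ℝ => b * x) b x := by simpa using (hasDerivAt_id x).const_mul b
    refine (((h1.cos.const_mul a).mul h2.sin).sub ((h1.sin.const_mul b).mul h2.cos)).congr_deriv ?_
    ring
  have hanti : StrictAntiOn D (Set.Icc 0 (Real.pi / a)) := by
    refine strictAntiOn_of_deriv_neg (convex_Icc _ _)
      (fun x _ => (hD x).continuousAt.continuousWithinAt) fun x hx => ?_
    rw [interior_Icc] at hx
    have hx1 : a * x < Real.pi := by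
      have := (lt_div_iff₀ ha).1 hx.2
      linarith
    rw [(hD x).deriv]
    have s1 := Real.sin_pos_of_pos_of_lt_pi (mul_pos ha hx.1) hx1
    have s2 := Real.sin_pos_of_pos_of_lt_pi (mul_pos hb hx.1)
      ((mul_lt_mul_of_pos_right hab hx.1).trans hx1)
    have h3 : 0 < a ^ 2 - b ^ 2 := by nlinarith
    have := mul_pos h3 (mul_pos s1 s2)
    linarith
  have hle : θ ≤ Real.pi / a := by rw [le_div_iff₀ ha]; linarith
  have := hanti (Set.left_mem_Icc.2 (by positivity)) ⟨hθ.le, hle⟩ hθ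
  simpa [D] using this

/-- The polar radius of the saddle curve. -/
noncomputable def saddleRadius (M : ℕ) (θ : ℝ) : ℝ :=
  (Polynomial.Chebyshev.U ℝ M).eval (Real.cos θ) /
    (Polynomial.Chebyshev.U ℝ (M - 1)).eval (Real.cos θ)

/-- The curve on which the phase function has real derivative. -/
noncomputable def saddleCurve (M : ℕ) (θ : ℝ) : ℂ :=
  saddleRadius M θ * Complex.exp (θ * I)

section Angles

variable {M : ℕ} {θ : ℝ}

lemma add_one_mul_lt_pi (hθ' : θ < Real.pi / (M + 1)) : ((M : ℝ) + 1) * θ < Real.pi := by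
  have := (lt_div_iff₀ (by positivity)).1 hθ'
  linarith

lemma add_one_mul_le_pi (hθ' : θ ≤ Real.pi / (M + 1)) : ((M : ℝ) + 1) * θ ≤ Real.pi := by
  have := (le_div_iff₀ (by positivity)).1 hθ'
  linarith

lemma mul_lt_pi (hθ : 0 < θ) (hθ' : θ ≤ Real.pi / (M + 1)) : (M : ℝ) * θ < Real.pi := by
  linarith [add_one_mul_le_pi hθ']

lemma lt_pi_of_le (hM : 1 ≤ M) (hθ : 0 < θ) (hθ' : θ ≤ Real.pi / (M + 1)) : 2 * θ ≤ Real.pi := by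
  have h1 : (1 : ℝ) ≤ M := by exact_mod_cast hM
  nlinarith [add_one_mul_le_pi hθ']

lemma sin_nat_mul_pos (hM : 1 ≤ M) (hθ : 0 < θ) (hθ' : θ ≤ Real.pi / (M + 1)) :
    0 < Real.sin (M * θ) := by
  have h1 : (1 : ℝ) ≤ M := by exact_mod_cast hM
  exact Real.sin_pos_of_pos_of_lt_pi (by positivity) (mul_lt_pi hθ hθ')

lemma sin_add_one_mul_pos (hθ : 0 < θ) (hθ' : θ < Real.pi / (M + 1)) :
    0 < Real.sin ((M + 1) * θ) :=
  Real.sin_pos_of_pos_of_lt_pi (by positivity) (add_one_mul_lt_pi hθ')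

lemma sin_pos_of_le (hM : 1 ≤ M) (hθ : 0 < θ) (hθ' : θ ≤ Real.pi / (M + 1)) :
    0 < Real.sin θ :=
  Real.sin_pos_of_pos_of_lt_pi hθ (by linarith [lt_pi_of_le hM hθ hθ', Real.pi_pos])

lemma chebyshevU_cos_mul_sin (M : ℕ) (θ : ℝ) :
    (Polynomial.Chebyshev.U ℝ M).eval (Real.cos θ) * Real.sin θ = Real.sin ((M + 1) * θ) := by
  simp

lemma chebyshevU_sub_one_cos_mul_sin (M : ℕ) (θ : ℝ) :
    (Polynomial.Chebyshev.U ℝ (M - 1)).eval (Real.cos θ) * Real.sin θ = Real.sin (M * θ) := by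
  simp

lemma chebyshevU_sub_one_pos (hM : 1 ≤ M) (hθ : |θ| ≤ Real.pi / (M + 1)) :
    0 < (Polynomial.Chebyshev.U ℝ (M - 1)).eval (Real.cos θ) := by
  rw [← Real.cos_abs]
  rcases (abs_nonneg θ).eq_or_lt with h | h
  · rw [← h, Real.cos_zero, Polynomial.Chebyshev.U_eval_one]
    push_cast
    have : (1 : ℝ) ≤ M := by exact_mod_cast hM
    linarith
  · have h1 := chebyshevU_sub_one_cos_mul_sin M |θ|
    have h2 := sin_nat_mul_pos hM h hθ
    rw [← h1] at h2
    exact (pos_iff_pos_of_mul_pos h2).2 (sin_pos_of_le hM h hθ)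

lemma saddleRadius_eq (hM : 1 ≤ M) (hθ : 0 < θ) (hθ' : θ ≤ Real.pi / (M + 1)) :
    saddleRadius M θ = Real.sin ((M + 1) * θ) / Real.sin (M * θ) := by
  rw [saddleRadius, ← chebyshevU_cos_mul_sin, ← chebyshevU_sub_one_cos_mul_sin,
    mul_div_mul_right _ _ (sin_pos_of_le hM hθ hθ').ne']

lemma saddleRadius_neg (M : ℕ) (θ : ℝ) : saddleRadius M (-θ) = saddleRadius M θ := by
  simp [saddleRadius]

lemma saddleRadius_abs (M : ℕ) (θ : ℝ) : saddleRadius M |θ| = saddleRadius M θ := by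
  simp [saddleRadius]

lemma saddleRadius_zero (M : ℕ) : saddleRadius M 0 = (M + 1) / M := by
  simp [saddleRadius, Polynomial.Chebyshev.U_eval_one]

lemma saddleRadius_pos (hM : 1 ≤ M) (hθ : |θ| < Real.pi / (M + 1)) : 0 < saddleRadius M θ := by
  rw [← saddleRadius_abs]
  rcases (abs_nonneg θ).eq_or_lt with h | h
  · rw [← h, saddleRadius_zero]; positivity
  · rw [saddleRadius_eq hM h hθ.le]
    exact div_pos (sin_add_one_mul_pos h hθ) (sin_nat_mul_pos hM h hθ.le)

lemma saddleRadius_end (hM : 1 ≤ M) : saddleRadius M (Real.pi / (M + 1)) = 0 := by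
  rw [saddleRadius_eq hM (by positivity) le_rfl, mul_div_cancel₀ _ (by positivity)]
  simp

lemma contDiffAt_saddleRadius (hM : 1 ≤ M) (hθ : |θ| ≤ Real.pi / (M + 1)) {k : ℕ} :
    ContDiffAt ℝ k (saddleRadius M) θ := by
  unfold saddleRadius
  refine ContDiffAt.div ?_ ?_ (chebyshevU_sub_one_pos hM hθ).ne'
  · exact ((contDiff_eval _).comp Real.contDiff_cos).contDiffAt
  · exact ((contDiff_eval _).comp Real.contDiff_cos).contDiffAt

lemma hasDerivAt_saddleRadius (hM : 1 ≤ M) (hθ : |θ| ≤ Real.pi / (M + 1)) :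
    HasDerivAt (saddleRadius M) (deriv (saddleRadius M) θ) θ :=
  ((contDiffAt_saddleRadius hM hθ (k := 1)).differentiableAt (by simp)).hasDerivAt

lemma continuousAt_deriv_saddleRadius (hM : 1 ≤ M) (hθ : |θ| ≤ Real.pi / (M + 1)) :
    ContinuousAt (deriv (saddleRadius M)) θ :=
  ((contDiffAt_saddleRadius hM hθ (k := 2)).derivWithin (m := 1) (by norm_num)).continuousAt

end Angles

end

section

lemma saddleCurve_re (M : ℕ) (θ : ℝ) :
    (saddleCurve M θ).re = saddleRadius M θ * Real.cos θ := by
  rw [saddleCurve, Complex.re_ofReal_mul, Complex.exp_ofReal_mul_I_re]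

lemma saddleCurve_im (M : ℕ) (θ : ℝ) :
    (saddleCurve M θ).im = saddleRadius M θ * Real.sin θ := by
  rw [saddleCurve, Complex.im_ofReal_mul, Complex.exp_ofReal_mul_I_im]

lemma saddleCurve_neg (M : ℕ) (θ : ℝ) :
    saddleCurve M (-θ) = (starRingEnd ℂ) (saddleCurve M θ) := by
  apply Complex.ext
  · rw [Complex.conj_re, saddleCurve_re, saddleCurve_re, saddleRadius_neg, Real.cos_neg]
  · rw [Complex.conj_im, saddleCurve_im, saddleCurve_im, saddleRadius_neg, Real.sin_neg, mul_neg]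

lemma saddleCurve_re_abs (M : ℕ) (θ : ℝ) : (saddleCurve M |θ|).re = (saddleCurve M θ).re := by
  rw [saddleCurve_re, saddleCurve_re, saddleRadius_abs, Real.cos_abs]

/-- The derivative of the saddle curve. -/
noncomputable def saddleCurveDeriv (M : ℕ) (θ : ℝ) : ℂ :=
  (deriv (saddleRadius M) θ + saddleRadius M θ * I) * Complex.exp (θ * I)

section Curve

variable {M : ℕ} {θ : ℝ}

lemma hasDerivAt_saddleCurve (hM : 1 ≤ M) (hθ : |θ| ≤ Real.pi / (M + 1)) :
    HasDerivAt (saddleCurve M) (saddleCurveDeriv M θ) θ := by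
  have h1 := (hasDerivAt_saddleRadius hM hθ).ofReal_comp
  have h2 : HasDerivAt (fun x : ℝ => (x : ℂ) * I) I θ := by
    simpa using (Complex.ofRealCLM.hasDerivAt (x := θ)).mul_const I
  refine (h1.mul h2.cexp).congr_deriv ?_
  rw [saddleCurveDeriv]
  ring

lemma continuousOn_saddleCurve (hM : 1 ≤ M) :
    ContinuousOn (saddleCurve M) (Set.Icc (-(Real.pi / (M + 1))) (Real.pi / (M + 1))) :=
  fun _ hθ => (hasDerivAt_saddleCurve hM (abs_le.2 hθ)).continuousAt.continuousWithinAt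

lemma continuousOn_saddleCurveDeriv (hM : 1 ≤ M) :
    ContinuousOn (saddleCurveDeriv M) (Set.Icc (-(Real.pi / (M + 1))) (Real.pi / (M + 1))) := by
  intro θ hθ
  have h1 := continuousAt_deriv_saddleRadius hM (abs_le.2 hθ)
  have h2 := (hasDerivAt_saddleRadius hM (abs_le.2 hθ)).continuousAt
  apply ContinuousAt.continuousWithinAt
  unfold saddleCurveDeriv
  fun_prop

lemma deriv_saddleRadius_neg (hM : 1 ≤ M) (hθ : 0 < θ) (hθ' : θ < Real.pi / (M + 1)) :
    deriv (saddleRadius M) θ < 0 := by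
  have h1 : saddleRadius M =ᶠ[nhds θ] fun x => Real.sin ((M + 1) * x) / Real.sin (M * x) := by
    filter_upwards [Ioo_mem_nhds hθ hθ'] with x hx using saddleRadius_eq hM hx.1 hx.2.le
  have hs := sin_nat_mul_pos hM hθ hθ'.le
  have d : ∀ a : ℝ, HasDerivAt (fun x : ℝ => a * x) a θ := fun a => by
    simpa using (hasDerivAt_id θ).const_mul a
  have hd : HasDerivAt (fun x => Real.sin ((M + 1) * x) / Real.sin (M * x)) _ θ :=
    (d (M + 1)).sin.div (d M).sin hs.ne'
  rw [h1.deriv_eq, hd.deriv]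
  refine div_neg_of_neg_of_pos ?_ (by positivity)
  have := mul_cos_mul_sin_sub_neg (a := M + 1) (b := M) (by exact_mod_cast hM) (by simp) hθ
    (add_one_mul_le_pi hθ'.le)
  linarith

lemma hasDerivAt_saddleCurve_re (hM : 1 ≤ M) (hθ : |θ| ≤ Real.pi / (M + 1)) :
    HasDerivAt (fun x => (saddleCurve M x).re) (saddleCurveDeriv M θ).re θ :=
  Complex.reCLM.hasFDerivAt.comp_hasDerivAt θ (hasDerivAt_saddleCurve hM hθ)

lemma saddleCurveDeriv_re_neg (hM : 1 ≤ M) (hθ : 0 < θ) (hθ' : θ < Real.pi / (M + 1)) :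
    (saddleCurveDeriv M θ).re < 0 := by
  have h1 := deriv_saddleRadius_neg hM hθ hθ'
  have h2 : 0 < saddleRadius M θ := saddleRadius_pos hM (by rwa [abs_of_pos hθ])
  have h3 := sin_pos_of_le hM hθ hθ'.le
  have h4 : 0 ≤ Real.cos θ := Real.cos_nonneg_of_mem_Icc
    ⟨by linarith [Real.pi_pos], by linarith [lt_pi_of_le hM hθ hθ'.le]⟩
  have : (saddleCurveDeriv M θ).re =
      deriv (saddleRadius M) θ * Real.cos θ - saddleRadius M θ * Real.sin θ := by
    simp [saddleCurveDeriv, Complex.exp_ofReal_mul_I_re, Complex.exp_ofReal_mul_I_im]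
  rw [this]
  nlinarith [mul_pos h2 h3, mul_nonneg (neg_nonneg.2 h1.le) h4]

lemma strictAntiOn_saddleCurve_re (hM : 1 ≤ M) :
    StrictAntiOn (fun x => (saddleCurve M x).re) (Set.Icc 0 (Real.pi / (M + 1))) := by
  refine strictAntiOn_of_deriv_neg (convex_Icc _ _) ?_ fun x hx => ?_
  · exact fun x hx => (hasDerivAt_saddleCurve_re hM
      (by rw [abs_of_nonneg hx.1]; exact hx.2)).continuousAt.continuousWithinAt
  · rw [interior_Icc] at hx
    rw [(hasDerivAt_saddleCurve_re hM (by rw [abs_of_pos hx.1]; exact hx.2.le)).deriv]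
    exact saddleCurveDeriv_re_neg hM hx.1 hx.2

lemma saddleCurve_end (hM : 1 ≤ M) : saddleCurve M (Real.pi / (M + 1)) = 0 := by
  simp [saddleCurve, saddleRadius_end hM]

lemma saddleCurve_zero (M : ℕ) : saddleCurve M 0 = (((M + 1) / M : ℝ) : ℂ) := by
  simp [saddleCurve, saddleRadius_zero]

lemma saddleCurve_re_nonneg (hM : 1 ≤ M) (hθ : |θ| ≤ Real.pi / (M + 1)) :
    0 ≤ (saddleCurve M θ).re := by
  have h := (strictAntiOn_saddleCurve_re hM).antitoneOn (a := |θ|) (b := Real.pi / (M + 1))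
    ⟨abs_nonneg θ, hθ⟩ ⟨by positivity, le_rfl⟩ hθ
  simp only [saddleCurve_end hM, saddleCurve_re_abs] at h
  exact h

lemma saddleCurve_im_pos (hM : 1 ≤ M) (hθ : 0 < θ) (hθ' : θ < Real.pi / (M + 1)) :
    0 < (saddleCurve M θ).im := by
  rw [saddleCurve_im]
  exact mul_pos (saddleRadius_pos hM (by rwa [abs_of_pos hθ])) (sin_pos_of_le hM hθ hθ'.le)

lemma saddleCurve_sub_one (hM : 1 ≤ M) (hθ : 0 < θ) (hθ' : θ ≤ Real.pi / (M + 1)) :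
    saddleCurve M θ - 1 =
      ((Real.sin θ / Real.sin (M * θ) : ℝ) : ℂ) * Complex.exp (((M + 1) * θ : ℝ) * I) := by
  have hs := (sin_nat_mul_pos hM hθ hθ').ne'
  apply Complex.ext
  · rw [Complex.sub_re, saddleCurve_re, Complex.re_ofReal_mul, Complex.exp_ofReal_mul_I_re,
      saddleRadius_eq hM hθ hθ', Complex.one_re]
    field_simp
    have : (M : ℝ) * θ = (M + 1) * θ - θ := by ring
    rw [this, Real.sin_sub]
    ring
  · rw [Complex.sub_im, saddleCurve_im, Complex.im_ofReal_mul, Complex.exp_ofReal_mul_I_im,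
      saddleRadius_eq hM hθ hθ', Complex.one_im]
    field_simp
    ring

lemma v_pos (hM : 1 ≤ M) (hθ : 0 < θ) (hθ' : θ < Real.pi / (M + 1)) : 0 < v M θ := by
  have h1 := sin_nat_mul_pos hM hθ hθ'.le
  have h2 := sin_add_one_mul_pos hθ hθ'
  have h3 := sin_pos_of_le hM hθ hθ'.le
  unfold v
  positivity

lemma log_saddleCurve (hM : 1 ≤ M) (hθ : 0 < θ) (hθ' : θ < Real.pi / (M + 1)) :
    Complex.log (saddleCurve M θ) = Real.log (saddleRadius M θ) + θ * I := by
  have h1 := lt_pi_of_le hM hθ hθ'.le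
  have h2 := Real.pi_pos
  rw [saddleCurve, Complex.log_ofReal_mul (saddleRadius_pos hM (by rwa [abs_of_pos hθ]))
    (Complex.exp_ne_zero _), Complex.log_exp (by simp; linarith) (by simp; linarith)]

lemma log_saddleCurve_sub_one (hM : 1 ≤ M) (hθ : 0 < θ) (hθ' : θ < Real.pi / (M + 1)) :
    Complex.log (saddleCurve M θ - 1) =
      Real.log (Real.sin θ / Real.sin (M * θ)) + ((M + 1) * θ : ℝ) * I := by
  have h1 := add_one_mul_lt_pi hθ'
  have h2 := Real.pi_pos
  have h3 : (0 : ℝ) < (M + 1) * θ := by positivity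
  rw [saddleCurve_sub_one hM hθ hθ'.le, Complex.log_ofReal_mul
    (div_pos (sin_pos_of_le hM hθ hθ'.le) (sin_nat_mul_pos hM hθ hθ'.le))
    (Complex.exp_ne_zero _),
    Complex.log_exp (by rw [Complex.im_ofReal_mul]; simp; linarith)
      (by rw [Complex.im_ofReal_mul]; simp; linarith)]

/-- The derivative of the phase function. -/
noncomputable def phaseDeriv (M : ℕ) (x0 : ℝ) (z : ℂ) : ℂ :=
  (M + 1) * Complex.log z - Complex.log (z - 1) - Real.log x0

lemma phaseDeriv_saddleCurve (hM : 1 ≤ M) {x0 : ℝ} (hθ : 0 < θ)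
    (hθ' : θ < Real.pi / (M + 1)) :
    phaseDeriv M x0 (saddleCurve M θ) = ((Real.log (v M θ) - Real.log x0 : ℝ) : ℂ) := by
  have h1 := sin_nat_mul_pos hM hθ hθ'.le
  have h2 := sin_add_one_mul_pos hθ hθ'
  have h3 := sin_pos_of_le hM hθ hθ'.le
  rw [phaseDeriv, log_saddleCurve hM hθ hθ', log_saddleCurve_sub_one hM hθ hθ',
    saddleRadius_eq hM hθ hθ'.le, v, Real.log_div h2.ne' h1.ne', Real.log_div h3.ne' h1.ne',
    Real.log_div (by positivity) (by positivity), Real.log_mul h3.ne' (by positivity),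
    Real.log_pow, Real.log_pow]
  push_cast
  ring

lemma hasDerivAt_phase_comp {x0 : ℝ} {g : ℝ → ℂ} {g' : ℂ} {a : ℝ} (hg : HasDerivAt g g' a)
    (hpos : 0 < (g a).im) :
    HasDerivAt (fun x => phase M x0 (g x)) (phaseDeriv M x0 (g a) * g').re a := by
  have s1 : g a ∈ slitPlane := Or.inr hpos.ne'
  have s2 : g a - 1 ∈ slitPlane := Or.inr (by simpa using hpos.ne')
  have h0 : g a ≠ 0 := slitPlane_ne_zero s1
  have h01 : g a - 1 ≠ 0 := slitPlane_ne_zero s2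
  have d1 := hg.mul (hg.clog_real s1)
  have d2 := (hg.sub_const 1).mul ((hg.sub_const 1).clog_real s2)
  have d := (((d1.const_mul ((M : ℂ) + 1)).sub d2).sub (hg.const_mul (M : ℂ))).sub
    (hg.mul_const ((Real.log x0 : ℝ) : ℂ))
  have e := Complex.reCLM.hasFDerivAt.comp_hasDerivAt a d
  refine (e.congr_deriv ?_).congr_of_eventuallyEq (Eventually.of_forall fun x => ?_)
  · rw [Complex.reCLM_apply, phaseDeriv]
    congr 1
    field_simp
    ring
  · simp [phase, xlogRe]

end Curve

end

section

lemma sin_mul_div_sin_mul_lt {a b : ℝ} (hb : 0 < b) (hab : b < a) {θ₁ θ₂ : ℝ} (h1 : 0 < θ₁)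
    (h12 : θ₁ < θ₂) (h2 : a * θ₂ ≤ Real.pi) :
    Real.sin (a * θ₂) / Real.sin (b * θ₂) < Real.sin (a * θ₁) / Real.sin (b * θ₁) := by
  have ha : 0 < a := hb.trans hab
  have hs : ∀ x ∈ Set.Icc θ₁ θ₂, 0 < Real.sin (b * x) := fun x hx => by
    have hx0 := h1.trans_le hx.1
    refine Real.sin_pos_of_pos_of_lt_pi (by positivity) ?_
    nlinarith [hx.2]
  have d : ∀ a x : ℝ, HasDerivAt (fun x : ℝ => a * x) a x := fun a x => by
    simpa using (hasDerivAt_id x).const_mul a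
  have hd : ∀ x ∈ Set.Icc θ₁ θ₂, HasDerivAt (fun x => Real.sin (a * x) / Real.sin (b * x)) _ x :=
    fun x hx => (d a x).sin.div (d b x).sin (hs x hx).ne'
  have hanti : StrictAntiOn (fun x => Real.sin (a * x) / Real.sin (b * x)) (Set.Icc θ₁ θ₂) := by
    refine strictAntiOn_of_deriv_neg (convex_Icc _ _)
      (fun x hx => (hd x hx).continuousAt.continuousWithinAt) fun x hx => ?_
    have hx' := interior_subset hx
    have := hs x hx'
    rw [(hd x hx').deriv]
    refine div_neg_of_neg_of_pos ?_ (by positivity)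
    have := mul_cos_mul_sin_sub_neg hb hab (h1.trans_le hx'.1) (by nlinarith [hx'.2])
    linarith
  exact hanti (Set.left_mem_Icc.2 h12.le) (Set.right_mem_Icc.2 h12.le) h12

lemma phase_conj (M : ℕ) (x0 : ℝ) (z : ℂ) : phase M x0 ((starRingEnd ℂ) z) = phase M x0 z := by
  have h : ∀ z : ℂ, xlogRe ((starRingEnd ℂ) z) = xlogRe z := by
    intro z
    rw [xlogRe_eq, xlogRe_eq, Complex.arg_conj]
    split_ifs with h
    · rw [Complex.arg_eq_pi_iff] at h
      simp [h.2]
    · simp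
  have e : (starRingEnd ℂ) z - 1 = (starRingEnd ℂ) (z - 1) := by simp
  rw [phase, e, h, h, Complex.conj_re, phase]

lemma continuous_phase (M : ℕ) (x0 : ℝ) : Continuous (phase M x0) := by
  unfold phase
  have := continuous_xlogRe
  fun_prop

section

variable {M : ℕ} {θ φ x0 : ℝ}

lemma v_eq (hM : 1 ≤ M) (hθ : 0 < θ) (hθ' : θ < Real.pi / (M + 1)) :
    v M θ = (Real.sin ((M + 1) * θ) / Real.sin (M * θ)) ^ M *
      (Real.sin ((M + 1) * θ) / Real.sin (1 * θ)) := by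
  have h1 := sin_nat_mul_pos hM hθ hθ'.le
  have h3 := sin_pos_of_le hM hθ hθ'.le
  rw [v, one_mul, div_pow]
  field_simp
  exact pow_succ _ _

lemma v_lt_v (hM : 1 ≤ M) (hθ : 0 < θ) (h : θ < φ) (hφ' : φ < Real.pi / (M + 1)) :
    v M φ < v M θ := by
  have hφ := hθ.trans h
  have hθ' := h.trans hφ'
  rw [v_eq hM hφ hφ', v_eq hM hθ hθ', one_mul, one_mul]
  have hM' : (1 : ℝ) ≤ M := by exact_mod_cast hM
  have e1 := sin_mul_div_sin_mul_lt (a := M + 1) (b := M) (by positivity) (by simp) hθ h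
    (add_one_mul_le_pi hφ'.le)
  have e2 := sin_mul_div_sin_mul_lt (a := M + 1) (b := 1) (by positivity) (by linarith) hθ h
    (add_one_mul_le_pi hφ'.le)
  rw [one_mul, one_mul] at e2
  have := sin_nat_mul_pos hM hφ hφ'.le
  have := sin_add_one_mul_pos hφ hφ'
  have := sin_pos_of_le hM hφ hφ'.le
  exact mul_lt_mul'' (pow_lt_pow_left₀ e1 (by positivity) (by omega)) e2 (by positivity)
    (by positivity)

lemma continuousOn_phase_saddleCurve (hM : 1 ≤ M) :
    ContinuousOn (fun θ => phase M x0 (saddleCurve M θ))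
      (Set.Icc (-(Real.pi / (M + 1))) (Real.pi / (M + 1))) :=
  (continuous_phase M x0).comp_continuousOn (continuousOn_saddleCurve hM)

lemma hasDerivAt_phase_saddleCurve (hM : 1 ≤ M) (hθ : 0 < θ) (hθ' : θ < Real.pi / (M + 1)) :
    HasDerivAt (fun x => phase M x0 (saddleCurve M x))
      ((Real.log (v M θ) - Real.log x0) * (saddleCurveDeriv M θ).re) θ := by
  refine (hasDerivAt_phase_comp (hasDerivAt_saddleCurve hM
    (by rw [abs_of_pos hθ]; exact hθ'.le)) (saddleCurve_im_pos hM hθ hθ')).congr_deriv ?_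
  rw [phaseDeriv_saddleCurve hM hθ hθ', Complex.re_ofReal_mul]

lemma phase_saddle_lt (hM : 1 ≤ M) (hφ : 0 < φ) (hφ' : φ < Real.pi / (M + 1)) (hx0 : x0 = v M φ)
    (hθ : |θ| ≤ Real.pi / (M + 1)) (hne : |θ| ≠ φ) :
    phase M x0 (saddleCurve M φ) < phase M x0 (saddleCurve M θ) := by
  subst hx0
  have h0 : phase M (v M φ) (saddleCurve M θ) = phase M (v M φ) (saddleCurve M |θ|) := by
    rcases abs_choice θ with h | h <;> rw [h]
    rw [saddleCurve_neg, phase_conj]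
  rw [h0]
  have hp : (0 : ℝ) < Real.pi / (M + 1) := by positivity
  have ha := abs_nonneg θ
  generalize |θ| = θ at *
  rcases lt_or_gt_of_ne hne with h | h
  · refine strictAntiOn_of_deriv_neg (convex_Icc 0 φ) ((continuousOn_phase_saddleCurve hM).mono
      (Set.Icc_subset_Icc (by linarith) hφ'.le)) (fun x hx => ?_) ⟨ha, h.le⟩ ⟨hφ.le, le_rfl⟩ h
    rw [interior_Icc] at hx
    have hx' := hx.2.trans hφ'
    rw [(hasDerivAt_phase_saddleCurve hM hx.1 hx').deriv]
    refine mul_neg_of_pos_of_neg (sub_pos.2 (Real.log_lt_log (v_pos hM hφ hφ') ?_))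
      (saddleCurveDeriv_re_neg hM hx.1 hx')
    exact v_lt_v hM hx.1 hx.2 hφ'
  · refine strictMonoOn_of_deriv_pos (convex_Icc φ (Real.pi / (M + 1)))
      ((continuousOn_phase_saddleCurve hM).mono (Set.Icc_subset_Icc (by linarith) le_rfl))
      (fun x hx => ?_) ⟨le_rfl, hφ'.le⟩ ⟨h.le, hθ⟩ h
    rw [interior_Icc] at hx
    have hx0 := hφ.trans hx.1
    rw [(hasDerivAt_phase_saddleCurve hM hx0 hx.2).deriv]
    refine mul_pos_of_neg_of_neg (sub_neg.2 (Real.log_lt_log (v_pos hM hx0 hx.2) ?_))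
      (saddleCurveDeriv_re_neg hM hx0 hx.2)
    exact v_lt_v hM hφ hx.1 hx.2

lemma saddleCurve_re_pos (hM : 1 ≤ M) (hφ : 0 < φ) (hφ' : φ < Real.pi / (M + 1)) :
    0 < (saddleCurve M φ).re := by
  have := strictAntiOn_saddleCurve_re hM (a := φ) (b := Real.pi / (M + 1)) ⟨hφ.le, hφ'.le⟩
    ⟨by positivity, le_rfl⟩ hφ'
  simpa [saddleCurve_end hM] using this

/-- Along the vertical line through the saddle, the sign of the derivative of the phase. -/
lemma phaseDeriv_im_sign (hM : 1 ≤ M) (hφ : 0 < φ) (hφ' : φ < Real.pi / (M + 1)) {y : ℝ}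
    (hy : 0 < y) :
    (y < (saddleCurve M φ).im →
      (phaseDeriv M x0 ((saddleCurve M φ).re + y * I)).im < 0) ∧
    ((saddleCurve M φ).im < y →
      0 < (phaseDeriv M x0 ((saddleCurve M φ).re + y * I)).im) := by
  have hc := saddleCurve_re_pos hM hφ hφ'
  have hφ2 := lt_pi_of_le hM hφ hφ'.le
  have hφ3 : 2 * φ < Real.pi := by
    have := lt_pi_of_le hM (hφ.trans hφ') le_rfl
    linarith
  have him : (saddleCurve M φ).im = (saddleCurve M φ).re * Real.tan φ := by
    rw [saddleCurve_im, saddleCurve_re, Real.tan_eq_sin_div_cos]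
    have : Real.cos φ ≠ 0 :=
      (Real.cos_pos_of_mem_Ioo ⟨by linarith, by linarith⟩).ne'
    field_simp
  have hφmem : φ ∈ Set.Icc 0 (Real.pi / (M + 1)) := ⟨hφ.le, hφ'.le⟩
  have hanti := strictAntiOn_saddleCurve_re hM
  set c := (saddleCurve M φ).re with hcdef
  set θ := Real.arctan (y / c) with hθdef
  have hθ0 : 0 < θ := by rw [hθdef, Real.arctan_pos]; positivity
  have hθ1 : θ < Real.pi / 2 := Real.arctan_lt_pi_div_two _
  have htan : Real.tan θ = y / c := Real.tan_arctan _
  have hcos : 0 < Real.cos θ := Real.cos_pos_of_mem_Ioo ⟨by linarith, hθ1⟩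
  have hyc : y = c * Real.tan θ := by rw [htan]; field_simp
  have hiff1 : y < (saddleCurve M φ).im → θ < φ := by
    intro h
    rw [him, hyc] at h
    by_contra! hcon
    rcases hcon.eq_or_lt with e | e
    · rw [e] at h; exact lt_irrefl _ h
    · have := Real.tan_lt_tan_of_nonneg_of_lt_pi_div_two hφ.le hθ1 e
      nlinarith
  have hiff2 : (saddleCurve M φ).im < y → φ < θ := by
    intro h
    rw [him, hyc] at h
    by_contra! hcon
    rcases hcon.eq_or_lt with e | e
    · rw [e] at h; exact lt_irrefl _ h
    · have := Real.tan_lt_tan_of_nonneg_of_lt_pi_div_two hθ0.le (by linarith) e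
      nlinarith
  set z : ℂ := c + y * I with hz
  set r := c / Real.cos θ with hr
  have hr0 : 0 < r := by positivity
  have hzr : z = r * (Complex.cos θ + Complex.sin θ * I) := by
    have hcos' : (Real.cos θ : ℂ) ≠ 0 := by exact_mod_cast hcos.ne'
    rw [← Complex.ofReal_cos, ← Complex.ofReal_sin, hz, hyc, Real.tan_eq_sin_div_cos, hr,
      Complex.ofReal_mul, Complex.ofReal_div, Complex.ofReal_div]
    field_simp
  have hargz : Complex.arg z = θ := by
    rw [hzr, Complex.arg_mul_cos_add_sin_mul_I hr0 ⟨by linarith [Real.pi_pos], by linarith⟩]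
  have him1 : (z - 1).im = y := by simp [hz]
  have hz1 : z - 1 ≠ 0 := by
    intro h; rw [h] at him1; simp at him1; exact hy.ne him1
  set δ := Complex.arg (z - 1) with hδ
  have hδ0 : 0 < δ := by
    have h1 : 0 ≤ δ := Complex.arg_nonneg_iff.2 (by rw [him1]; exact hy.le)
    refine lt_of_le_of_ne h1 fun h => ?_
    have := (Complex.arg_eq_zero_iff.1 h.symm).2
    rw [him1] at this; exact hy.ne' this
  have hδ1 : δ < Real.pi := by
    refine lt_of_le_of_ne (Complex.arg_le_pi _) fun h => ?_
    have := (Complex.arg_eq_pi_iff.1 h).2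
    rw [him1] at this; exact hy.ne' this
  have hq : (phaseDeriv M x0 z).im = (M + 1) * θ - δ := by
    simp [phaseDeriv, Complex.log_im, hargz, hδ]
  have hkey : θ ≤ Real.pi / (M + 1) → ‖z - 1‖ * Real.sin (δ - (M + 1) * θ) =
      Real.sin (M * θ) * (saddleRadius M θ - r) := by
    intro h
    have e1 : ‖z - 1‖ * Real.cos δ = r * Real.cos θ - 1 := by
      rw [hδ, Complex.norm_mul_cos_arg, hzr]
      simp [← Complex.ofReal_cos, ← Complex.ofReal_sin]
    have e2 : ‖z - 1‖ * Real.sin δ = r * Real.sin θ := by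
      rw [hδ, Complex.norm_mul_sin_arg, hzr]
      simp [← Complex.ofReal_cos, ← Complex.ofReal_sin]
    have e3 : Real.sin (M * θ) * saddleRadius M θ = Real.sin ((M + 1) * θ) := by
      rw [saddleRadius_eq hM hθ0 h, mul_div_cancel₀ _ (sin_nat_mul_pos hM hθ0 h).ne']
    have e4 : (M : ℝ) * θ = (M + 1) * θ - θ := by ring
    rw [Real.sin_sub, mul_sub (Real.sin _), e3, e4, Real.sin_sub]
    linear_combination Real.cos ((M + 1) * θ) * e2 - Real.sin ((M + 1) * θ) * e1
  have hre : (saddleCurve M θ).re = saddleRadius M θ * Real.cos θ := saddleCurve_re _ _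
  have hcr : c = r * Real.cos θ := by rw [hr]; field_simp
  have hnorm : 0 < ‖z - 1‖ := norm_pos_iff.2 hz1
  have hM1 : (0 : ℝ) < M + 1 := by positivity
  rw [hq]
  constructor
  · intro h
    have hlt := hiff1 h
    have hle := (hlt.trans hφ').le
    have h1 := hanti ⟨hθ0.le, hle⟩ hφmem hlt
    simp only [← hcdef] at h1
    have h2 : 0 < saddleRadius M θ - r := by
      rw [hre] at h1
      nlinarith
    have h3 : 0 < ‖z - 1‖ * Real.sin (δ - (M + 1) * θ) := by
      rw [hkey hle]; exact mul_pos (sin_nat_mul_pos hM hθ0 hle) h2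
    have h4 : 0 < Real.sin (δ - (M + 1) * θ) := (pos_iff_pos_of_mul_pos h3).1 hnorm
    by_contra! hcon
    have := Real.sin_nonpos_of_nonpos_of_neg_pi_le (x := δ - (M + 1) * θ) (by linarith)
      (by linarith [add_one_mul_le_pi hle])
    linarith
  · intro h
    have hlt := hiff2 h
    rcases lt_or_ge θ (Real.pi / (M + 1)) with hle | hge
    · have h1 := hanti hφmem ⟨hθ0.le, hle.le⟩ hlt
      simp only [← hcdef] at h1
      have h2 : saddleRadius M θ - r < 0 := by
        rw [hre] at h1
        nlinarith
      have h3 : ‖z - 1‖ * Real.sin (δ - (M + 1) * θ) < 0 := by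
        rw [hkey hle.le]
        exact mul_neg_of_pos_of_neg (sin_nat_mul_pos hM hθ0 hle.le) h2
      have h4 : Real.sin (δ - (M + 1) * θ) < 0 := by
        by_contra! hcon
        have := mul_nonneg hnorm.le hcon
        linarith
      by_contra! hcon
      have := Real.sin_nonneg_of_nonneg_of_le_pi (x := δ - (M + 1) * θ) (by linarith)
        (by linarith [mul_pos hM1 hθ0])
      linarith
    · have := (div_le_iff₀ hM1).1 hge
      linarith

end

end

section

lemma phaseDeriv_im_eq (M : ℕ) (x0 : ℝ) (z : ℂ) :
    (phaseDeriv M x0 z).im = (M + 1) * Complex.arg z - Complex.arg (z - 1) := by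
  simp [phaseDeriv, Complex.log_im]

lemma norm_re_sin_le (z : ℂ) : |Real.sin z.re| ≤ ‖Complex.sin z‖ := by
  have h : (Complex.sin z).re = Real.sin z.re * Real.cosh z.im := by
    rw [Complex.sin_eq, ← Complex.ofReal_sin, ← Complex.ofReal_cos, ← Complex.ofReal_cosh,
      ← Complex.ofReal_sinh]
    simp [-Complex.ofReal_sin, -Complex.ofReal_cos, -Complex.ofReal_sinh, -Complex.ofReal_cosh]
  refine le_trans ?_ (Complex.abs_re_le_norm _)
  rw [h, abs_mul]
  exact le_mul_of_one_le_right (abs_nonneg _) ((Real.one_le_cosh _).trans (le_abs_self _))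

lemma tendsto_arg_add_mul_I (a : ℝ) :
    Tendsto (fun y : ℝ => Complex.arg (a + y * I)) atTop (nhds (Real.pi / 2)) := by
  have h1 : Tendsto (fun y : ℝ => ((a / y : ℝ) : ℂ) + I) atTop (nhds ((0 : ℝ) + I)) :=
    ((Complex.continuous_ofReal.tendsto 0).comp
      (tendsto_const_nhds.div_atTop tendsto_id)).add_const I
  have h2 := (Complex.continuousAt_arg (x := I) (Or.inr (by simp))).tendsto
  rw [Complex.ofReal_zero, zero_add] at h1
  have h3 := h2.comp h1
  rw [Complex.arg_I] at h3
  refine h3.congr' ?_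
  filter_upwards [eventually_gt_atTop 0] with y hy
  have : (a : ℂ) + y * I = (y : ℂ) * (((a / y : ℝ) : ℂ) + I) := by
    have : (y : ℂ) ≠ 0 := by exact_mod_cast hy.ne'
    push_cast
    field_simp
  rw [Function.comp_apply, this, Complex.arg_real_mul _ hy]

section

variable {M : ℕ} {θ φ x0 : ℝ}

lemma hasDerivAt_phase_vertical (c : ℝ) {y : ℝ} (hy : 0 < y) :
    HasDerivAt (fun y : ℝ => phase M x0 (c + y * I)) (-(phaseDeriv M x0 (c + y * I)).im) y := by
  have h : HasDerivAt (fun y : ℝ => (c : ℂ) + y * I) I y := by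
    simpa using ((Complex.ofRealCLM.hasDerivAt (x := y)).mul_const I).const_add (c : ℂ)
  refine (hasDerivAt_phase_comp h (by simpa using hy)).congr_deriv ?_
  simp

lemma continuous_phase_vertical (M : ℕ) (x0 c : ℝ) :
    Continuous fun y : ℝ => phase M x0 (c + y * I) :=
  (continuous_phase M x0).comp (by fun_prop)

lemma phase_vertical_abs (M : ℕ) (x0 c y : ℝ) :
    phase M x0 (c + (|y| : ℝ) * I) = phase M x0 (c + y * I) := by
  rcases abs_choice y with h | h <;> rw [h]
  rw [← phase_conj]
  simp

lemma phase_vertical_lt (hM : 1 ≤ M) (hφ : 0 < φ) (hφ' : φ < Real.pi / (M + 1)) {y : ℝ}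
    (hy : |y| ≠ (saddleCurve M φ).im) :
    phase M x0 ((saddleCurve M φ).re + y * I) < phase M x0 (saddleCurve M φ) := by
  rw [← phase_vertical_abs]
  conv_rhs => rw [← Complex.re_add_im (saddleCurve M φ)]
  have h0 := abs_nonneg y
  have hy0 := saddleCurve_im_pos hM hφ hφ'
  generalize |y| = y at *
  have hc := continuous_phase_vertical M x0 (saddleCurve M φ).re
  rcases lt_or_gt_of_ne hy with h | h
  · refine strictMonoOn_of_deriv_pos (convex_Icc 0 (saddleCurve M φ).im) hc.continuousOn
      (fun x hx => ?_) ⟨h0, h.le⟩ ⟨hy0.le, le_rfl⟩ h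
    rw [interior_Icc] at hx
    rw [(hasDerivAt_phase_vertical _ hx.1).deriv]
    have := (phaseDeriv_im_sign (x0 := x0) hM hφ hφ' hx.1).1 hx.2
    linarith
  · refine strictAntiOn_of_deriv_neg (convex_Ici (saddleCurve M φ).im) hc.continuousOn
      (fun x hx => ?_) self_mem_Ici h.le h
    rw [interior_Ici] at hx
    have hx0 : 0 < x := hy0.trans hx
    rw [(hasDerivAt_phase_vertical _ hx0).deriv]
    have := (phaseDeriv_im_sign (x0 := x0) hM hφ hφ' hx0).2 hx
    linarith

lemma exists_phase_vertical_le (hM : 1 ≤ M) (hφ : 0 < φ) (hφ' : φ < Real.pi / (M + 1)) :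
    ∃ ε C : ℝ, 0 < ε ∧ ∀ y : ℝ,
      phase M x0 ((saddleCurve M φ).re + y * I) ≤ C - ε * |y| := by
  set c := (saddleCurve M φ).re
  have ht : Tendsto (fun y : ℝ => (phaseDeriv M x0 (c + y * I)).im) atTop
      (nhds ((M + 1) * (Real.pi / 2) - Real.pi / 2)) := by
    simp only [phaseDeriv_im_eq]
    refine ((tendsto_arg_add_mul_I c).const_mul _).sub ?_
    refine (tendsto_arg_add_mul_I (c - 1)).congr fun y => ?_
    congr 1
    push_cast
    ring
  have hM' : (1 : ℝ) ≤ M := by exact_mod_cast hM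
  have hlim : 1 < ((M : ℝ) + 1) * (Real.pi / 2) - Real.pi / 2 := by
    nlinarith [Real.pi_gt_three]
  obtain ⟨Y, hY⟩ := (Filter.eventually_atTop.1 (ht.eventually (lt_mem_nhds hlim)))
  set Y' := max Y 1
  have hY0 : 0 < Y' := lt_of_lt_of_le one_pos (le_max_right _ _)
  have hanti : AntitoneOn (fun y : ℝ => phase M x0 (c + y * I) + y) (Set.Ici Y') := by
    have hd : ∀ y, 0 < y → HasDerivAt (fun y : ℝ => phase M x0 (c + y * I) + y) _ y :=
      fun y hy => (hasDerivAt_phase_vertical c hy).add (hasDerivAt_id y)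
    refine antitoneOn_of_deriv_nonpos (convex_Ici _) ?_ ?_ ?_
    · exact ((continuous_phase_vertical M x0 c).add continuous_id).continuousOn
    · intro y hy
      rw [interior_Ici] at hy
      exact (hd y (hY0.trans hy)).differentiableAt.differentiableWithinAt
    · intro y hy
      rw [interior_Ici] at hy
      rw [(hd y (hY0.trans hy)).deriv]
      have := hY y ((le_max_left _ _).trans hy.le)
      linarith
  have hbd : ∀ y : ℝ, phase M x0 (c + y * I) ≤ phase M x0 (saddleCurve M φ) := by
    intro y
    by_cases h : |y| = (saddleCurve M φ).im
    · rw [← phase_vertical_abs, h, Complex.re_add_im]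
    · exact (phase_vertical_lt hM hφ hφ' h).le
  refine ⟨1, phase M x0 (saddleCurve M φ) + Y', one_pos, fun y => ?_⟩
  rw [← phase_vertical_abs, one_mul]
  rcases le_total Y' |y| with h | h
  · have := hanti self_mem_Ici h h
    have := hbd Y'
    simp only at *
    linarith
  · linarith [hbd |y|]

lemma exists_mul_le_abs_saddleCurve_re_sub (hM : 1 ≤ M) (hφ : 0 < φ)
    (hφ' : φ < Real.pi / (M + 1)) :
    ∃ κ : ℝ, 0 < κ ∧ ∀ θ, |θ| ≤ Real.pi / (M + 1) →
      κ * |(|θ| - φ)| ≤ |(saddleCurve M θ).re - (saddleCurve M φ).re| := by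
  set f : ℝ → ℝ := fun x => (saddleCurve M x).re with hf
  set s := Set.Icc 0 (Real.pi / ((M : ℝ) + 1))
  have hs : s ∈ nhds φ := Icc_mem_nhds hφ hφ'
  have hd := hasDerivAt_saddleCurve_re hM (θ := φ) (by rw [abs_of_pos hφ]; exact hφ'.le)
  have hcont : ContinuousOn (dslope f φ) s := by
    refine (continuousOn_dslope hs).2 ⟨fun x hx => ?_, hd.differentiableAt⟩
    exact (hasDerivAt_saddleCurve_re hM
      (by rw [abs_of_nonneg hx.1]; exact hx.2)).continuousAt.continuousWithinAt
  obtain ⟨x, hx, hmin⟩ := isCompact_Icc.exists_isMinOn ⟨φ, hφ.le, hφ'.le⟩ hcont.abs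
  refine ⟨|dslope f φ x|, abs_pos.2 ?_, fun θ hθ => ?_⟩
  · by_cases h : x = φ
    · rw [h, dslope_same, hd.deriv]
      exact (saddleCurveDeriv_re_neg hM hφ hφ').ne
    · rw [dslope_of_ne _ h, slope_def_field]
      refine div_ne_zero (sub_ne_zero.2 fun hc => h ?_) (sub_ne_zero.2 h)
      exact (strictAntiOn_saddleCurve_re hM).injOn hx ⟨hφ.le, hφ'.le⟩ hc
  · have h1 := hmin (a := |θ|) ⟨abs_nonneg _, hθ⟩
    simp only [mem_ofPred_eq] at h1
    have h2 := sub_smul_dslope f φ |θ|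
    rw [smul_eq_mul] at h2
    rw [← saddleCurve_re_abs]
    change _ ≤ |f |θ| - f φ|
    rw [← h2, abs_mul, mul_comm |_|]
    gcongr

lemma exists_le_norm_sin_saddleCurve (hM : 1 ≤ M) :
    ∃ κ : ℝ, 0 < κ ∧ ∀ (n : ℕ) θ, 1 ≤ n → |θ| ≤ Real.pi / (M + 1) →
      (n : ℝ) ≤ ((n : ℂ) * saddleCurve M θ).re ∨
        κ ≤ ‖Complex.sin (Real.pi * ((n : ℂ) * saddleCurve M θ - 1 / 4))‖ := by
  set κ₁ := Real.sin (Real.pi / (2 * (M + 1)))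
  have hpi := Real.pi_pos
  have hM' : (1 : ℝ) ≤ M := by exact_mod_cast hM
  have hκ₁ : 0 < κ₁ := by
    refine Real.sin_pos_of_pos_of_lt_pi (by positivity) ?_
    rw [div_lt_iff₀ (by positivity)]
    nlinarith
  refine ⟨min (Real.sin (Real.pi / 8)) (Real.sinh (Real.pi * (κ₁ / 8))), lt_min ?_ ?_,
    fun n θ hn hθ => ?_⟩
  · exact Real.sin_pos_of_pos_of_lt_pi (by positivity) (by linarith)
  · exact Real.sinh_pos_iff.2 (by positivity)
  have hn' : (0 : ℝ) < n := by exact_mod_cast hn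
  have hre : ((n : ℂ) * saddleCurve M θ).re = n * (saddleCurve M θ).re := by simp
  have him : ((n : ℂ) * saddleCurve M θ).im = n * (saddleCurve M θ).im := by simp
  rcases le_or_gt 1 (saddleCurve M θ).re with h1 | h1
  · left; rw [hre]; nlinarith
  right
  have h0 := saddleCurve_re_nonneg hM hθ
  have hθ0 : 0 < |θ| := by
    rw [abs_pos]
    rintro rfl
    rw [saddleCurve_zero, Complex.ofReal_re, div_lt_one (by positivity)] at h1
    linarith
  have hIm : κ₁ * (saddleCurve M θ).re ≤ |(saddleCurve M θ).im| := by
    have e1 := congrArg Complex.re (saddleCurve_sub_one hM hθ0 hθ)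
    rw [Complex.sub_re, Complex.re_ofReal_mul, Complex.exp_ofReal_mul_I_re, saddleCurve_re_abs,
      Complex.one_re] at e1
    have hs1 := sin_pos_of_le hM hθ0 hθ
    have hs2 := sin_nat_mul_pos hM hθ0 hθ
    have e2 : Real.pi / 2 < (M + 1) * |θ| := by
      by_contra! hcon
      have := Real.cos_nonneg_of_mem_Icc (x := (M + 1) * |θ|)
        ⟨by linarith [show 0 ≤ ((M : ℝ) + 1) * |θ| by positivity], hcon⟩
      have : 0 ≤ Real.sin |θ| / Real.sin (M * |θ|) * Real.cos ((M + 1) * |θ|) := by positivity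
      linarith
    have e3 : κ₁ ≤ Real.sin |θ| := by
      refine Real.sin_le_sin_of_le_of_le_pi_div_two ?_ (by linarith [lt_pi_of_le hM hθ0 hθ]) ?_
      · have : 0 < Real.pi / (2 * (M + 1)) := by positivity
        linarith
      · rw [div_le_iff₀ (by positivity)]
        nlinarith
    have e4 : 0 ≤ saddleRadius M θ := by
      rcases hθ.eq_or_lt with h | h
      · rw [← saddleRadius_abs, h, saddleRadius_end hM]
      · exact (saddleRadius_pos hM h).le
    have e5 : |(saddleCurve M θ).im| = saddleRadius M θ * Real.sin |θ| := by
      rw [saddleCurve_im, abs_mul, abs_of_nonneg e4]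
      congr 1
      rcases abs_cases θ with ⟨h, _⟩ | ⟨h, _⟩
      · rw [h] at hs1 ⊢; exact abs_of_pos hs1
      · rw [h, Real.sin_neg] at hs1; rw [h, Real.sin_neg]; exact abs_of_neg (by linarith)
    have e6 : (saddleCurve M θ).re ≤ saddleRadius M θ := by
      rw [saddleCurve_re]
      exact mul_le_of_le_one_right e4 (Real.cos_le_one _)
    rw [e5, mul_comm]
    exact mul_le_mul e6 e3 hκ₁.le e4
  set u := (n : ℂ) * saddleCurve M θ
  rcases le_or_gt u.re (1 / 8) with h | h
  · refine (min_le_left _ _).trans ?_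
    have hu0 : 0 ≤ u.re := by rw [hre]; positivity
    refine le_trans ?_ (norm_re_sin_le _)
    have e : ((Real.pi : ℂ) * (u - 1 / 4)).re = -(Real.pi * (1 / 4 - u.re)) := by simp; ring
    rw [e, Real.sin_neg, abs_neg]
    refine le_trans ?_ (le_abs_self _)
    refine Real.sin_le_sin_of_le_of_le_pi_div_two (by linarith) ?_ ?_ <;> nlinarith
  · refine (min_le_right _ _).trans (le_trans ?_ (sinh_abs_im_le_norm_sin _))
    rw [Real.sinh_le_sinh]
    have : ((Real.pi : ℂ) * (u - 1 / 4)).im = Real.pi * u.im := by simp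
    rw [this, abs_mul, abs_of_pos hpi]
    gcongr
    rw [him, abs_mul, abs_of_pos hn']
    rw [hre] at h
    nlinarith

end

end

section

lemma exp_mul_rpow_div_le {A : ℝ} (hA : 0 < A) {n b r R δ : ℝ} (hn : 0 ≤ n) (hb : 0 ≤ b)
    (hr : 0 ≤ r) (hR : 0 ≤ R) (hδ : 0 < δ) (hδ' : δ ≤ r + b / A) :
    Real.exp (-(n * b)) * Real.exp (A * (Real.log (1 + n * R) - Real.log (1 + n * r))) ≤
      Real.exp (A * Real.log (1 + R / δ)) := by
  rw [← Real.exp_add, Real.exp_le_exp]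
  have h1 : Real.log (1 + n * R) ≤ Real.log (1 + n * r) + n * b / A + Real.log (1 + R / δ) := by
    have e1 : n * b / A = Real.log (Real.exp (n * b / A)) := (Real.log_exp _).symm
    rw [e1, ← Real.log_mul (by positivity) (by positivity),
      ← Real.log_mul (by positivity) (by positivity)]
    apply Real.log_le_log (by positivity)
    have e2 : 1 + n * δ ≤ (1 + n * r) * Real.exp (n * b / A) := by
      have := Real.add_one_le_exp (n * b / A)
      have h0 : 0 ≤ n * b / A := by positivity
      calc 1 + n * δ ≤ 1 + n * (r + b / A) := by gcongr
        _ = 1 + n * r + n * b / A := by ring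
        _ ≤ (1 + n * r) * (n * b / A + 1) := by nlinarith [mul_nonneg (mul_nonneg hn hr) h0]
        _ ≤ _ := by gcongr
    calc 1 + n * R ≤ (1 + n * δ) * (1 + R / δ) := by
          have : (1 + n * δ) * (1 + R / δ) = 1 + n * R + n * δ + R / δ := by field_simp; ring
          have : 0 ≤ n * δ := by positivity
          have : 0 ≤ R / δ := by positivity
          linarith
      _ ≤ _ := by gcongr
  have h2 := mul_le_mul_of_nonneg_left h1 hA.le
  have h3 : A * (n * b / A) = n * b := by field_simp
  nlinarith

lemma log_one_add_le_mul {κ : ℝ} (hκ : 0 < κ) {x : ℝ} (hx : 0 ≤ x) :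
    Real.log (1 + x) ≤ κ * x + |Real.log κ| + 1 := by
  have h1 : Real.log (1 + x) = Real.log (κ * (1 + x)) - Real.log κ := by
    rw [Real.log_mul hκ.ne' (by positivity)]; ring
  have h2 := Real.log_le_sub_one_of_pos (x := κ * (1 + x)) (by positivity)
  by_cases hk : κ ≤ 2
  · rw [h1]; linarith [neg_abs_le (Real.log κ)]
  · have := Real.log_le_sub_one_of_pos (x := 1 + x) (by positivity)
    push Not at hk
    nlinarith [abs_nonneg (Real.log κ)]

section

variable {M : ℕ} {φ x0 : ℝ}

/-- The drop of the phase along the vertical line through the saddle. -/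
noncomputable def saddleDrop (M : ℕ) (φ x0 y : ℝ) : ℝ :=
  phase M x0 (saddleCurve M φ) - phase M x0 ((saddleCurve M φ).re + y * I)

lemma continuous_saddleDrop : Continuous (saddleDrop M φ x0) :=
  continuous_const.sub (continuous_phase_vertical M x0 _)

lemma saddleDrop_pos (hM : 1 ≤ M) (hφ : 0 < φ) (hφ' : φ < Real.pi / (M + 1)) {y : ℝ}
    (hy : |y| ≠ (saddleCurve M φ).im) : 0 < saddleDrop M φ x0 y :=
  sub_pos.2 (phase_vertical_lt hM hφ hφ' hy)

lemma saddleDrop_nonneg (hM : 1 ≤ M) (hφ : 0 < φ) (hφ' : φ < Real.pi / (M + 1)) (y : ℝ) :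
    0 ≤ saddleDrop M φ x0 y := by
  by_cases h : |y| = (saddleCurve M φ).im
  · rw [saddleDrop, ← phase_vertical_abs, h, Complex.re_add_im, sub_self]
  · exact (saddleDrop_pos hM hφ hφ' h).le

lemma exists_le_saddleDrop (hM : 1 ≤ M) (hφ : 0 < φ) (hφ' : φ < Real.pi / (M + 1)) :
    ∃ ε C : ℝ, 0 < ε ∧ ∀ y, ε * |y| - C ≤ saddleDrop M φ x0 y := by
  obtain ⟨ε, C, hε, h⟩ := exists_phase_vertical_le (x0 := x0) hM hφ hφ'
  refine ⟨ε, C - phase M x0 (saddleCurve M φ), hε, fun y => ?_⟩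
  rw [saddleDrop]
  linarith [h y]

/-- The rise of the phase along the saddle curve. -/
noncomputable def saddleRise (M : ℕ) (φ x0 θ : ℝ) : ℝ :=
  phase M x0 (saddleCurve M θ) - phase M x0 (saddleCurve M φ)

lemma saddleRise_nonneg (hM : 1 ≤ M) (hφ : 0 < φ) (hφ' : φ < Real.pi / (M + 1))
    (hx0 : x0 = v M φ) {θ : ℝ} (hθ : |θ| ≤ Real.pi / (M + 1)) : 0 ≤ saddleRise M φ x0 θ := by
  by_cases h : |θ| = φ
  · have : phase M x0 (saddleCurve M θ) = phase M x0 (saddleCurve M φ) := by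
      rcases abs_choice θ with h' | h' <;> rw [h'] at h
      · rw [h]
      · rw [← h, saddleCurve_neg, phase_conj]
    rw [saddleRise, this, sub_self]
  · exact (sub_pos.2 (phase_saddle_lt hM hφ hφ' hx0 hθ h)).le

lemma exists_le_norm_add_saddleRise (hM : 1 ≤ M) (hφ : 0 < φ) (hφ' : φ < Real.pi / (M + 1))
    (hx0 : x0 = v M φ) {A : ℝ} (hA : 0 < A) :
    ∃ δ, 0 < δ ∧ ∀ θ, |θ| ≤ Real.pi / (M + 1) →
      δ ≤ ‖saddleCurve M θ‖ + saddleRise M φ x0 θ / A := by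
  have hc : ContinuousOn (fun θ => ‖saddleCurve M θ‖ + saddleRise M φ x0 θ / A)
      (Set.Icc (-(Real.pi / (M + 1))) (Real.pi / (M + 1))) :=
    (continuousOn_saddleCurve hM).norm.add
      (((continuousOn_phase_saddleCurve hM).sub continuousOn_const).div_const A)
  have hp : 0 < Real.pi / ((M : ℝ) + 1) := by positivity
  obtain ⟨x, hx, hmin⟩ := isCompact_Icc.exists_isMinOn ⟨0, by constructor <;> linarith⟩ hc
  refine ⟨_, ?_, fun θ hθ => hmin (abs_le.1 hθ)⟩
  have hx' := abs_le.2 hx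
  rcases hx'.eq_or_lt with h | h
  · have := sub_pos.2 (phase_saddle_lt hM hφ hφ' hx0 hx' (by rw [h]; exact hφ'.ne'))
    have h2 : 0 < saddleRise M φ x0 x := this
    positivity
  · have h1 := saddleRadius_pos hM h
    have h2 := saddleRise_nonneg hM hφ hφ' hx0 hx'
    have h3 : 0 < ‖saddleCurve M x‖ := by
      rw [norm_pos_iff, saddleCurve]
      exact mul_ne_zero (by exact_mod_cast h1.ne') (Complex.exp_ne_zero _)
    positivity

lemma exists_le_norm_add_saddleDrop (hM : 1 ≤ M) (hφ : 0 < φ) (hφ' : φ < Real.pi / (M + 1)) :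
    ∃ δ, 0 < δ ∧ ∀ y : ℝ,
      δ ≤ ‖((saddleCurve M φ).re + y * I - 1 : ℂ)‖ + 2 * saddleDrop M φ x0 y := by
  have hc : ContinuousOn (fun y : ℝ =>
      ‖((saddleCurve M φ).re + y * I - 1 : ℂ)‖ + 2 * saddleDrop M φ x0 y) (Set.Icc (-1) 1) := by
    have := continuous_saddleDrop (M := M) (φ := φ) (x0 := x0)
    exact Continuous.continuousOn (by fun_prop)
  obtain ⟨x, hx, hmin⟩ := isCompact_Icc.exists_isMinOn ⟨0, by norm_num⟩ hc
  refine ⟨min 1 (‖((saddleCurve M φ).re + x * I - 1 : ℂ)‖ + 2 * saddleDrop M φ x0 x),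
    lt_min one_pos ?_, fun y => ?_⟩
  · have h0 := saddleDrop_nonneg (x0 := x0) hM hφ hφ' x
    by_cases h : x = 0
    · have := saddleDrop_pos (x0 := x0) hM hφ hφ' (y := x)
        (by rw [h, abs_zero]; exact (saddleCurve_im_pos hM hφ hφ').ne)
      positivity
    · have : 0 < ‖((saddleCurve M φ).re + x * I - 1 : ℂ)‖ := by
        rw [norm_pos_iff]
        intro e
        have := congrArg Complex.im e
        simp at this
        exact h this
      positivity
  · by_cases h : |y| ≤ 1
    · exact (min_le_right _ _).trans (hmin (abs_le.1 h))
    · refine (min_le_left _ _).trans ?_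
      have h1 := Complex.abs_im_le_norm ((saddleCurve M φ).re + y * I - 1 : ℂ)
      have h2 := saddleDrop_nonneg (x0 := x0) hM hφ hφ' y
      have h3 : ((saddleCurve M φ).re + y * I - 1 : ℂ).im = y := by simp
      rw [h3] at h1
      push Not at h
      linarith

lemma exists_norm_vertical_le_saddleDrop (hM : 1 ≤ M) (hφ : 0 < φ) (hφ' : φ < Real.pi / (M + 1))
    {A δ : ℝ} (hA : 0 < A) (hδ : 0 < δ) :
    ∃ C, ∀ y : ℝ, A * Real.log (1 + ‖((saddleCurve M φ).re + y * I : ℂ)‖ / δ) ≤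
      saddleDrop M φ x0 y / 4 + C := by
  obtain ⟨ε, C, hε, h⟩ := exists_le_saddleDrop (x0 := x0) hM hφ hφ'
  set κ := ε * δ / (4 * A)
  have hκ : 0 < κ := by positivity
  have hc := saddleCurve_re_pos hM hφ hφ'
  refine ⟨A * (κ * ((saddleCurve M φ).re / δ) + |Real.log κ| + 1) + C / 4, fun y => ?_⟩
  have h1 : ‖((saddleCurve M φ).re + y * I : ℂ)‖ ≤ (saddleCurve M φ).re + |y| := by
    refine (norm_add_le _ _).trans ?_
    simp [abs_of_pos hc]
  have h2 := log_one_add_le_mul hκ (x := ‖((saddleCurve M φ).re + y * I : ℂ)‖ / δ) (by positivity)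
  have h3 : κ * (‖((saddleCurve M φ).re + y * I : ℂ)‖ / δ) ≤
      κ * (((saddleCurve M φ).re + |y|) / δ) := by gcongr
  have h4 : A * (κ * (|y| / δ)) = ε * |y| / 4 := by
    simp only [κ]; field_simp
  have h5 := mul_le_mul_of_nonneg_left (h2.trans (by linarith :
    _ ≤ κ * (((saddleCurve M φ).re + |y|) / δ) + |Real.log κ| + 1)) hA.le
  have h6 : A * (κ * (((saddleCurve M φ).re + |y|) / δ) + |Real.log κ| + 1) =
    A * (κ * ((saddleCurve M φ).re / δ) + |Real.log κ| + 1) + A * (κ * (|y| / δ)) := by ring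
  linarith [h y]

lemma exists_norm_weightF_ratio_le (hM : 1 ≤ M) (ν : ℕ → ℕ) (hφ : 0 < φ)
    (hφ' : φ < Real.pi / (M + 1)) (hx0 : x0 = v M φ) :
    ∃ K, 0 < K ∧ ∀ (n : ℕ), 1 ≤ n → ∀ y θ : ℝ, |θ| ≤ Real.pi / (M + 1) →
      ‖weightF M ν n (n * ((saddleCurve M φ).re + y * I) - 1 / 4)‖ ≤
        K * Real.exp (-(n * saddleDrop M φ x0 y / 4)) *
          Real.exp (n * ((saddleCurve M φ).re - (saddleCurve M θ).re) *
            (M * Real.log n + Real.log x0)) *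
          ‖weightF M ν n (n * saddleCurve M θ - 1 / 4)‖ := by
  obtain ⟨κ, hκ, hsin⟩ := exists_le_norm_sin_saddleCurve hM
  obtain ⟨C₁, hC₁, h₁⟩ := exists_norm_weightF_le M ν
  obtain ⟨C₂, hC₂, h₂⟩ := exists_le_norm_weightF M ν hκ
  set A := prefactorExp M ν
  have hA : 0 < A := prefactorExp_pos M ν
  obtain ⟨δ, hδ, hδ'⟩ := exists_le_norm_add_saddleRise hM hφ hφ' hx0 hA
  obtain ⟨δ₂, hδ₂, hδ₂'⟩ := exists_le_norm_add_saddleDrop (x0 := x0) hM hφ hφ'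
  obtain ⟨C₃, h₃⟩ := exists_norm_vertical_le_saddleDrop (x0 := x0) hM hφ hφ' hA hδ
  obtain ⟨R, hR⟩ := isCompact_Icc.exists_bound_of_continuousOn
    ((continuousOn_saddleCurve hM).sub (continuousOn_const (c := 1)))
  have hc := saddleCurve_re_pos hM hφ hφ'
  set C₄ := 1 / 4 * Real.log (1 + |R| / δ₂)
  refine ⟨C₁ * C₂ * Real.exp (C₃ + C₄), by positivity, fun n hn y θ hθ => ?_⟩
  have hn' : (1 : ℝ) ≤ n := by exact_mod_cast hn
  have hn0 : (0 : ℝ) ≤ n := by positivity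
  set z : ℂ := (saddleCurve M φ).re + y * I with hz
  set ζ := saddleCurve M θ
  have hzre : z.re = (saddleCurve M φ).re := by simp [hz]
  have a1 := h₁ n (n * z) (by
    have : ((n : ℂ) * z).re = n * z.re := by simp
    rw [this, hzre]; positivity)
  have a2 := h₂ n (n * ζ) (by
    have : ((n : ℂ) * ζ).re = n * ζ.re := by simp
    rw [this]; exact mul_nonneg hn0 (saddleCurve_re_nonneg hM hθ)) (hsin n θ hn hθ)
  refine a1.trans ?_
  have hrise := saddleRise_nonneg hM hφ hφ' hx0 hθ
  have hdrop := saddleDrop_nonneg (x0 := x0) hM hφ hφ' y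
  have b1 := exp_mul_rpow_div_le hA hn0 hrise (norm_nonneg ζ) (norm_nonneg z) hδ (hδ' θ hθ)
  have b2 := exp_mul_rpow_div_le (A := 1 / 4) (by norm_num) hn0 (b := saddleDrop M φ x0 y / 2)
    (by positivity) (norm_nonneg (z - 1)) (abs_nonneg R) hδ₂
    ((hδ₂' y).trans_eq (by ring))
  have b3 : ‖ζ - 1‖ ≤ |R| := (hR θ (abs_le.1 hθ)).trans (le_abs_self _)
  have b4 : Real.log (1 + n * ‖ζ - 1‖) ≤ Real.log (1 + n * |R|) := by gcongr
  rw [← Real.exp_add, Real.exp_le_exp] at b1 b2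
  have b5 : saddleDrop M φ x0 y / 4 ≤ n * saddleDrop M φ x0 y / 4 := by
    have := mul_le_mul_of_nonneg_right hn' hdrop
    linarith
  have key : weightApprox M ν n (n * z) ≤ C₃ + C₄ + -(n * saddleDrop M φ x0 y / 4) +
      n * ((saddleCurve M φ).re - ζ.re) * (M * Real.log n + Real.log x0) +
      weightApprox M ν n (n * ζ) := by
    rw [weightApprox_natCast_mul M ν x0 hn, weightApprox_natCast_mul M ν x0 hn, hzre]
    have e1 : phase M x0 z = phase M x0 (saddleCurve M φ) - saddleDrop M φ x0 y := by
      rw [saddleDrop]; ring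
    have e2 : phase M x0 ζ = phase M x0 (saddleCurve M φ) + saddleRise M φ x0 θ := by
      rw [saddleRise]; ring
    rw [e1, e2]
    have := h₃ y
    rw [← hz] at this
    have hA' : prefactorExp M ν = A := rfl
    have hC4 : C₄ = 1 / 4 * Real.log (1 + |R| / δ₂) := rfl
    rw [hA']
    ring_nf at b1 b2 b4 b5 this hC4 ⊢
    linarith
  calc _ ≤ C₁ * Real.exp (C₃ + C₄ + -(n * saddleDrop M φ x0 y / 4) +
      n * ((saddleCurve M φ).re - ζ.re) * (M * Real.log n + Real.log x0) +
      weightApprox M ν n (n * ζ)) := by gcongr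
    _ = C₁ * (Real.exp (C₃ + C₄) * Real.exp (-(n * saddleDrop M φ x0 y / 4)) *
      Real.exp (n * ((saddleCurve M φ).re - ζ.re) * (M * Real.log n + Real.log x0)) *
      Real.exp (weightApprox M ν n (n * ζ))) := by simp only [Real.exp_add]
    _ ≤ C₁ * (Real.exp (C₃ + C₄) * Real.exp (-(n * saddleDrop M φ x0 y / 4)) *
      Real.exp (n * ((saddleCurve M φ).re - ζ.re) * (M * Real.log n + Real.log x0)) *
      (C₂ * ‖weightF M ν n (n * ζ - 1 / 4)‖)) := by gcongr
    _ = _ := by ring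

end

end

/-- Partial fraction expansion modulo entire functions. -/
lemma exists_partialFraction (P : Finset ℂ) {G : ℂ → ℂ} (hG : Differentiable ℂ G) :
    ∃ (H : ℂ → ℂ) (c : ℂ → ℂ), Differentiable ℂ H ∧
      ∀ t, t ∉ P → G t / ∏ p ∈ P, (t - p) = H t + ∑ p ∈ P, c p / (t - p) := by
  induction P using Finset.induction_on with
  | empty => exact ⟨G, 0, hG, by simp⟩
  | insert q P hq ih =>
    obtain ⟨H, c, hH, h⟩ := ih
    have hd : Differentiable ℂ (dslope H q) := by
      rw [← differentiableOn_univ, Complex.differentiableOn_dslope univ_mem]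
      exact hH.differentiableOn
    refine ⟨dslope H q, fun p => if p = q then H q + ∑ p ∈ P, c p / (q - p) else c p / (p - q),
      hd, fun t ht => ?_⟩
    rw [Finset.mem_insert, not_or] at ht
    have htq : t - q ≠ 0 := sub_ne_zero.2 ht.1
    have h1 := sub_smul_dslope H q t
    rw [smul_eq_mul] at h1
    have h2 : ∑ p ∈ P, (if p = q then H q + ∑ p ∈ P, c p / (q - p) else c p / (p - q)) / (t - p)
        = ∑ p ∈ P, (c p / (t - p) - c p / (q - p)) / (t - q) := by
      refine Finset.sum_congr rfl fun p hp => ?_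
      have hpq : p ≠ q := fun e => hq (e ▸ hp)
      have a1 : t - p ≠ 0 := sub_ne_zero.2 fun e => ht.2 (e ▸ hp)
      have a2 : p - q ≠ 0 := sub_ne_zero.2 hpq
      have a3 : q - p ≠ 0 := sub_ne_zero.2 hpq.symm
      rw [if_neg hpq]
      field_simp
      ring
    rw [Finset.prod_insert hq, Finset.sum_insert hq]
    beta_reduce
    rw [if_pos rfl, h2, ← Finset.sum_div,
      Finset.sum_sub_distrib, mul_comm (t - q), ← div_div, h t ht.2]
    field_simp
    linear_combination -h1

lemma intervalIntegrable_curve {γ γ' : ℝ → ℂ} {a b : ℝ}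
    (hγ : ∀ θ ∈ Set.uIcc a b, HasDerivAt γ (γ' θ) θ) (hγ' : ContinuousOn γ' (Set.uIcc a b))
    {f : ℂ → ℂ} (hf : ∀ θ ∈ Set.uIcc a b, ContinuousAt f (γ θ)) :
    IntervalIntegrable (fun θ => f (γ θ) * γ' θ) volume a b := by
  refine ContinuousOn.intervalIntegrable (ContinuousOn.mul (fun θ hθ => ?_) hγ')
  exact ((hf θ hθ).comp (hγ θ hθ).continuousAt).continuousWithinAt

lemma integral_closed_curve {γ γ' : ℝ → ℂ} {a b : ℝ}
    (hγ : ∀ θ ∈ Set.uIcc a b, HasDerivAt γ (γ' θ) θ) (hγ' : ContinuousOn γ' (Set.uIcc a b))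
    (hcl : γ b = γ a) {H : ℂ → ℂ} (hH : Differentiable ℂ H) :
    ∫ θ in a..b, H (γ θ) * γ' θ = 0 := by
  obtain ⟨g, hg⟩ := hH.isExactOn_univ
  have h : ∀ θ ∈ Set.uIcc a b, HasDerivAt (fun θ => g (γ θ)) (H (γ θ) * γ' θ) θ :=
    fun θ hθ => (hg _ (mem_univ _)).comp_of_eq θ (hγ θ hθ) rfl
  rw [intervalIntegral.integral_eq_sub_of_hasDerivAt h
    (intervalIntegrable_curve (γ' := γ') hγ hγ' fun _ _ => hH.continuous.continuousAt), hcl,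
    sub_self]

/-- Two closed curves with the same winding numbers around the finite set `P` give the same
integral to a meromorphic function with simple poles in `P`. -/
lemma integral_meromorphic_eq {γ₁ γ₁' γ₂ γ₂' : ℝ → ℂ} {a₁ b₁ a₂ b₂ : ℝ}
    (h₁ : ∀ θ ∈ Set.uIcc a₁ b₁, HasDerivAt γ₁ (γ₁' θ) θ) (h₁' : ContinuousOn γ₁' (Set.uIcc a₁ b₁))
    (h₁c : γ₁ b₁ = γ₁ a₁)
    (h₂ : ∀ θ ∈ Set.uIcc a₂ b₂, HasDerivAt γ₂ (γ₂' θ) θ) (h₂' : ContinuousOn γ₂' (Set.uIcc a₂ b₂))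
    (h₂c : γ₂ b₂ = γ₂ a₂) (P : Finset ℂ)
    (hP₁ : ∀ θ ∈ Set.uIcc a₁ b₁, γ₁ θ ∉ P) (hP₂ : ∀ θ ∈ Set.uIcc a₂ b₂, γ₂ θ ∉ P)
    (hw : ∀ p ∈ P, ∫ θ in a₁..b₁, (γ₁ θ - p)⁻¹ * γ₁' θ = ∫ θ in a₂..b₂, (γ₂ θ - p)⁻¹ * γ₂' θ)
    {G : ℂ → ℂ} (hG : Differentiable ℂ G) :
    ∫ θ in a₁..b₁, G (γ₁ θ) / (∏ p ∈ P, (γ₁ θ - p)) * γ₁' θ =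
      ∫ θ in a₂..b₂, G (γ₂ θ) / (∏ p ∈ P, (γ₂ θ - p)) * γ₂' θ := by
  obtain ⟨H, c, hH, h⟩ := exists_partialFraction P hG
  have key : ∀ {γ γ' : ℝ → ℂ} {a b : ℝ}, (∀ θ ∈ Set.uIcc a b, HasDerivAt γ (γ' θ) θ) →
      ContinuousOn γ' (Set.uIcc a b) → γ b = γ a → (∀ θ ∈ Set.uIcc a b, γ θ ∉ P) →
      ∫ θ in a..b, G (γ θ) / (∏ p ∈ P, (γ θ - p)) * γ' θ =
        ∑ p ∈ P, c p * ∫ θ in a..b, (γ θ - p)⁻¹ * γ' θ := by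
    intro γ γ' a b hγ hγ' hcl hP
    have hi : ∀ p ∈ P, IntervalIntegrable (fun θ => (γ θ - p)⁻¹ * γ' θ) volume a b := by
      intro p hp
      refine intervalIntegrable_curve (γ' := γ') (f := fun t => (t - p)⁻¹) hγ hγ' fun θ hθ => ?_
      have : γ θ - p ≠ 0 := sub_ne_zero.2 fun e => hP θ hθ (e ▸ hp)
      exact ContinuousAt.inv₀ (by fun_prop) this
    have e : ∫ θ in a..b, G (γ θ) / (∏ p ∈ P, (γ θ - p)) * γ' θ =
        ∫ θ in a..b, (H (γ θ) * γ' θ + ∑ p ∈ P, c p * ((γ θ - p)⁻¹ * γ' θ)) := by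
      refine intervalIntegral.integral_congr fun θ hθ => ?_
      simp only [h _ (hP θ hθ), add_mul, Finset.sum_mul]
      congr 1
      exact Finset.sum_congr rfl fun p _ => by rw [div_eq_mul_inv, mul_assoc]
    rw [e, intervalIntegral.integral_add, integral_closed_curve hγ hγ' hcl hH, zero_add,
      intervalIntegral.integral_finsetSum]
    · simp_rw [intervalIntegral.integral_const_mul]
    · exact fun p hp => (hi p hp).const_mul _
    · exact intervalIntegrable_curve (γ' := γ') hγ hγ' fun _ _ => hH.continuous.continuousAt
    · refine (IntervalIntegrable.sum P fun p hp => (hi p hp).const_mul (c p)).congr ?_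
      exact fun x _ => by simp
  rw [key h₁ h₁' h₁c hP₁, key h₂ h₂' h₂c hP₂]
  exact Finset.sum_congr rfl fun p hp => by rw [hw p hp]

lemma integral_inv_of_slitPlane {γ γ' : ℝ → ℂ} {a b : ℝ}
    (hγ : ∀ θ ∈ Set.uIcc a b, HasDerivAt γ (γ' θ) θ) (hγ' : ContinuousOn γ' (Set.uIcc a b))
    {u p : ℂ} (hu : u ≠ 0) (hs : ∀ θ ∈ Set.uIcc a b, u * (γ θ - p) ∈ slitPlane) :
    ∫ θ in a..b, (γ θ - p)⁻¹ * γ' θ =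
      Complex.log (u * (γ b - p)) - Complex.log (u * (γ a - p)) := by
  have h : ∀ θ ∈ Set.uIcc a b, HasDerivAt (fun θ => Complex.log (u * (γ θ - p)))
      ((γ θ - p)⁻¹ * γ' θ) θ := by
    intro θ hθ
    have hd : HasDerivAt (fun θ => u * (γ θ - p)) (u * γ' θ) θ :=
      ((hγ θ hθ).sub_const p).const_mul u
    refine (hd.clog_real (hs θ hθ)).congr_deriv ?_
    have := slitPlane_ne_zero (hs θ hθ)
    have h2 : γ θ - p ≠ 0 := right_ne_zero_of_mul this
    field_simp
  refine intervalIntegral.integral_eq_sub_of_hasDerivAt h ?_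
  refine intervalIntegrable_curve (γ' := γ') (f := fun t => (t - p)⁻¹) hγ hγ' fun θ hθ => ?_
  exact ContinuousAt.inv₀ (by fun_prop) (right_ne_zero_of_mul (slitPlane_ne_zero (hs θ hθ)))

lemma integral_inv_of_re_pos {γ γ' : ℝ → ℂ} {a b : ℝ}
    (hγ : ∀ θ ∈ Set.uIcc a b, HasDerivAt γ (γ' θ) θ) (hγ' : ContinuousOn γ' (Set.uIcc a b))
    (hcl : γ b = γ a) {p : ℂ} (hs : ∀ θ ∈ Set.uIcc a b, p.re < (γ θ).re) :
    ∫ θ in a..b, (γ θ - p)⁻¹ * γ' θ = 0 := by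
  rw [integral_inv_of_slitPlane hγ hγ' one_ne_zero (fun θ hθ => ?_), hcl, sub_self]
  left
  simpa using hs θ hθ

section

/-- The rescaled saddle curve, shifted off the poles. -/
noncomputable def saddleContour (M n : ℕ) (θ : ℝ) : ℂ := n * saddleCurve M θ - 1 / 4

section Contour

variable {M n : ℕ} {θ : ℝ}

lemma uIcc_neg_div (M : ℕ) : Set.uIcc (-(Real.pi / (M + 1))) (Real.pi / ((M : ℝ) + 1)) =
    Set.Icc (-(Real.pi / (M + 1))) (Real.pi / (M + 1)) := by
  have hp : 0 < Real.pi / ((M : ℝ) + 1) := by positivity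
  exact Set.uIcc_of_le (by linarith)

lemma hasDerivAt_saddleContour (hM : 1 ≤ M) (hθ : |θ| ≤ Real.pi / (M + 1)) :
    HasDerivAt (saddleContour M n) (n * saddleCurveDeriv M θ) θ :=
  ((hasDerivAt_saddleCurve hM hθ).const_mul (n : ℂ)).sub_const _

lemma continuousOn_saddleContour (hM : 1 ≤ M) : ContinuousOn (saddleContour M n)
    (Set.Icc (-(Real.pi / (M + 1))) (Real.pi / (M + 1))) := fun _ hθ =>
  (hasDerivAt_saddleContour hM (abs_le.2 hθ)).continuousAt.continuousWithinAt

lemma continuousOn_saddleContourDeriv (hM : 1 ≤ M) : ContinuousOn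
    (fun θ => (n : ℂ) * saddleCurveDeriv M θ)
    (Set.Icc (-(Real.pi / (M + 1))) (Real.pi / (M + 1))) :=
  continuousOn_const.mul (continuousOn_saddleCurveDeriv hM)

lemma saddleContour_neg (M n : ℕ) (θ : ℝ) :
    saddleContour M n (-θ) = (starRingEnd ℂ) (saddleContour M n θ) := by
  have h4 : (starRingEnd ℂ) (1 / 4) = 1 / 4 := by
    have := Complex.conj_ofReal (1 / 4)
    push_cast at this
    exact this
  rw [saddleContour, saddleContour, saddleCurve_neg, map_sub, h4, map_mul, Complex.conj_natCast]

lemma saddleContour_end (hM : 1 ≤ M) :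
    saddleContour M n (Real.pi / (M + 1)) = ((-(1 / 4) : ℝ) : ℂ) := by
  rw [saddleContour, saddleCurve_end hM]; push_cast; ring

lemma saddleContour_end_neg (hM : 1 ≤ M) :
    saddleContour M n (-(Real.pi / (M + 1))) = ((-(1 / 4) : ℝ) : ℂ) := by
  rw [saddleContour_neg, saddleContour_end hM, Complex.conj_ofReal]

lemma saddleContour_zero (M n : ℕ) :
    saddleContour M n 0 = ((n * ((M + 1) / M) - 1 / 4 : ℝ) : ℂ) := by
  rw [saddleContour, saddleCurve_zero]; push_cast; ring

lemma saddleContour_re (M n : ℕ) (θ : ℝ) :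
    (saddleContour M n θ).re = n * (saddleCurve M θ).re - 1 / 4 := by
  rw [saddleContour, Complex.sub_re, ← Complex.ofReal_natCast, Complex.re_ofReal_mul]
  norm_num

lemma saddleContour_im (M n : ℕ) (θ : ℝ) :
    (saddleContour M n θ).im = n * (saddleCurve M θ).im := by
  rw [saddleContour, Complex.sub_im, ← Complex.ofReal_natCast, Complex.im_ofReal_mul]
  norm_num

lemma le_saddleContour_re (hM : 1 ≤ M) (hθ : |θ| ≤ Real.pi / (M + 1)) :
    -(1 / 4) ≤ (saddleContour M n θ).re := by
  rw [saddleContour_re]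
  have := mul_nonneg n.cast_nonneg (saddleCurve_re_nonneg hM hθ)
  linarith

lemma sub_one_lt_saddleContour_zero (hM : 1 ≤ M) (n : ℕ) :
    (n : ℝ) - 1 < n * (((M : ℝ) + 1) / M) - 1 / 4 := by
  have hM' : (0 : ℝ) < M := by exact_mod_cast hM
  have : (1 : ℝ) ≤ (M + 1) / M := by rw [le_div_iff₀ hM']; linarith
  have := mul_le_mul_of_nonneg_left this n.cast_nonneg (α := ℝ)
  linarith

lemma saddleContour_im_pos (hM : 1 ≤ M) (hn : 1 ≤ n) (h0 : 0 < θ)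
    (hθ : θ < Real.pi / (M + 1)) : 0 < (saddleContour M n θ).im := by
  have hn' : (0 : ℝ) < n := by exact_mod_cast hn
  rw [saddleContour_im]
  exact mul_pos hn' (saddleCurve_im_pos hM h0 hθ)

/-- On the upper half of the contour, `-I * (γ θ - k)` avoids the branch cut. -/
lemma saddleContour_upper_mem_slitPlane (hM : 1 ≤ M) (hn : 1 ≤ n) {k : ℕ} (hk : k < n)
    (h0 : 0 ≤ θ) (hθ : θ ≤ Real.pi / (M + 1)) : -I * (saddleContour M n θ - k) ∈ slitPlane := by
  rw [mem_slitPlane_iff]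
  have hk' : (k : ℝ) ≤ n - 1 := by
    have : (k : ℝ) + 1 ≤ n := by exact_mod_cast hk
    linarith
  rcases h0.eq_or_lt with rfl | h0
  · right
    have := sub_one_lt_saddleContour_zero hM n
    simp [saddleContour_zero]
    intro h; linarith
  rcases hθ.eq_or_lt with rfl | hθ
  · right
    have : (0 : ℝ) ≤ k := k.cast_nonneg
    simp [saddleContour_end hM]
    intro h; linarith
  · left
    have := saddleContour_im_pos hM hn h0 hθ
    simpa using this

lemma saddleContour_lower_mem_slitPlane (hM : 1 ≤ M) (hn : 1 ≤ n) {k : ℕ} (hk : k < n)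
    (h0 : -(Real.pi / (M + 1)) ≤ θ) (hθ : θ ≤ 0) :
    I * (saddleContour M n θ - k) ∈ slitPlane := by
  have := saddleContour_upper_mem_slitPlane hM hn hk (neg_nonneg.2 hθ) (neg_le.1 h0)
  rw [saddleContour_neg, mem_slitPlane_iff] at this
  rw [mem_slitPlane_iff]
  simpa [sub_eq_zero, eq_comm] using this

lemma saddleContour_ne_natCast (hM : 1 ≤ M) (hn : 1 ≤ n) {k : ℕ} (hk : k < n)
    (hθ : |θ| ≤ Real.pi / (M + 1)) : saddleContour M n θ ≠ k := by
  intro e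
  rcases le_total 0 θ with h | h
  · have := saddleContour_upper_mem_slitPlane hM hn hk h (le_trans (le_abs_self _) hθ)
    simp [e] at this
  · have := saddleContour_lower_mem_slitPlane hM hn hk (abs_le.1 hθ).1 h
    simp [e] at this

lemma log_I_mul {r : ℝ} (hr : 0 < r) : Complex.log (I * r) = Real.log r + Real.pi / 2 * I := by
  rw [mul_comm, Complex.log_ofReal_mul hr I_ne_zero, log_I]

lemma log_neg_I_mul {r : ℝ} (hr : 0 < r) :
    Complex.log (-I * r) = Real.log r - Real.pi / 2 * I := by
  rw [mul_comm, Complex.log_ofReal_mul hr (neg_ne_zero.2 I_ne_zero), log_neg_I]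
  ring

lemma winding_saddleContour (hM : 1 ≤ M) (hn : 1 ≤ n) {k : ℕ} (hk : k < n) :
    ∫ θ in (-(Real.pi / (M + 1)))..(Real.pi / ((M : ℝ) + 1)),
      (saddleContour M n θ - k)⁻¹ * (n * saddleCurveDeriv M θ) = 2 * Real.pi * I := by
  have hp : 0 < Real.pi / ((M : ℝ) + 1) := by positivity
  have hu : Set.uIcc 0 (Real.pi / ((M : ℝ) + 1)) = Set.Icc 0 (Real.pi / (M + 1)) :=
    Set.uIcc_of_le hp.le
  have hl : Set.uIcc (-(Real.pi / ((M : ℝ) + 1))) 0 = Set.Icc (-(Real.pi / (M + 1))) 0 :=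
    Set.uIcc_of_le (by linarith)
  have hk' : (k : ℝ) ≤ n - 1 := by
    have : (k : ℝ) + 1 ≤ n := by exact_mod_cast hk
    linarith
  have hγint : ContinuousOn (fun θ => (saddleContour M n θ - k)⁻¹ * (n * saddleCurveDeriv M θ))
      (Set.Icc (-(Real.pi / (M + 1))) (Real.pi / (M + 1))) :=
    (((continuousOn_saddleContour hM).sub continuousOn_const).inv₀ fun θ hθ =>
      sub_ne_zero.2 (saddleContour_ne_natCast hM hn hk (abs_le.2 hθ))).mul
        (continuousOn_saddleContourDeriv hM)
  have sub1 : Set.Icc 0 (Real.pi / ((M : ℝ) + 1)) ⊆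
    Set.Icc (-(Real.pi / (M + 1))) (Real.pi / (M + 1)) := Set.Icc_subset_Icc_left (by linarith)
  have sub2 : Set.Icc (-(Real.pi / ((M : ℝ) + 1))) 0 ⊆
    Set.Icc (-(Real.pi / (M + 1))) (Real.pi / (M + 1)) := Set.Icc_subset_Icc_right hp.le
  rw [← intervalIntegral.integral_add_adjacent_intervals (b := 0)
    (ContinuousOn.intervalIntegrable (hl ▸ hγint.mono sub2))
    (ContinuousOn.intervalIntegrable (hu ▸ hγint.mono sub1)),
    integral_inv_of_slitPlane (γ' := fun θ => n * saddleCurveDeriv M θ)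
      (u := I) (fun θ hθ => hasDerivAt_saddleContour hM (abs_le.2 (sub2 (hl ▸ hθ))))
      (hl ▸ (continuousOn_saddleContourDeriv hM).mono sub2) I_ne_zero
      (fun θ hθ => by rw [hl] at hθ; exact saddleContour_lower_mem_slitPlane hM hn hk hθ.1 hθ.2),
    integral_inv_of_slitPlane (γ' := fun θ => n * saddleCurveDeriv M θ)
      (u := -I) (fun θ hθ => hasDerivAt_saddleContour hM (abs_le.2 (sub1 (hu ▸ hθ))))
      (hu ▸ (continuousOn_saddleContourDeriv hM).mono sub1) (neg_ne_zero.2 I_ne_zero)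
      (fun θ hθ => by rw [hu] at hθ; exact saddleContour_upper_mem_slitPlane hM hn hk hθ.1 hθ.2)]
  have hr1 : (0 : ℝ) < k + 1 / 4 := by positivity
  have hr2 : (0 : ℝ) < n * ((M + 1) / M) - 1 / 4 - k := by
    linarith [sub_one_lt_saddleContour_zero hM n]
  have e1 : I * (saddleContour M n 0 - k) = I * ((n * ((M + 1) / M) - 1 / 4 - k : ℝ) : ℂ) := by
    rw [saddleContour_zero]; push_cast; ring
  have e2 : -I * (saddleContour M n 0 - k) = -I * ((n * ((M + 1) / M) - 1 / 4 - k : ℝ) : ℂ) := by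
    rw [saddleContour_zero]; push_cast; ring
  have e3 : -I * (saddleContour M n (Real.pi / (M + 1)) - k) = I * ((k + 1 / 4 : ℝ) : ℂ) := by
    rw [saddleContour_end hM]; push_cast; ring
  have e4 : I * (saddleContour M n (-(Real.pi / (M + 1))) - k) = -I * ((k + 1 / 4 : ℝ) : ℂ) := by
    rw [saddleContour_end_neg hM]; push_cast; ring
  rw [e1, e2, e3, e4, log_I_mul hr1, log_I_mul hr2, log_neg_I_mul hr1, log_neg_I_mul hr2]
  ring

lemma tC_eq_circleMap (n : ℕ) (θ : ℝ) :
    tC n θ = circleMap (((n : ℝ) - 1) / 2 : ℝ) (n / 2 - 1 / 8) θ := by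
  rw [tC, circleMap]; push_cast; ring

lemma hasDerivAt_tC (n : ℕ) (θ : ℝ) :
    HasDerivAt (tC n) (((n : ℂ) / 2 - 1/8) * Complex.I * Complex.exp (θ * Complex.I)) θ := by
  have h : tC n = circleMap (((n : ℝ) - 1) / 2 : ℝ) (n / 2 - 1 / 8) :=
    funext (tC_eq_circleMap n)
  rw [h]
  refine (hasDerivAt_circleMap _ _ _).congr_deriv ?_
  rw [circleMap]; push_cast; ring

lemma lt_tC_re (hn : 1 ≤ n) (θ : ℝ) : -(1 / 2) < (tC n θ).re := by
  have hn' : (1 : ℝ) ≤ n := by exact_mod_cast hn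
  have : (tC n θ).re = (n - 1) / 2 + (n / 2 - 1 / 8) * Real.cos θ := by
    rw [tC_eq_circleMap, circleMap, Complex.exp_mul_I]
    simp [← Complex.ofReal_cos, ← Complex.ofReal_sin]
  rw [this]
  nlinarith [Real.neg_one_le_cos θ]

lemma norm_tC_sub (hn : 1 ≤ n) (θ : ℝ) :
    ‖tC n θ - (((n : ℝ) - 1) / 2 : ℝ)‖ = n / 2 - 1 / 8 := by
  have hn' : (1 : ℝ) ≤ n := by exact_mod_cast hn
  rw [tC_eq_circleMap, circleMap_sub_center, norm_circleMap_zero, abs_of_pos (by linarith)]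

lemma natCast_mem_ball {k : ℕ} (hk : k < n) :
    (k : ℂ) ∈ Metric.ball ((((n : ℝ) - 1) / 2 : ℝ) : ℂ) (n / 2 - 1 / 8) := by
  have hk' : (k : ℝ) + 1 ≤ n := by exact_mod_cast hk
  have hk0 : (0 : ℝ) ≤ k := k.cast_nonneg
  rw [Metric.mem_ball, dist_eq_norm, ← Complex.ofReal_natCast, ← Complex.ofReal_sub,
    Complex.norm_real, Real.norm_eq_abs, abs_lt]
  constructor <;> linarith

lemma tC_ne_natCast (hn : 1 ≤ n) {k : ℕ} (hk : k < n) (θ : ℝ) : tC n θ ≠ k := by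
  intro e
  have h1 := natCast_mem_ball hk
  rw [← e, Metric.mem_ball, dist_eq_norm, norm_tC_sub hn] at h1
  exact lt_irrefl _ h1

lemma winding_tC {k : ℕ} (hk : k < n) :
    ∫ θ in (0 : ℝ)..(2 * Real.pi), (tC n θ - k)⁻¹ *
      (((n : ℂ) / 2 - 1/8) * Complex.I * Complex.exp (θ * Complex.I)) = 2 * Real.pi * I := by
  rw [← circleIntegral.integral_sub_inv_of_mem_ball (natCast_mem_ball hk), circleIntegral]
  refine intervalIntegral.integral_congr fun θ _ => ?_
  simp only [← tC_eq_circleMap, deriv_circleMap, smul_eq_mul]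
  rw [circleMap]
  push_cast
  ring

/-- Deformation of the circle to the saddle contour. -/
lemma integral_tC_eq_integral_saddleContour (hM : 1 ≤ M) (hn : 1 ≤ n) {s : ℂ}
    (hs : s.re = -(1 / 2)) {G : ℂ → ℂ} (hG : Differentiable ℂ G) :
    ∫ θ in (0 : ℝ)..(2 * Real.pi), G (tC n θ) / (fallingPoly n (tC n θ) * (s - tC n θ)) *
        (((n : ℂ) / 2 - 1/8) * Complex.I * Complex.exp (θ * Complex.I)) =
      ∫ θ in (-(Real.pi / (M + 1)))..(Real.pi / ((M : ℝ) + 1)),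
        G (saddleContour M n θ) / (fallingPoly n (saddleContour M n θ) *
          (s - saddleContour M n θ)) * (n * saddleCurveDeriv M θ) := by
  classical
  set P : Finset ℂ := insert s ((Finset.range n).image fun k : ℕ => (k : ℂ))
  have hsP : s ∉ (Finset.range n).image fun k : ℕ => (k : ℂ) := by
    intro h
    obtain ⟨k, -, rfl⟩ := Finset.mem_image.1 h
    have : (0 : ℝ) ≤ k := k.cast_nonneg
    simp at hs
    linarith
  have hprod : ∀ t : ℂ, ∏ p ∈ P, (t - p) = -(fallingPoly n t * (s - t)) := by
    intro t
    rw [Finset.prod_insert hsP, Finset.prod_image (fun a _ b _ h => by exact_mod_cast h),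
      fallingPoly]
    ring
  have hI := uIcc_neg_div M
  have main := integral_meromorphic_eq (γ₁ := tC n)
    (γ₁' := fun θ : ℝ => ((n : ℂ) / 2 - 1/8) * Complex.I * Complex.exp (θ * Complex.I))
    (a₁ := 0) (b₁ := 2 * Real.pi) (γ₂ := saddleContour M n)
    (γ₂' := fun θ => n * saddleCurveDeriv M θ) (a₂ := -(Real.pi / (M + 1)))
    (b₂ := Real.pi / (M + 1)) (fun θ _ => hasDerivAt_tC n θ)
    (Continuous.continuousOn (by fun_prop)) (by simp [tC])
    (fun θ hθ => hasDerivAt_saddleContour hM (abs_le.2 (by rwa [hI] at hθ)))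
    (by rw [hI]; exact continuousOn_saddleContourDeriv hM)
    (by rw [saddleContour_end hM, saddleContour_end_neg hM]) P ?_ ?_ ?_ hG
  · simp only [hprod, div_neg, neg_mul, intervalIntegral.integral_neg] at main
    exact neg_injective main
  · intro θ _ h
    rcases Finset.mem_insert.1 h with h | h
    · have := lt_tC_re hn θ
      rw [h, hs] at this
      exact lt_irrefl _ this
    · obtain ⟨k, hk, e⟩ := Finset.mem_image.1 h
      exact tC_ne_natCast hn (Finset.mem_range.1 hk) θ e.symm
  · intro θ hθ h
    rw [hI] at hθ
    rcases Finset.mem_insert.1 h with h | h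
    · have := le_saddleContour_re (n := n) hM (abs_le.2 hθ)
      rw [h, hs] at this
      linarith
    · obtain ⟨k, hk, e⟩ := Finset.mem_image.1 h
      exact saddleContour_ne_natCast hM hn (Finset.mem_range.1 hk) (abs_le.2 hθ) e.symm
  · intro p hp
    rcases Finset.mem_insert.1 hp with rfl | hp
    · rw [integral_inv_of_re_pos (fun θ _ => hasDerivAt_tC n θ)
        (Continuous.continuousOn (by fun_prop)) (by simp [tC])
        (fun θ _ => hs ▸ lt_tC_re hn θ),
        integral_inv_of_re_pos (γ' := fun θ => n * saddleCurveDeriv M θ)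
        (fun θ hθ => hasDerivAt_saddleContour hM (abs_le.2 (by rwa [hI] at hθ)))
        (by rw [hI]; exact continuousOn_saddleContourDeriv hM)
        (by rw [saddleContour_end hM, saddleContour_end_neg hM])]
      intro θ hθ
      rw [hI] at hθ
      have := le_saddleContour_re (n := n) hM (abs_le.2 hθ)
      linarith
    · obtain ⟨k, hk, rfl⟩ := Finset.mem_image.1 hp
      rw [winding_tC (Finset.mem_range.1 hk), winding_saddleContour hM hn (Finset.mem_range.1 hk)]

end Contour

end

section

lemma integral_I_div_add_mul_I {β τ T : ℝ} (hβ : β ≠ 0) :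
    ∫ y in (τ - T)..(τ + T), (1 / (β + (y - τ) * I) : ℂ) = 2 * Real.arctan (T / β) := by
  have hne : ∀ y : ℝ, (β + (y - τ) * I : ℂ) ≠ 0 := fun y h => hβ (by
    have := congrArg Complex.re h
    simpa using this)
  have hpos : ∀ y : ℝ, 0 < β ^ 2 + (y - τ) ^ 2 := fun y => by positivity
  have hd : ∀ y : ℝ, HasDerivAt
      (fun y : ℝ => ((Real.arctan ((y - τ) / β) : ℝ) : ℂ)
        - (((1 / 2) * Real.log (β ^ 2 + (y - τ) ^ 2) : ℝ) : ℂ) * I)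
      (1 / (β + (y - τ) * I) : ℂ) y := by
    intro y
    have h0 : HasDerivAt (fun y : ℝ => y - τ) 1 y := (hasDerivAt_id y).sub_const τ
    have h1 : HasDerivAt (fun y : ℝ => Real.arctan ((y - τ) / β)) _ y := (h0.div_const β).arctan
    have h2 : HasDerivAt (fun y : ℝ => β ^ 2 + (y - τ) ^ 2) _ y := (h0.pow 2).const_add _
    have h3 : HasDerivAt (fun y : ℝ => (1 / 2) * Real.log (β ^ 2 + (y - τ) ^ 2)) _ y :=
      (h2.log (hpos y).ne').const_mul (1 / 2)
    refine (h1.ofReal_comp.sub (h3.ofReal_comp.mul_const I)).congr_deriv ?_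
    have e1 : 1 / (1 + ((y - τ) / β) ^ 2) * (1 / β) = β / (β ^ 2 + (y - τ) ^ 2) := by
      have := (hpos y).ne'
      field_simp
    rw [e1, eq_div_iff (hne y)]
    have e2 : ((β ^ 2 + (y - τ) ^ 2 : ℝ) : ℂ) ≠ 0 := by exact_mod_cast (hpos y).ne'
    push_cast at e2 ⊢
    field_simp
    ring_nf
    rw [I_sq]
    ring
  rw [intervalIntegral.integral_eq_sub_of_hasDerivAt (fun y _ => hd y)]
  · have e1 : (τ + T - τ) / β = T / β := by ring
    have e2 : (τ - T - τ) / β = -(T / β) := by ring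
    have e3 : (τ + T - τ) ^ 2 = (τ - T - τ) ^ 2 := by ring
    rw [e1, e2, e3, Real.arctan_neg]
    push_cast
    ring
  · refine Continuous.intervalIntegrable ?_ _ _
    exact continuous_const.div (by fun_prop) hne

lemma tendsto_arctan_div {β : ℝ} (hβ : β ≠ 0) :
    Tendsto (fun T : ℝ => Real.arctan (T / β)) atTop
      (nhds (if 0 < β then Real.pi / 2 else -(Real.pi / 2))) := by
  split_ifs with h
  · exact (Real.tendsto_arctan_atTop.mono_right nhdsWithin_le_nhds).comp
      (tendsto_id.atTop_div_const h)
  · have h' : β < 0 := lt_of_le_of_ne (not_lt.1 h) hβ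
    have h1 := (Real.tendsto_arctan_atBot.mono_right nhdsWithin_le_nhds).comp
      (tendsto_id.atTop_div_const_of_neg h')
    exact h1

section VerticalShift

variable {f : ℂ → ℂ} {a b C : ℝ} {t : ℂ}

lemma continuous_vertical (hf : DifferentiableOn ℂ f {s | -1 < s.re}) (hb : -1 < b) :
    Continuous fun y : ℝ => f (b + y * I) := by
  have ho : IsOpen {s : ℂ | -1 < s.re} := isOpen_lt continuous_const Complex.continuous_re
  refine continuous_iff_continuousAt.2 fun y => ?_
  have hm : (b + y * I : ℂ) ∈ {s : ℂ | -1 < s.re} := by simpa using hb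
  exact ContinuousAt.comp_of_eq (hf.differentiableAt (ho.mem_nhds hm)).continuousAt
    (by fun_prop) rfl

lemma vertical_sub_ne_zero (h : t.re ≠ b) (y : ℝ) : (b + y * I - t : ℂ) ≠ 0 := fun e => h (by
  have := congrArg Complex.re e
  simp at this
  linarith)

lemma abs_le_norm_vertical_sub (y : ℝ) : |b - t.re| ≤ ‖(b + y * I - t : ℂ)‖ := by
  simpa using Complex.abs_re_le_norm (b + y * I - t : ℂ)

lemma integrable_vertical (hf : DifferentiableOn ℂ f {s | -1 < s.re}) (hb : -1 < b)
    (hC : ∀ y : ℝ, ‖f (b + y * I)‖ ≤ C * (1 + y ^ 2)⁻¹) (h : t.re ≠ b) :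
    Integrable fun y : ℝ => f (b + y * I) / (b + y * I - t) := by
  have hpos : 0 < |b - t.re| := abs_pos.2 (sub_ne_zero.2 h.symm)
  refine Integrable.mono' ((integrable_inv_one_add_sq.const_mul C).div_const |b - t.re|) ?_ ?_
  · exact (Continuous.div (continuous_vertical hf hb) (by fun_prop)
      (vertical_sub_ne_zero h)).aestronglyMeasurable
  · refine Eventually.of_forall fun y => ?_
    rw [norm_div]
    exact div_le_div₀ ((norm_nonneg _).trans (hC y)) (hC y) hpos (abs_le_norm_vertical_sub y)

/-- Shifting a vertical line of integration past a simple pole. -/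
lemma integral_vertical_shift (hf : DifferentiableOn ℂ f {s | -1 < s.re}) (hb : -1 < b)
    (hab : b ≤ a) (hC : ∀ s : ℂ, b ≤ s.re → s.re ≤ a → ‖f s‖ ≤ C * (1 + s.im ^ 2)⁻¹)
    (htb : b < t.re) (hta : t.re ≠ a) :
    ∫ y : ℝ, f (b + y * I) / (b + y * I - t) = (∫ y : ℝ, f (a + y * I) / (a + y * I - t))
      - if t.re < a then 2 * Real.pi * f t else 0 := by
  have hC0 : 0 ≤ C := by
    have := (norm_nonneg _).trans (hC (b : ℂ) (by simp) (by simpa using hab))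
    simpa using this
  set U : Set ℂ := {s | -1 < s.re}
  have ho : IsOpen U := isOpen_lt continuous_const Complex.continuous_re
  have htU : t ∈ U := hb.trans htb
  have hg : DifferentiableOn ℂ (dslope f t) U :=
    (Complex.differentiableOn_dslope (ho.mem_nhds htU)).2 hf
  have hdsl : ∀ s : ℂ, s ≠ t → dslope f t s = f s / (s - t) - f t * (1 / (s - t)) := by
    intro s hs
    rw [dslope_of_ne _ hs, slope_def_field]
    ring
  have ha : -1 < a := hb.trans_le hab
  -- the vertical sides
  have hside : ∀ c : ℝ, -1 < c → t.re ≠ c → ∀ T : ℝ,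
      ∫ y in (t.im - T)..(t.im + T), dslope f t (c + y * I) =
        (∫ y in (t.im - T)..(t.im + T), f (c + y * I) / (c + y * I - t))
          - f t * (2 * Real.arctan (T / (c - t.re))) := by
    intro c hc htc T
    have hne := vertical_sub_ne_zero htc
    have h1 : Continuous fun y : ℝ => f (c + y * I) / (c + y * I - t) :=
      (continuous_vertical hf hc).div (by fun_prop) hne
    have h2 : Continuous fun y : ℝ => 1 / (c + y * I - t : ℂ) :=
      continuous_const.div (by fun_prop) hne
    rw [← integral_I_div_add_mul_I (τ := t.im) (sub_ne_zero.2 htc.symm),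
      ← intervalIntegral.integral_const_mul]
    have e : ∀ y : ℝ, (((c - t.re : ℝ) : ℂ) + (y - t.im) * I) = c + y * I - t := by
      intro y
      apply Complex.ext <;> simp
    simp only [e]
    rw [← intervalIntegral.integral_sub (h1.intervalIntegrable _ _)
      ((h2.intervalIntegrable _ _).const_mul _)]
    exact intervalIntegral.integral_congr fun y _ => hdsl _ (sub_ne_zero.1 (hne y))
  have hlim : ∀ c : ℝ, -1 < c → t.re ≠ c → (∀ y : ℝ, ‖f (c + y * I)‖ ≤ C * (1 + y ^ 2)⁻¹) →
      Tendsto (fun T : ℝ => ∫ y in (t.im - T)..(t.im + T), dslope f t (c + y * I)) atTop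
        (nhds ((∫ y : ℝ, f (c + y * I) / (c + y * I - t)) - f t *
          (2 * ((if 0 < c - t.re then Real.pi / 2 else -(Real.pi / 2) : ℝ) : ℂ)))) := by
    intro c hc htc hCc
    refine Tendsto.congr (fun T => (hside c hc htc T).symm) ?_
    refine Tendsto.sub ?_ (Tendsto.const_mul _ (Tendsto.const_mul _ ?_))
    · refine intervalIntegral_tendsto_integral (integrable_vertical hf hc hCc htc) ?_ ?_
      · exact tendsto_atBot_add_const_left _ _ tendsto_neg_atTop_atBot
      · exact tendsto_atTop_add_const_left _ _ tendsto_id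
    · exact (Complex.continuous_ofReal.tendsto _).comp
        (tendsto_arctan_div (sub_ne_zero.2 htc.symm))
  have hb' := hlim b hb htb.ne' fun y => by
    simpa using hC (b + y * I) (by simp) (by simpa using hab)
  have ha' := hlim a ha hta fun y => by
    simpa using hC (a + y * I) (by simpa using hab) (by simp)
  -- the horizontal sides
  have hhor : ∀ ε : ℝ, |ε| = 1 → Tendsto (fun T : ℝ =>
      ∫ x in b..a, dslope f t (x + ((t.im + ε * T : ℝ) : ℂ) * I)) atTop (nhds 0) := by
    intro ε hε
    have hz : Tendsto (fun T : ℝ => (C + ‖f t‖) / T * |a - b|) atTop (nhds 0) := by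
      have := (tendsto_const_nhds (x := C + ‖f t‖)).div_atTop (tendsto_id (α := ℝ))
      simpa using this.mul_const |a - b|
    refine squeeze_zero_norm' ?_ hz
    filter_upwards [eventually_gt_atTop 0] with T hT
    refine intervalIntegral.norm_integral_le_of_norm_le_const fun x hx => ?_
    rw [Set.uIoc_of_le hab] at hx
    set s : ℂ := x + ((t.im + ε * T : ℝ) : ℂ) * I with hs
    have hsim : (s - t).im = ε * T := by simp [hs]
    have hT' : T ≤ ‖s - t‖ := by
      have := Complex.abs_im_le_norm (s - t)
      rwa [hsim, abs_mul, hε, one_mul, abs_of_pos hT] at this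
    have hst : s ≠ t := fun e => by rw [e, sub_self, norm_zero] at hT'; linarith
    rw [dslope_of_ne _ hst, slope_def_field, norm_div]
    refine div_le_div₀ (by positivity) ((norm_sub_le _ _).trans ?_) hT hT'
    have := hC s (by simp [hs, hx.1.le]) (by simp [hs, hx.2])
    have h2 : C * (1 + s.im ^ 2)⁻¹ ≤ C * 1 := by
      gcongr
      exact inv_le_one_of_one_le₀ (by nlinarith [sq_nonneg s.im])
    linarith
  have h1 := hhor (-1) (by simp)
  have h2 := hhor 1 (by simp)
  have hrect : ∀ T : ℝ, (∫ x in b..a, dslope f t (x + ((t.im + -1 * T : ℝ) : ℂ) * I)) -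
      (∫ x in b..a, dslope f t (x + ((t.im + 1 * T : ℝ) : ℂ) * I)) +
      I * (∫ y in (t.im - T)..(t.im + T), dslope f t (a + y * I)) -
      I * (∫ y in (t.im - T)..(t.im + T), dslope f t (b + y * I)) = 0 := by
    intro T
    have := Complex.integral_boundary_rect_eq_zero_of_differentiableOn (dslope f t)
      (b + ((t.im - T : ℝ) : ℂ) * I) (a + ((t.im + T : ℝ) : ℂ) * I) (hg.mono ?_)
    · have e1 : t.im + -1 * T = t.im - T := by ring
      rw [e1, one_mul]
      simpa using this
    · intro z hz
      rw [mem_reProdIm] at hz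
      have := hz.1
      simp only [add_re, ofReal_re, mul_re, I_re, mul_zero, ofReal_im, I_im, mul_one, sub_self,
        add_zero] at this
      rw [Set.uIcc_of_le hab] at this
      exact hb.trans_le this.1
  have hall := ((h1.sub h2).add (ha'.const_mul I)).sub (hb'.const_mul I)
  simp only [hrect] at hall
  have hfin := tendsto_nhds_unique hall tendsto_const_nhds
  rw [if_neg (by linarith : ¬ (0 < b - t.re))] at hfin
  have hI := I_ne_zero
  split_ifs with hlt
  · rw [if_pos (by linarith)] at hfin
    apply mul_left_cancel₀ hI
    push_cast at hfin
    linear_combination -hfin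
  · rw [if_neg (by linarith)] at hfin
    apply mul_left_cancel₀ hI
    push_cast at hfin
    linear_combination -hfin

end VerticalShift

end

section

lemma norm_Gamma_le {u : ℂ} (hu : 0 < u.re) : ‖Complex.Gamma u‖ ≤ Real.Gamma u.re := by
  rw [Complex.Gamma_eq_integral hu, Real.Gamma_eq_integral hu, Complex.GammaIntegral]
  refine (norm_integral_le_integral_norm _).trans (le_of_eq ?_)
  refine setIntegral_congr_fun measurableSet_Ioi fun x hx => ?_
  have hx' : 0 < x := hx
  simp only [norm_mul, Complex.norm_real, Real.norm_eq_abs, Real.abs_exp,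
    Complex.norm_cpow_eq_rpow_re_of_pos hx', sub_re, one_re]

lemma exists_norm_Gamma_mul_pow_le (m : ℕ) (A : ℝ) : ∃ C, 0 < C ∧ ∀ u : ℂ, 1 / 2 ≤ u.re → u.re ≤ A →
    ‖Complex.Gamma u‖ * ‖u‖ ^ m ≤ C := by
  induction m generalizing A with
  | zero =>
    have hc : ContinuousOn Real.Gamma (Set.Icc (1 / 2) A) := fun x hx =>
      (Real.differentiableAt_Gamma fun k => by
        have : (0 : ℝ) ≤ k := k.cast_nonneg
        have := hx.1
        intro e; linarith).continuousAt.continuousWithinAt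
    obtain ⟨C, hC⟩ := isCompact_Icc.exists_bound_of_continuousOn hc
    refine ⟨|C| + 1, by positivity, fun u h1 h2 => ?_⟩
    have h3 := (le_abs_self _).trans (hC u.re ⟨h1, h2⟩)
    rw [pow_zero, mul_one]
    linarith [norm_Gamma_le (by linarith : 0 < u.re), le_abs_self C]
  | succ m ih =>
    obtain ⟨C, hC0, hC⟩ := ih (A + 1)
    refine ⟨C, hC0, fun u h1 h2 => ?_⟩
    have hu : u ≠ 0 := fun e => by rw [e] at h1; norm_num at h1
    have h3 : ‖u‖ ≤ ‖u + 1‖ := by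
      rw [Complex.norm_def, Complex.norm_def]
      apply Real.sqrt_le_sqrt
      simp [Complex.normSq_apply]
      nlinarith
    calc ‖Complex.Gamma u‖ * ‖u‖ ^ (m + 1) = ‖Complex.Gamma (u + 1)‖ * ‖u‖ ^ m := by
          rw [Complex.Gamma_add_one u hu, norm_mul]; ring
      _ ≤ ‖Complex.Gamma (u + 1)‖ * ‖u + 1‖ ^ m := by gcongr
      _ ≤ C := hC _ (by simp; linarith) (by simpa using h2)

lemma exists_norm_fallingPoly_le_pow (n : ℕ) : ∃ C, 0 < C ∧ ∀ s : ℂ, -(1 / 2) ≤ s.re →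
    ‖fallingPoly n s‖ ≤ C * ‖s + 1‖ ^ n := by
  refine ⟨(2 * n + 3) ^ n, by positivity, fun s hs => ?_⟩
  have h0 : 1 / 2 ≤ ‖s + 1‖ := by
    have := Complex.re_le_norm (s + 1)
    simp at this
    linarith
  rw [fallingPoly, ← mul_pow]
  refine (Finset.norm_prod_le _ _).trans ?_
  refine (Finset.prod_le_prod (g := fun _ => (2 * n + 3) * ‖s + 1‖) (fun _ _ => norm_nonneg _)
    fun k hk => ?_).trans_eq (by simp)
  have hk' : (k : ℝ) ≤ n := by exact_mod_cast (Finset.mem_range.1 hk).le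
  have h1 : ‖s - k‖ ≤ ‖s + 1‖ + (k + 1) := by
    have e : s - k = (s + 1) - ((k : ℂ) + 1) := by ring
    rw [e]
    refine (norm_sub_le _ _).trans ?_
    gcongr
    refine (norm_add_le _ _).trans ?_
    simp
  nlinarith [norm_nonneg (s + 1)]

/-- The `s`-dependent factor of the kernel integrand. -/
noncomputable def kernelNum (M : ℕ) (ν : ℕ → ℕ) (n : ℕ) (l : ℝ) (s : ℂ) : ℂ :=
  weightF M ν n s * Complex.exp (-(s + 1) * l)

section KernelNum

variable {M n : ℕ} {ν : ℕ → ℕ} {l : ℝ}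

lemma gamma_arg_re_pos {s : ℂ} (hs : -1 < s.re) (k : ℕ) : 0 < (s + k + 1).re := by
  have : (0 : ℝ) ≤ k := k.cast_nonneg
  simp
  linarith

lemma differentiableAt_Gamma_add {s : ℂ} (hs : -1 < s.re) (k : ℕ) :
    DifferentiableAt ℂ (fun s : ℂ => Complex.Gamma (s + k + 1)) s := by
  have hd : DifferentiableAt ℂ Complex.Gamma (s + k + 1) :=
    Complex.differentiableAt_Gamma _ fun m e => by
      have h1 := gamma_arg_re_pos hs k
      rw [e] at h1
      simp at h1
      have : (0 : ℝ) ≤ m := m.cast_nonneg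
      linarith
  exact DifferentiableAt.comp s hd (by fun_prop)

lemma differentiable_fallingPoly (n : ℕ) : Differentiable ℂ (fallingPoly n) := by
  have : fallingPoly n = fun t : ℂ => ∏ k ∈ Finset.range n, (t - (k : ℂ)) := rfl
  rw [this]
  fun_prop

lemma differentiableAt_weightF {s : ℂ} (hs : -1 < s.re) : DifferentiableAt ℂ (weightF M ν n) s :=
  (DifferentiableAt.fun_finsetProd fun j _ => differentiableAt_Gamma_add hs (ν (j + 1))).mul
    (differentiable_fallingPoly n s)

lemma gammaProd_ne_zero {s : ℂ} (hs : -1 < s.re) : gammaProd M ν s ≠ 0 :=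
  Finset.prod_ne_zero_iff.2 fun _ _ => Complex.Gamma_ne_zero_of_re_pos (gamma_arg_re_pos hs _)

lemma weightF_ne_zero {s : ℂ} (hs : -1 < s.re) (hk : ∀ k < n, s ≠ k) : weightF M ν n s ≠ 0 :=
  mul_ne_zero (gammaProd_ne_zero hs) (Finset.prod_ne_zero_iff.2 fun k h =>
    sub_ne_zero.2 (hk k (Finset.mem_range.1 h)))

lemma differentiableOn_kernelNum : DifferentiableOn ℂ (kernelNum M ν n l) {s | -1 < s.re} :=
  fun _ hs => (DifferentiableAt.mul (differentiableAt_weightF hs)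
    (by fun_prop)).differentiableWithinAt

lemma exists_norm_kernelNum_le (hM : 1 ≤ M) (ν : ℕ → ℕ) (n : ℕ) (l a : ℝ) :
    ∃ C, ∀ s : ℂ, -(1 / 2) ≤ s.re → s.re ≤ a →
      ‖kernelNum M ν n l s‖ ≤ C * (1 + s.im ^ 2)⁻¹ := by
  obtain ⟨M, rfl⟩ : ∃ m, M = m + 1 := ⟨M - 1, by omega⟩
  obtain ⟨C₁, hC₁, h₁⟩ := exists_norm_fallingPoly_le_pow n
  obtain ⟨C₂, hC₂, h₂⟩ := exists_norm_Gamma_mul_pow_le (n + 2) (a + ν 1 + 1)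
  choose C₃ hC₃ h₃ using fun j => exists_norm_Gamma_mul_pow_le 0 (a + ν (j + 2) + 1)
  refine ⟨(∏ j ∈ Finset.range M, C₃ j) * (5 * C₁ * C₂) * Real.exp (|l| * (|a| + 2)),
    fun s hs hs' => ?_⟩
  have hpos : 0 < 1 + s.im ^ 2 := by positivity
  have key : ∀ k : ℕ, 1 / 2 ≤ (s + k + 1).re ∧ (s + k + 1).re ≤ a + k + 1 := by
    intro k
    have : (0 : ℝ) ≤ k := k.cast_nonneg
    constructor
    · simp; linarith
    · simp; linarith
  have b1 := h₁ s hs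
  have b2 := h₂ _ (key (ν 1)).1 (key (ν 1)).2
  have b3 : ‖∏ j ∈ Finset.range M, Complex.Gamma (s + ν (j + 2) + 1)‖ ≤
      ∏ j ∈ Finset.range M, C₃ j := by
    refine (Finset.norm_prod_le _ _).trans (Finset.prod_le_prod (fun _ _ => norm_nonneg _) ?_)
    intro j _
    simpa using h₃ j _ (key (ν (j + 2))).1 (key (ν (j + 2))).2
  have b4 : ‖Complex.exp (-(s + 1) * l)‖ ≤ Real.exp (|l| * (|a| + 2)) := by
    rw [Complex.norm_exp, Real.exp_le_exp]
    have : (-(s + 1) * l).re = -(s.re + 1) * l := by simp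
    rw [this]
    refine (le_abs_self _).trans ?_
    rw [abs_mul, mul_comm]
    gcongr
    rw [abs_neg, abs_le]
    constructor <;> linarith [abs_nonneg a, le_abs_self a]
  set u := s + ν 1 + 1
  have hu : 1 / 2 ≤ ‖u‖ := (key (ν 1)).1.trans (Complex.re_le_norm _)
  have hsu : ‖s + 1‖ ≤ ‖u‖ := by
    have : (0 : ℝ) ≤ ν 1 := Nat.cast_nonneg _
    rw [Complex.norm_def, Complex.norm_def]
    apply Real.sqrt_le_sqrt
    simp [Complex.normSq_apply, u]
    nlinarith
  have him : s.im ^ 2 ≤ ‖u‖ ^ 2 := by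
    rw [← sq_abs s.im]
    have := Complex.abs_im_le_norm u
    have e : u.im = s.im := by simp [u]
    rw [e] at this
    gcongr
  have h5 : 1 + s.im ^ 2 ≤ 5 * ‖u‖ ^ 2 := by nlinarith
  have b5 : (‖Complex.Gamma u‖ * ‖fallingPoly n s‖) * (1 + s.im ^ 2) ≤ 5 * C₁ * C₂ := by
    calc _ ≤ (‖Complex.Gamma u‖ * (C₁ * ‖u‖ ^ n)) * (5 * ‖u‖ ^ 2) := by
          gcongr
          exact b1.trans (by gcongr)
      _ = 5 * C₁ * (‖Complex.Gamma u‖ * ‖u‖ ^ (n + 2)) := by ring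
      _ ≤ 5 * C₁ * C₂ := by gcongr
  have b6 : ‖Complex.Gamma u‖ * ‖fallingPoly n s‖ ≤ 5 * C₁ * C₂ * (1 + s.im ^ 2)⁻¹ := by
    rwa [← div_eq_mul_inv, le_div_iff₀ hpos]
  rw [kernelNum, weightF, gammaProd, Finset.prod_range_succ']
  simp only [norm_mul, zero_add]
  have hprod : 0 ≤ ∏ j ∈ Finset.range M, C₃ j := Finset.prod_nonneg fun j _ => (hC₃ j).le
  calc _ = ‖∏ j ∈ Finset.range M, Complex.Gamma (s + ν (j + 2) + 1)‖ *
        (‖Complex.Gamma u‖ * ‖fallingPoly n s‖) * ‖Complex.exp (-(s + 1) * l)‖ := by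
        rw [mul_assoc ‖∏ _ ∈ _, _‖]
    _ ≤ (∏ j ∈ Finset.range M, C₃ j) * (5 * C₁ * C₂ * (1 + s.im ^ 2)⁻¹) *
        Real.exp (|l| * (|a| + 2)) := by gcongr
    _ = _ := by ring

end KernelNum

end

section

/-- The entire part of the `t`-dependent factor of the kernel integrand. -/
noncomputable def kernelDen (M : ℕ) (ν : ℕ → ℕ) (l : ℝ) (t : ℂ) : ℂ :=
  Complex.exp (t * l) * ∏ j ∈ Finset.range M, (Complex.Gamma (t + ν (j + 1) + 1))⁻¹

lemma differentiable_kernelDen (M : ℕ) (ν : ℕ → ℕ) (l : ℝ) :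
    Differentiable ℂ (kernelDen M ν l) := by
  refine Differentiable.mul (by fun_prop) (Differentiable.fun_finsetProd fun j _ => ?_)
  exact Complex.differentiable_one_div_Gamma.comp (by fun_prop)

lemma kernelDen_div_fallingPoly (M : ℕ) (ν : ℕ → ℕ) (n : ℕ) (l : ℝ) (t : ℂ) :
    kernelDen M ν l t / fallingPoly n t = Complex.exp (t * l) / weightF M ν n t := by
  rw [kernelDen, weightF, gammaProd, Finset.prod_inv_distrib]
  field_simp

lemma Gamma_sub_add_one_ne_zero {n : ℕ} {t : ℂ} (ht : -1 < t.re) (hk : ∀ k < n, t ≠ k) :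
    Complex.Gamma (t - n + 1) ≠ 0 := by
  have := Gamma_add_one_eq_fallingPoly_mul n hk
  intro e
  rw [e, mul_zero] at this
  exact Complex.Gamma_ne_zero_of_re_pos (by simp; linarith) this

lemma integrand_eq {M : ℕ} {ν : ℕ → ℕ} (hν0 : ν 0 = 0) {n : ℕ} (x y : ℝ) {s t : ℂ}
    (hs : -1 < s.re) (ht : -1 < t.re) (hsk : ∀ k < n, s ≠ k) (htk : ∀ k < n, t ≠ k) :
    integrand M ν n x y s t = kernelNum M ν n (Real.log y) s *
      (kernelDen M ν (Real.log x) t / (fallingPoly n t * (s - t))) := by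
  have h1 := Gamma_sub_add_one_ne_zero hs hsk
  have h2 := Gamma_sub_add_one_ne_zero ht htk
  rw [integrand, Finset.prod_range_succ', hν0, Nat.cast_zero, add_zero, add_zero,
    Gamma_add_one_eq_fallingPoly_mul n hsk, Gamma_add_one_eq_fallingPoly_mul n htk,
    Finset.prod_div_distrib, kernelNum, weightF, gammaProd, kernelDen, Finset.prod_inv_distrib]
  have h3 : fallingPoly n s * Complex.Gamma (s - n + 1) / (fallingPoly n t *
      Complex.Gamma (t - n + 1)) * (Complex.Gamma (t - n + 1) / Complex.Gamma (s - n + 1)) =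
      fallingPoly n s / fallingPoly n t := by
    by_cases h0 : fallingPoly n t = 0
    · simp [h0]
    · field_simp
  rw [mul_assoc (_ / _) (_ / _) (_ / _), h3]
  field_simp

/-- The `t`-dependent factor of the kernel integrand along the saddle contour. -/
noncomputable def contourDensity (M : ℕ) (ν : ℕ → ℕ) (n : ℕ) (l θ : ℝ) : ℂ :=
  Complex.exp (saddleContour M n θ * l) / weightF M ν n (saddleContour M n θ) *
    (n * saddleCurveDeriv M θ)

section

variable {M n : ℕ} {ν : ℕ → ℕ} {θ : ℝ}

lemma sC_re (σ : ℝ) : (sC σ).re = -(1 / 2) := by simp [sC]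

lemma ne_natCast_of_re_neg {s : ℂ} (hs : s.re < 0) (k : ℕ) : s ≠ k := fun e => by
  have : (0 : ℝ) ≤ k := k.cast_nonneg
  rw [e] at hs
  simp at hs
  linarith

lemma integral_integrand_eq (hM : 1 ≤ M) (hν0 : ν 0 = 0) (hn : 1 ≤ n) (x y σ : ℝ) :
    ∫ θ in (0 : ℝ)..(2 * Real.pi),
      (((n : ℂ) / 2 - 1/8) * Complex.I * Complex.exp (θ * Complex.I)) *
        integrand M ν n x y (sC σ) (tC n θ) =
      ∫ θ in (-(Real.pi / (M + 1)))..(Real.pi / ((M : ℝ) + 1)),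
        contourDensity M ν n (Real.log x) θ *
          (kernelNum M ν n (Real.log y) (sC σ) / (sC σ - saddleContour M n θ)) := by
  have e := integral_tC_eq_integral_saddleContour hM hn (sC_re σ)
    (differentiable_kernelDen M ν (Real.log x))
  have hre := sC_re σ
  calc _ = ∫ θ in (0 : ℝ)..(2 * Real.pi), kernelNum M ν n (Real.log y) (sC σ) *
      (kernelDen M ν (Real.log x) (tC n θ) / (fallingPoly n (tC n θ) * (sC σ - tC n θ)) *
        (((n : ℂ) / 2 - 1/8) * Complex.I * Complex.exp (θ * Complex.I))) := by
        refine intervalIntegral.integral_congr fun θ _ => ?_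
        have h1 := lt_tC_re hn θ
        rw [integrand_eq hν0 x y (by linarith) (by linarith)
          (fun k _ => ne_natCast_of_re_neg (by linarith) k) (fun k hk => tC_ne_natCast hn hk θ)]
        ring
    _ = _ := by
        rw [intervalIntegral.integral_const_mul, e, ← intervalIntegral.integral_const_mul]
        refine intervalIntegral.integral_congr fun θ _ => ?_
        rw [contourDensity, ← kernelDen_div_fallingPoly, ← div_div]
        ring

lemma weightF_saddleContour_ne_zero (hM : 1 ≤ M) (hn : 1 ≤ n) (hθ : |θ| ≤ Real.pi / (M + 1)) :
    weightF M ν n (saddleContour M n θ) ≠ 0 :=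
  weightF_ne_zero (by linarith [le_saddleContour_re (n := n) hM hθ])
    fun _ hk => saddleContour_ne_natCast hM hn hk hθ

lemma continuousOn_contourDensity (hM : 1 ≤ M) (hn : 1 ≤ n) (l : ℝ) :
    ContinuousOn (contourDensity M ν n l)
      (Set.Icc (-(Real.pi / (M + 1))) (Real.pi / (M + 1))) := by
  have hc := continuousOn_saddleContour (n := n) hM
  refine ContinuousOn.mul (ContinuousOn.div ?_ ?_ fun θ hθ =>
    weightF_saddleContour_ne_zero hM hn (abs_le.2 hθ)) (continuousOn_saddleContourDeriv hM)
  · exact (hc.mul continuousOn_const).cexp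
  · intro θ hθ
    have h := le_saddleContour_re (n := n) hM (abs_le.2 hθ)
    exact ContinuousAt.comp_continuousWithinAt
      (differentiableAt_weightF (by linarith)).continuousAt (hc θ hθ)

/-- The vertical integral attached to a point of the saddle contour. -/
noncomputable def verticalIntegral (M : ℕ) (ν : ℕ → ℕ) (n : ℕ) (l a θ : ℝ) : ℂ :=
  ∫ y : ℝ, kernelNum M ν n l (a + y * I) / (a + y * I - saddleContour M n θ)

lemma sC_eq (σ : ℝ) : sC σ = ((-(1 / 2) : ℝ) : ℂ) + σ * I := by
  rw [sC]; push_cast; ring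

lemma integrable_prod_kernel (hM : 1 ≤ M) (hn : 1 ≤ n) (l l' : ℝ) :
    Integrable (Function.uncurry fun (σ θ : ℝ) => contourDensity M ν n l θ *
      (kernelNum M ν n l' (sC σ) / (sC σ - saddleContour M n θ)))
      (volume.prod (volume.restrict
        (Set.Ioc (-(Real.pi / (M + 1))) (Real.pi / ((M : ℝ) + 1))))) := by
  obtain ⟨C, hC⟩ := exists_norm_kernelNum_le hM ν n l' 0
  obtain ⟨R, hR⟩ := isCompact_Icc.exists_bound_of_continuousOn
    (continuousOn_contourDensity (ν := ν) hM hn l)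
  have hR0 : 0 ≤ R := (norm_nonneg _).trans (hR 0 (abs_le.1 (by rw [abs_zero]; positivity)))
  set J := Set.Ioc (-(Real.pi / (M + 1))) (Real.pi / ((M : ℝ) + 1))
  have hJ : J ⊆ Set.Icc (-(Real.pi / (M + 1))) (Real.pi / (M + 1)) := Set.Ioc_subset_Icc_self
  have hvol : (volume : Measure (ℝ)).prod (volume.restrict J) =
      (volume.prod volume).restrict (Set.univ ×ˢ J) := by
    rw [← Measure.prod_restrict, Measure.restrict_univ]
  have hms : MeasurableSet ((Set.univ : Set ℝ) ×ˢ J) := MeasurableSet.univ.prod measurableSet_Ioc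
  have hne : ∀ σ : ℝ, ∀ θ ∈ J, 1 / 4 ≤ ‖sC σ - saddleContour M n θ‖ := by
    intro σ θ hθ
    have h1 := le_saddleContour_re (n := n) hM (abs_le.2 (hJ hθ))
    have h2 := Complex.abs_re_le_norm (sC σ - saddleContour M n θ)
    rw [sub_re, sC_re] at h2
    have h3 := neg_abs_le (-(1 / 2) - (saddleContour M n θ).re)
    linarith
  have hb : Integrable (fun z : ℝ × ℝ => (C * (1 + z.1 ^ 2)⁻¹) * (4 * R))
      (volume.prod (volume.restrict J)) :=
    (integrable_inv_one_add_sq.const_mul C).mul_prod (integrable_const (4 * R))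
  refine hb.mono' ?_ ?_
  · rw [hvol]
    refine ContinuousOn.aestronglyMeasurable ?_ hms
    have hsc : Continuous fun z : ℝ × ℝ => sC z.1 := by unfold sC; fun_prop
    have hm : MapsTo (fun z : ℝ × ℝ => z.2) (Set.univ ×ˢ J)
        (Set.Icc (-(Real.pi / (M + 1))) (Real.pi / (M + 1))) := fun z hz => hJ hz.2
    refine ContinuousOn.mul ((continuousOn_contourDensity hM hn l).comp
      continuous_snd.continuousOn hm) (ContinuousOn.div ?_ ?_ fun z hz e => ?_)
    · have : Continuous fun σ : ℝ => kernelNum M ν n l' (sC σ) := by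
        simp only [sC_eq]
        exact continuous_vertical differentiableOn_kernelNum (by norm_num)
      exact (this.comp continuous_fst).continuousOn
    · exact hsc.continuousOn.sub ((continuousOn_saddleContour hM).comp
        continuous_snd.continuousOn hm)
    · have := hne z.1 z.2 hz.2
      rw [e, norm_zero] at this
      norm_num at this
  · rw [hvol]
    refine (ae_restrict_mem hms).mono fun z hz => ?_
    have h1 := hne z.1 z.2 hz.2
    have h2 : ‖kernelNum M ν n l' (sC z.1)‖ ≤ C * (1 + z.1 ^ 2)⁻¹ := by
      have := hC (sC z.1) (sC_re _).ge (by rw [sC_re]; norm_num)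
      simpa [sC] using this
    have h3 := hR z.2 (hJ hz.2)
    simp only [Function.uncurry]
    rw [norm_mul, norm_div]
    calc _ ≤ R * (C * (1 + z.1 ^ 2)⁻¹ / (1 / 4)) := by
          gcongr
          exact (norm_nonneg _).trans h2
      _ = _ := by ring

end

end

section

lemma integral_exp_mul_I_mul (Y L : ℝ) :
    ∫ y in (-Y)..Y, Complex.exp (y * I * L) = 2 * Y * (Real.sinc (Y * L) : ℂ) := by
  by_cases hL : L = 0
  · simp [hL]; ring
  · have h := intervalIntegral.integral_comp_mul_right (a := -Y) (b := Y)
      (fun t : ℝ => Complex.exp (t * I)) hL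
    have e : ∀ y : ℝ, Complex.exp (y * I * L) = Complex.exp ((y * L : ℝ) * I) := by
      intro y; push_cast; ring_nf
    simp only [e]
    rw [h, neg_mul, integral_exp_mul_I_eq_sinc, Complex.real_smul]
    have : (L : ℂ) ≠ 0 := by exact_mod_cast hL
    push_cast
    field_simp

lemma vertical_primitive_sub {E : ℂ → ℂ} {L : ℝ}
    (hE : ∀ z, HasDerivAt E (Complex.exp (z * L)) z) (a Y : ℝ) :
    E (a + Y * I) - E (a - Y * I) =
      I * (Complex.exp (a * L) * (2 * Y * (Real.sinc (Y * L) : ℂ))) := by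
  have hd : ∀ y : ℝ, HasDerivAt (fun y : ℝ => E (a + y * I))
      (I * (Complex.exp (a * L) * Complex.exp (y * I * L))) y := by
    intro y
    have h1 : HasDerivAt (fun y : ℝ => (a + y * I : ℂ)) (1 * I) y :=
      ((hasDerivAt_id y).ofReal_comp.mul_const I).const_add _
    refine ((hE (a + y * I)).comp_of_eq y h1 rfl).congr_deriv ?_
    rw [← Complex.exp_add, ← add_mul]
    ring
  have h := intervalIntegral.integral_eq_sub_of_hasDerivAt (a := -Y) (b := Y)
    (fun y _ => hd y) (Continuous.intervalIntegrable (by fun_prop) _ _)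
  rw [intervalIntegral.integral_const_mul, intervalIntegral.integral_const_mul,
    integral_exp_mul_I_mul] at h
  rw [h]
  push_cast
  ring_nf

section

variable {M n : ℕ} {ν : ℕ → ℕ} {φ θ : ℝ}

lemma Kn_eq_integral (hM : 1 ≤ M) (hν0 : ν 0 = 0) (hn : 1 ≤ n) (x y : ℝ) :
    Kn M ν n x y = (1 / (2 * (Real.pi : ℂ) * Complex.I) ^ 2) * (I *
      ∫ θ in (-(Real.pi / (M + 1)))..(Real.pi / ((M : ℝ) + 1)),
        contourDensity M ν n (Real.log x) θ *
          verticalIntegral M ν n (Real.log y) (-(1 / 2)) θ) := by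
  have hp : 0 < Real.pi / ((M : ℝ) + 1) := by positivity
  have hle : -(Real.pi / ((M : ℝ) + 1)) ≤ Real.pi / (M + 1) := by linarith
  rw [Kn]
  congr 1
  simp only [integral_integrand_eq hM hν0 hn]
  rw [integral_const_mul]
  congr 1
  simp only [intervalIntegral.integral_of_le hle]
  rw [integral_integral_swap (integrable_prod_kernel hM hn _ _)]
  refine integral_congr_ae (Eventually.of_forall fun θ => ?_)
  simp only
  rw [integral_const_mul, verticalIntegral]
  simp only [sC_eq]

lemma intervalIntegrable_contourDensity_mul (hM : 1 ≤ M) (hn : 1 ≤ n) (l l' : ℝ) :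
    IntervalIntegrable (fun θ => contourDensity M ν n l θ *
      verticalIntegral M ν n l' (-(1 / 2)) θ) volume
        (-(Real.pi / (M + 1))) (Real.pi / ((M : ℝ) + 1)) := by
  have hp : 0 < Real.pi / ((M : ℝ) + 1) := by positivity
  rw [intervalIntegrable_iff_integrableOn_Ioc_of_le (by linarith)]
  refine (integrable_prod_kernel (ν := ν) hM hn l l').integral_prod_right.congr
    (Eventually.of_forall fun θ => ?_)
  simp only [Function.uncurry]
  rw [integral_const_mul, verticalIntegral]
  simp only [sC_eq]

lemma saddleCurve_re_lt_iff (hM : 1 ≤ M) (hφ : 0 < φ) (hφ' : φ < Real.pi / (M + 1))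
    (hθ : |θ| ≤ Real.pi / (M + 1)) : (saddleCurve M θ).re < (saddleCurve M φ).re ↔ φ < |θ| := by
  rw [← saddleCurve_re_abs M θ]
  exact (strictAntiOn_saddleCurve_re hM).lt_iff_gt ⟨abs_nonneg _, hθ⟩ ⟨hφ.le, hφ'.le⟩

lemma saddleCurve_re_eq_iff (hM : 1 ≤ M) (hφ : 0 < φ) (hφ' : φ < Real.pi / (M + 1))
    (hθ : |θ| ≤ Real.pi / (M + 1)) : (saddleCurve M θ).re = (saddleCurve M φ).re ↔ φ = |θ| := by
  rw [← saddleCurve_re_abs M θ]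
  refine ⟨fun h => ((strictAntiOn_saddleCurve_re hM).injOn ⟨abs_nonneg _, hθ⟩
    ⟨hφ.le, hφ'.le⟩ h).symm, fun h => by rw [h]⟩

lemma verticalIntegral_shift (hM : 1 ≤ M) (hn : 1 ≤ n) (hφ : 0 < φ)
    (hφ' : φ < Real.pi / (M + 1)) (hθ : |θ| ≤ Real.pi / (M + 1)) (hne : φ ≠ |θ|) (l : ℝ) :
    verticalIntegral M ν n l (-(1 / 2)) θ =
      verticalIntegral M ν n l (saddleContour M n φ).re θ -
        if φ < |θ| then 2 * Real.pi * kernelNum M ν n l (saddleContour M n θ) else 0 := by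
  have hn' : (0 : ℝ) < n := by exact_mod_cast hn
  obtain ⟨C, hC⟩ := exists_norm_kernelNum_le hM ν n l (saddleContour M n φ).re
  have h1 := le_saddleContour_re (n := n) hM hθ
  have h2 := le_saddleContour_re (n := n) hM (θ := φ) (by rw [abs_of_pos hφ]; exact hφ'.le)
  have e1 : (saddleContour M n θ).re < (saddleContour M n φ).re ↔ φ < |θ| := by
    rw [← saddleCurve_re_lt_iff hM hφ hφ' hθ, saddleContour_re, saddleContour_re]
    simp [hn']
  have e2 : (saddleContour M n θ).re ≠ (saddleContour M n φ).re := by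
    rw [Ne, ← saddleCurve_re_eq_iff hM hφ hφ' hθ] at hne
    rw [saddleContour_re, saddleContour_re]
    simpa [hn'.ne'] using hne
  rw [verticalIntegral, integral_vertical_shift differentiableOn_kernelNum (by norm_num)
    (by linarith) hC (by linarith) e2, verticalIntegral]
  simp only [e1]

lemma contourDensity_mul_kernelNum (hM : 1 ≤ M) (hn : 1 ≤ n)
    (hθ : |θ| ≤ Real.pi / (M + 1)) (l l' : ℝ) :
    contourDensity M ν n l θ * kernelNum M ν n l' (saddleContour M n θ) =
      Complex.exp (-l') * (Complex.exp (saddleContour M n θ * (l - l' : ℝ)) *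
        (n * saddleCurveDeriv M θ)) := by
  have h := weightF_saddleContour_ne_zero (ν := ν) hM hn hθ
  rw [contourDensity, kernelNum]
  have e : Complex.exp (-l') * Complex.exp (saddleContour M n θ * (l - l' : ℝ)) =
      Complex.exp (saddleContour M n θ * l) *
        Complex.exp (-(saddleContour M n θ + 1) * l') := by
    rw [← Complex.exp_add, ← Complex.exp_add]
    congr 1
    push_cast
    ring
  rw [← mul_assoc (Complex.exp (-l')), e]
  field_simp

lemma integral_residue (hM : 1 ≤ M) (hn : 1 ≤ n) (hφ : 0 < φ)
    (hφ' : φ < Real.pi / (M + 1)) (l l' : ℝ) :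
    IntervalIntegrable (fun θ => contourDensity M ν n l θ *
      if φ < |θ| then 2 * Real.pi * kernelNum M ν n l' (saddleContour M n θ) else 0) volume
        (-(Real.pi / (M + 1))) (Real.pi / ((M : ℝ) + 1)) ∧
    ∫ θ in (-(Real.pi / (M + 1)))..(Real.pi / ((M : ℝ) + 1)), (contourDensity M ν n l θ *
      if φ < |θ| then 2 * Real.pi * kernelNum M ν n l' (saddleContour M n θ) else 0) =
      -(2 * Real.pi * Complex.exp (-l') *
        (I * (Complex.exp ((saddleContour M n φ).re * (l - l' : ℝ)) *
        (2 * (saddleContour M n φ).im *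
          (Real.sinc ((saddleContour M n φ).im * (l - l')) : ℂ))))) := by
  set f : ℝ → ℂ := fun θ => contourDensity M ν n l θ *
    if φ < |θ| then 2 * Real.pi * kernelNum M ν n l' (saddleContour M n θ) else 0 with hf
  set φ0 := Real.pi / ((M : ℝ) + 1)
  set g : ℝ → ℂ := fun θ => 2 * Real.pi * Complex.exp (-l') *
    (Complex.exp (saddleContour M n θ * (l - l' : ℝ)) * (n * saddleCurveDeriv M θ)) with hg
  have hgc : ContinuousOn g (Set.Icc (-φ0) φ0) :=
    continuousOn_const.mul (((continuousOn_saddleContour hM).mul continuousOn_const).cexp.mul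
      (continuousOn_saddleContourDeriv hM))
  obtain ⟨E, hE⟩ := (by fun_prop : Differentiable ℂ
    fun z : ℂ => Complex.exp (z * (l - l' : ℝ))).isExactOn_univ
  have hE' : ∀ z, HasDerivAt E (Complex.exp (z * (l - l' : ℝ))) z := fun z => hE z (mem_univ z)
  have hd : ∀ θ, |θ| ≤ φ0 → HasDerivAt (fun θ => 2 * Real.pi * Complex.exp (-l') *
      E (saddleContour M n θ)) (g θ) θ := fun θ hθ =>
    ((hE' _).comp_of_eq θ (hasDerivAt_saddleContour hM hθ) rfl).const_mul _
  have hfg : ∀ θ, |θ| ≤ φ0 → φ < |θ| → f θ = g θ := by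
    intro θ h1 h2
    simp only [hf, hg]
    rw [if_pos h2, mul_left_comm, contourDensity_mul_kernelNum hM hn h1]
    ring
  have hf0 : ∀ θ, |θ| < φ → f θ = 0 := by
    intro θ h2
    simp only [hf]
    rw [if_neg (not_lt.2 h2.le), mul_zero]
  have hφ0 : 0 < φ0 := by positivity
  have piece : ∀ a b : ℝ, a ≤ b → Set.Icc a b ⊆ Set.Icc (-φ0) φ0 →
      IntervalIntegrable g volume a b ∧ ∫ θ in a..b, g θ = 2 * Real.pi * Complex.exp (-l') *
        E (saddleContour M n b) - 2 * Real.pi * Complex.exp (-l') * E (saddleContour M n a) := by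
    intro a b hab hsub
    have hi : IntervalIntegrable g volume a b :=
      (hgc.mono ((Set.uIcc_of_le hab).trans_subset hsub)).intervalIntegrable
    refine ⟨hi, intervalIntegral.integral_eq_sub_of_hasDerivAt (fun θ hθ => hd θ ?_) hi⟩
    rw [Set.uIcc_of_le hab] at hθ
    exact abs_le.2 (hsub hθ)
  have p1 := piece (-φ0) (-φ) (by linarith) (Set.Icc_subset_Icc_right (by linarith))
  have p2 := piece φ φ0 hφ'.le (Set.Icc_subset_Icc_left (by linarith))
  have q1 : Set.EqOn g f (Set.uIoo (-φ0) (-φ)) := by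
    intro θ hθ
    rw [Set.uIoo_of_le (by linarith)] at hθ
    have : |θ| = -θ := abs_of_neg (by linarith [hθ.2])
    exact (hfg θ (by rw [this]; linarith [hθ.1]) (by rw [this]; linarith [hθ.2])).symm
  have q2 : Set.EqOn g f (Set.uIoo φ φ0) := by
    intro θ hθ
    rw [Set.uIoo_of_le hφ'.le] at hθ
    have : |θ| = θ := abs_of_pos (by linarith [hθ.1])
    exact (hfg θ (by rw [this]; exact hθ.2.le) (by rw [this]; exact hθ.1)).symm
  have q3 : Set.EqOn (fun _ => (0 : ℂ)) f (Set.uIoo (-φ) φ) := by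
    intro θ hθ
    rw [Set.uIoo_of_le (by linarith)] at hθ
    exact (hf0 θ (abs_lt.2 hθ)).symm
  have i1 := p1.1.congr_uIoo q1
  have i2 := p2.1.congr_uIoo q2
  have i3 : IntervalIntegrable f volume (-φ) φ :=
    (intervalIntegrable_const (c := (0 : ℂ))).congr_uIoo q3
  refine ⟨(i1.trans i3).trans i2, ?_⟩
  rw [← intervalIntegral.integral_add_adjacent_intervals (i1.trans i3) i2,
    ← intervalIntegral.integral_add_adjacent_intervals i1 i3,
    ← intervalIntegral.integral_congr_uIoo q1, ← intervalIntegral.integral_congr_uIoo q2,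
    ← intervalIntegral.integral_congr_uIoo q3, p1.2, p2.2, intervalIntegral.integral_zero]
  have v := vertical_primitive_sub hE' (saddleContour M n φ).re (saddleContour M n φ).im
  have c1 : ((saddleContour M n φ).re + (saddleContour M n φ).im * I : ℂ) = saddleContour M n φ :=
    Complex.re_add_im _
  have c2 : ((saddleContour M n φ).re - (saddleContour M n φ).im * I : ℂ) =
      saddleContour M n (-φ) := by
    rw [saddleContour_neg]
    apply Complex.ext <;> simp
  rw [c1, c2] at v
  rw [saddleContour_end hM, saddleContour_end_neg hM, ← v]
  ring

/-- The kernel as a sine-kernel main term plus an oscillatory double integral. -/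
lemma Kn_eq (hM : 1 ≤ M) (hν0 : ν 0 = 0) (hn : 1 ≤ n) (hφ : 0 < φ)
    (hφ' : φ < Real.pi / (M + 1)) (x y : ℝ) :
    Kn M ν n x y = Complex.exp (-Real.log y) *
      (Complex.exp ((saddleContour M n φ).re * (Real.log x - Real.log y : ℝ)) *
        ((saddleContour M n φ).im / Real.pi *
          (Real.sinc ((saddleContour M n φ).im * (Real.log x - Real.log y)) : ℂ))) +
      (1 / (2 * (Real.pi : ℂ) * Complex.I) ^ 2) * (I *
      ∫ θ in (-(Real.pi / (M + 1)))..(Real.pi / ((M : ℝ) + 1)),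
        contourDensity M ν n (Real.log x) θ *
          verticalIntegral M ν n (Real.log y) (saddleContour M n φ).re θ) := by
  have hp : 0 < Real.pi / ((M : ℝ) + 1) := by positivity
  obtain ⟨r1, r2⟩ := integral_residue (ν := ν) hM hn hφ hφ' (Real.log x) (Real.log y)
  have i1 := intervalIntegrable_contourDensity_mul (ν := ν) hM hn (Real.log x) (Real.log y)
  have e : ∫ θ in (-(Real.pi / (M + 1)))..(Real.pi / ((M : ℝ) + 1)),
        contourDensity M ν n (Real.log x) θ *
          verticalIntegral M ν n (Real.log y) (saddleContour M n φ).re θ =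
      ∫ θ in (-(Real.pi / (M + 1)))..(Real.pi / ((M : ℝ) + 1)),
        (contourDensity M ν n (Real.log x) θ * verticalIntegral M ν n (Real.log y) (-(1 / 2)) θ +
        contourDensity M ν n (Real.log x) θ *
      if φ < |θ| then 2 * Real.pi * kernelNum M ν n (Real.log y) (saddleContour M n θ) else 0) := by
    refine intervalIntegral.integral_congr_ae ?_
    have h1 := Measure.ae_ne (volume : Measure ℝ) φ
    have h2 := Measure.ae_ne (volume : Measure ℝ) (-φ)
    filter_upwards [h1, h2] with θ h1 h2 hθ
    rw [Set.uIoc_of_le (by linarith)] at hθ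
    have hne : φ ≠ |θ| := fun h => by
      rcases abs_choice θ with h' | h' <;> rw [h'] at h
      · exact h1 h.symm
      · exact h2 (by linarith)
    rw [verticalIntegral_shift hM hn hφ hφ' (abs_le.2 ⟨hθ.1.le, hθ.2⟩) hne, mul_sub, sub_add_cancel]
  rw [Kn_eq_integral hM hν0 hn, e, intervalIntegral.integral_add i1 r1, r2]
  have hpi : (Real.pi : ℂ) ≠ 0 := by exact_mod_cast Real.pi_ne_zero
  field_simp
  ring_nf

end

end

section

/-- The inverse square root singularity, cut off at distance `r`. -/
noncomputable def rootCut (r u : ℝ) : ℝ :=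
  (Set.Iic r).indicator (fun x => x ^ (-(1 / 2) : ℝ)) |u|

lemma rootCut_nonneg (r u : ℝ) : 0 ≤ rootCut r u :=
  Set.indicator_apply_nonneg fun _ => Real.rpow_nonneg (abs_nonneg u) _

lemma integral_rootCut {r : ℝ} (hr : 0 < r) : ∫ u, rootCut r u = 4 * r ^ (1 / 2 : ℝ) := by
  have h := integral_comp_abs (f := (Set.Iic r).indicator fun x => x ^ (-(1 / 2) : ℝ))
  rw [show (∫ u, rootCut r u) = _ from h, integral_indicator measurableSet_Iic,
    Measure.restrict_restrict measurableSet_Iic, Set.inter_comm, Set.Ioi_inter_Iic,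
    ← intervalIntegral.integral_of_le hr.le, integral_rpow (Or.inl (by norm_num))]
  norm_num
  ring

lemma integrable_rootCut {r : ℝ} (hr : 0 < r) : Integrable (rootCut r) := by
  by_contra h
  have h1 := integral_undef h
  rw [integral_rootCut hr] at h1
  have : 0 < r ^ (1 / 2 : ℝ) := by positivity
  linarith

lemma mul_rpow_abs_le {d r : ℝ} (hd : 0 ≤ d) (hd' : d ≤ 1) (hr : 0 < r) (u : ℝ) :
    d * |u| ^ (-(1 / 2) : ℝ) ≤ rootCut r u + r ^ (-(1 / 2) : ℝ) * d := by
  by_cases h : |u| ≤ r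
  · rw [rootCut, Set.indicator_of_mem (Set.mem_Iic.2 h)]
    have h1 : 0 ≤ |u| ^ (-(1 / 2) : ℝ) := by positivity
    have h2 : 0 ≤ r ^ (-(1 / 2) : ℝ) * d := by positivity
    nlinarith
  · rw [rootCut, Set.indicator_of_notMem (by simpa using h), zero_add, mul_comm]
    push Not at h
    exact mul_le_mul_of_nonneg_right
      (Real.rpow_le_rpow_of_nonpos hr h.le (by norm_num)) hd

lemma norm_inv_le_rpow {w : ℂ} (h1 : w.re ≠ 0) (h2 : w.im ≠ 0) :
    ‖w‖⁻¹ ≤ |w.re| ^ (-(1 / 2) : ℝ) * |w.im| ^ (-(1 / 2) : ℝ) := by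
  have h1' := abs_pos.2 h1
  have h2' := abs_pos.2 h2
  rw [Real.rpow_neg h1'.le, Real.rpow_neg h2'.le, ← mul_inv, ← Real.sqrt_eq_rpow,
    ← Real.sqrt_eq_rpow]
  refine inv_anti₀ (by positivity) ?_
  calc √|w.re| * √|w.im| ≤ √‖w‖ * √‖w‖ := by
        gcongr
        · exact Complex.abs_re_le_norm w
        · exact Complex.abs_im_le_norm w
    _ = ‖w‖ := Real.mul_self_sqrt (norm_nonneg w)

lemma integrable_exp_neg_mul_abs {c : ℝ} (hc : 0 < c) :
    Integrable fun y : ℝ => Real.exp (-c * |y|) := by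
  by_contra h
  have h1 := integral_undef h
  rw [integral_comp_abs (f := fun x => Real.exp (-c * x)), integral_exp_mul_Ioi (by linarith)] at h1
  simp [hc.ne'] at h1

section

variable {M : ℕ} {φ x0 : ℝ}

lemma exists_exp_saddleDrop_le (hM : 1 ≤ M) (hφ : 0 < φ) (hφ' : φ < Real.pi / (M + 1)) :
    ∃ g : ℝ → ℝ, Integrable g ∧ ∀ n : ℕ, 1 ≤ n → ∀ y,
      ‖Real.exp (-(n * saddleDrop M φ x0 y / 4))‖ ≤ g y := by
  obtain ⟨ε, C, hε, h⟩ := exists_le_saddleDrop (x0 := x0) hM hφ hφ'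
  refine ⟨_, (integrable_exp_neg_mul_abs (c := ε / 4) (by positivity)).const_mul
    (Real.exp (C / 4)), fun n hn y => ?_⟩
  rw [Real.norm_eq_abs, Real.abs_exp, ← Real.exp_add, Real.exp_le_exp]
  have h1 := h y
  have h2 := saddleDrop_nonneg (x0 := x0) hM hφ hφ' y
  have h3 : (1 : ℝ) ≤ n := by exact_mod_cast hn
  nlinarith [mul_le_mul_of_nonneg_right h3 h2]

lemma continuous_exp_saddleDrop (n : ℕ) :
    Continuous fun y => Real.exp (-(n * saddleDrop M φ x0 y / 4)) := by
  have := continuous_saddleDrop (M := M) (φ := φ) (x0 := x0)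
  fun_prop

lemma integrable_exp_saddleDrop (hM : 1 ≤ M) (hφ : 0 < φ) (hφ' : φ < Real.pi / (M + 1)) {n : ℕ}
    (hn : 1 ≤ n) : Integrable fun y => Real.exp (-(n * saddleDrop M φ x0 y / 4)) := by
  obtain ⟨g, hg, h⟩ := exists_exp_saddleDrop_le (x0 := x0) hM hφ hφ'
  exact hg.mono' (continuous_exp_saddleDrop n).aestronglyMeasurable
    (Eventually.of_forall (h n hn))

lemma tendsto_integral_exp_saddleDrop (hM : 1 ≤ M) (hφ : 0 < φ) (hφ' : φ < Real.pi / (M + 1)) :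
    Tendsto (fun n : ℕ => ∫ y, Real.exp (-(n * saddleDrop M φ x0 y / 4))) atTop (nhds 0) := by
  obtain ⟨g, hg, h⟩ := exists_exp_saddleDrop_le (x0 := x0) hM hφ hφ'
  rw [← tendsto_add_atTop_iff_nat 1, ← integral_zero ℝ ℝ]
  refine tendsto_integral_of_dominated_convergence g
    (fun n => (continuous_exp_saddleDrop (n + 1)).aestronglyMeasurable) hg
    (fun n => Eventually.of_forall (h (n + 1) (by omega))) ?_
  filter_upwards [Measure.ae_ne (volume : Measure ℝ) (saddleCurve M φ).im,
    Measure.ae_ne (volume : Measure ℝ) (-(saddleCurve M φ).im)] with y h1 h2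
  have hne : |y| ≠ (saddleCurve M φ).im := fun h => by
    rcases abs_choice y with h' | h' <;> rw [h'] at h
    · exact h1 h
    · exact h2 (by linarith)
  have hp := saddleDrop_pos (x0 := x0) hM hφ hφ' hne
  refine Real.tendsto_exp_neg_atTop_nhds_zero.comp ?_
  have := (tendsto_natCast_atTop_atTop (R := ℝ)).comp (tendsto_add_atTop_nat 1)
  simpa [mul_div_assoc] using this.atTop_mul_const (by positivity : 0 < saddleDrop M φ x0 y / 4)

/-- The weakly singular integral of the Gaussian-like profile is uniformly small. -/
lemma norm_integral_le_rootCut (hM : 1 ≤ M) (hφ : 0 < φ) (hφ' : φ < Real.pi / (M + 1)) {n : ℕ}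
    (hn : 1 ≤ n) {r : ℝ} (hr : 0 < r) {A b : ℝ} (hA : 0 ≤ A) {F : ℝ → ℂ}
    (hF : ∀ y, y ≠ b → ‖F y‖ ≤ A * (Real.exp (-(n * saddleDrop M φ x0 y / 4)) *
      |y - b| ^ (-(1 / 2) : ℝ))) :
    ‖∫ y, F y‖ ≤ A * (4 * r ^ (1 / 2 : ℝ) + r ^ (-(1 / 2) : ℝ) *
      ∫ y, Real.exp (-(n * saddleDrop M φ x0 y / 4))) := by
  have i1 := (integrable_rootCut hr).comp_sub_right b
  have i2 := (integrable_exp_saddleDrop (x0 := x0) hM hφ hφ' hn).const_mul (r ^ (-(1 / 2) : ℝ))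
  have e : A * (4 * r ^ (1 / 2 : ℝ) + r ^ (-(1 / 2) : ℝ) *
      ∫ y, Real.exp (-(n * saddleDrop M φ x0 y / 4))) =
      ∫ y, A * (rootCut r (y - b) + r ^ (-(1 / 2) : ℝ) *
        Real.exp (-(n * saddleDrop M φ x0 y / 4))) := by
    rw [integral_const_mul, integral_add i1 i2, integral_sub_right_eq_self (rootCut r),
      integral_rootCut hr, integral_const_mul]
  rw [e]
  refine MeasureTheory.norm_integral_le_of_norm_le ((i1.add i2).const_mul A) ?_
  filter_upwards [Measure.ae_ne (volume : Measure ℝ) b] with y hy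
  refine (hF y hy).trans (mul_le_mul_of_nonneg_left
    (mul_rpow_abs_le (Real.exp_pos _).le ?_ hr _) hA)
  rw [Real.exp_le_one_iff]
  have := mul_nonneg (n.cast_nonneg (α := ℝ)) (saddleDrop_nonneg (x0 := x0) hM hφ hφ' y)
  linarith

end

end

section

section

variable {M n : ℕ} {ν : ℕ → ℕ} {φ x0 θ : ℝ}

lemma norm_contourDensity (M : ℕ) (ν : ℕ → ℕ) (n : ℕ) (l θ : ℝ) :
    ‖contourDensity M ν n l θ‖ = Real.exp ((n * (saddleCurve M θ).re - 1 / 4) * l) /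
      ‖weightF M ν n (n * saddleCurve M θ - 1 / 4)‖ * (n * ‖saddleCurveDeriv M θ‖) := by
  rw [contourDensity, norm_mul, norm_div, Complex.norm_exp, norm_mul, Complex.norm_natCast,
    Complex.re_mul_ofReal, saddleContour_re, saddleContour]

lemma norm_kernelNum (M : ℕ) (ν : ℕ → ℕ) (n : ℕ) (l : ℝ) (s : ℂ) :
    ‖kernelNum M ν n l s‖ = ‖weightF M ν n s‖ * Real.exp (-(s.re + 1) * l) := by
  rw [kernelNum, norm_mul, Complex.norm_exp, Complex.re_mul_ofReal]
  simp

lemma verticalIntegral_eq (hn : 1 ≤ n) (l : ℝ) :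
    verticalIntegral M ν n l (saddleContour M n φ).re θ =
      ∫ y : ℝ, kernelNum M ν n l (n * ((saddleCurve M φ).re + y * I) - 1 / 4) /
        ((saddleCurve M φ).re + y * I - saddleCurve M θ) := by
  have hn' : (0 : ℝ) < n := by exact_mod_cast hn
  have hnc : (n : ℂ) ≠ 0 := by exact_mod_cast hn'.ne'
  have h := MeasureTheory.Measure.integral_comp_mul_left (fun y : ℝ =>
    kernelNum M ν n l ((saddleContour M n φ).re + y * I) /
      ((saddleContour M n φ).re + y * I - saddleContour M n θ)) (n : ℝ)
  have h2 : verticalIntegral M ν n l (saddleContour M n φ).re θ = (n : ℝ) • ∫ y : ℝ,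
      kernelNum M ν n l ((saddleContour M n φ).re + (n * y : ℝ) * I) /
      ((saddleContour M n φ).re + (n * y : ℝ) * I - saddleContour M n θ) := by
    rw [h, smul_smul, abs_of_pos (by positivity), mul_inv_cancel₀ hn'.ne', one_smul,
      verticalIntegral]
  rw [h2, ← integral_smul]
  refine integral_congr_ae (Eventually.of_forall fun y => ?_)
  beta_reduce
  rw [saddleContour_re, saddleContour, Complex.real_smul]
  have e1 : ((n * (saddleCurve M φ).re - 1 / 4 : ℝ) : ℂ) + (n * y : ℝ) * I =
      n * ((saddleCurve M φ).re + y * I) - 1 / 4 := by push_cast; ring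
  have e2 : (n : ℂ) * ((saddleCurve M φ).re + y * I) - 1 / 4 - (n * saddleCurve M θ - 1 / 4) =
      n * ((saddleCurve M φ).re + y * I - saddleCurve M θ) := by ring
  rw [e1, e2, Complex.ofReal_natCast, mul_div_assoc',
    mul_div_mul_left _ _ hnc]

lemma exponent_le {n c t R B lX lY l0 L : ℝ} (hn : 1 ≤ n) (hc : 0 ≤ c) (ht : 0 ≤ t)
    (hcR : c ≤ R) (htR : t ≤ R) (hX : n * |lX - l0| ≤ B) (hY : n * |lY - l0| ≤ B) :
    (n * t - 1 / 4) * (L + lX) + -(n * c + 3 / 4) * (L + lY) + n * (c - t) * (L + l0) ≤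
      -L - l0 + 2 * (R + 1) * B := by
  have key : ∀ d a : ℝ, |a| ≤ n * (R + 1) → n * |d| ≤ B → a * d ≤ (R + 1) * B := by
    intro d a ha hd
    calc a * d ≤ |a| * |d| := by rw [← abs_mul]; exact le_abs_self _
      _ ≤ n * (R + 1) * |d| := by gcongr
      _ = (R + 1) * (n * |d|) := by ring
      _ ≤ (R + 1) * B := by gcongr; linarith
  have h1 := key (lX - l0) (n * t - 1 / 4) (abs_le.2 ⟨by nlinarith, by nlinarith⟩) hX
  have h2 := key (lY - l0) (-(n * c + 3 / 4)) (abs_le.2 ⟨by nlinarith, by nlinarith⟩) hY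
  linarith

lemma rpow_abs_abs_sub_le (φ θ : ℝ) : |(|θ| - φ)| ^ (-(1 / 2) : ℝ) ≤
    rootCut 1 (θ - φ) + rootCut 1 (θ + φ) + 1 := by
  have h := mul_rpow_abs_le (d := 1) zero_le_one le_rfl one_pos (|θ| - φ)
  rw [one_mul, Real.one_rpow, one_mul] at h
  refine h.trans ?_
  have h1 := rootCut_nonneg 1 (θ - φ)
  have h2 := rootCut_nonneg 1 (θ + φ)
  rcases abs_choice θ with h' | h' <;> rw [h']
  · linarith
  · have : rootCut 1 (-θ - φ) = rootCut 1 (θ + φ) := by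
      rw [rootCut, rootCut, show -θ - φ = -(θ + φ) by ring, abs_neg]
    linarith

lemma norm_contourDensity_mul_le (hn : 1 ≤ n) {c R B K d X Y : ℝ} {z : ℂ}
    (hx0 : 0 < x0) (hX : 0 < X) (hY : 0 < Y) (hz : z.re = c) (hc : 0 ≤ c) (hcR : c ≤ R)
    (hθ : 0 ≤ (saddleCurve M θ).re) (hθR : (saddleCurve M θ).re ≤ R)
    (hθD : ‖saddleCurveDeriv M θ‖ ≤ R)
    (hXB : n * |Real.log X - Real.log x0| ≤ B) (hYB : n * |Real.log Y - Real.log x0| ≤ B)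
    (hre : (saddleCurve M θ).re ≠ c) (him : z.im ≠ (saddleCurve M θ).im)
    (hw : weightF M ν n (n * saddleCurve M θ - 1 / 4) ≠ 0) (hd : 0 ≤ d) (hK : 0 ≤ K)
    (h : ‖weightF M ν n (n * z - 1 / 4)‖ ≤ K * d * Real.exp (n * (c - (saddleCurve M θ).re) *
      (M * Real.log n + Real.log x0)) * ‖weightF M ν n (n * saddleCurve M θ - 1 / 4)‖) :
    ‖contourDensity M ν n (Real.log (n ^ M * X)) θ *
      (kernelNum M ν n (Real.log (n ^ M * Y)) (n * z - 1 / 4) / (z - saddleCurve M θ))‖ ≤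
    n * ((n : ℝ) ^ M)⁻¹ * (R * K * x0⁻¹ * Real.exp (2 * (R + 1) * B)) *
      |(saddleCurve M θ).re - c| ^ (-(1 / 2) : ℝ) *
        (d * |z.im - (saddleCurve M θ).im| ^ (-(1 / 2) : ℝ)) := by
  have hn1 : (1 : ℝ) ≤ n := by exact_mod_cast hn
  have hn' : (0 : ℝ) < n := by linarith
  have hw' : 0 < ‖weightF M ν n (n * saddleCurve M θ - 1 / 4)‖ := norm_pos_iff.2 hw
  have hR : 0 ≤ R := hc.trans hcR
  have hlX : Real.log (n ^ M * X) = M * Real.log n + Real.log X := by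
    rw [Real.log_mul (by positivity) hX.ne', Real.log_pow]
  have hlY : Real.log (n ^ M * Y) = M * Real.log n + Real.log Y := by
    rw [Real.log_mul (by positivity) hY.ne', Real.log_pow]
  have hE := exponent_le (L := M * Real.log n) hn1 hc hθ hcR hθR hXB hYB
  rw [← Real.exp_le_exp, Real.exp_add, Real.exp_add, Real.exp_add, Real.exp_sub, Real.exp_neg,
    Real.exp_log hx0, ← hlX, ← hlY, ← Real.log_pow, Real.exp_log (by positivity)] at hE
  have hzn : (n * z - 1 / 4).re + 1 = n * c + 3 / 4 := by
    have : (n * z - 1 / 4).re = n * c - 1 / 4 := by simp [hz]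
    rw [this]; ring
  have hinv := norm_inv_le_rpow (w := z - saddleCurve M θ)
    (by rw [Complex.sub_re, hz]; exact sub_ne_zero.2 hre.symm)
    (by rw [Complex.sub_im]; exact sub_ne_zero.2 him)
  rw [Complex.sub_re, Complex.sub_im, hz, abs_sub_comm c] at hinv
  rw [norm_mul, norm_div, norm_contourDensity, norm_kernelNum, hzn]
  set E1 := Real.exp ((n * (saddleCurve M θ).re - 1 / 4) * Real.log (n ^ M * X))
  set E2 := Real.exp (-(n * c + 3 / 4) * Real.log (n ^ M * Y))
  set W := ‖weightF M ν n (n * saddleCurve M θ - 1 / 4)‖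
  rw [← Real.log_pow] at h
  set E3 := Real.exp (n * (c - (saddleCurve M θ).re) * (Real.log (n ^ M) + Real.log x0))
  calc E1 / W * (n * ‖saddleCurveDeriv M θ‖) * (‖weightF M ν n (n * z - 1 / 4)‖ * E2 /
        ‖z - saddleCurve M θ‖)
      ≤ E1 / W * (n * R) * (K * d * E3 * W * E2 /
        ‖z - saddleCurve M θ‖) := by gcongr
    _ = n * R * (K * d) * (E1 * E2 * E3) * ‖z - saddleCurve M θ‖⁻¹ := by
        field_simp
    _ ≤ n * R * (K * d) * (((n : ℝ) ^ M)⁻¹ / x0 * Real.exp (2 * (R + 1) * B)) *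
        (|(saddleCurve M θ).re - c| ^ (-(1 / 2) : ℝ) *
          |z.im - (saddleCurve M θ).im| ^ (-(1 / 2) : ℝ)) := by gcongr
    _ = _ := by ring

end

end

section

section

variable {M : ℕ} {ν : ℕ → ℕ} {φ x0 θ : ℝ}

/-- The double integral remaining after the residue is uniformly small. -/
lemma exists_norm_integral_contour_le (hM : 1 ≤ M) (ν : ℕ → ℕ) (hφ : 0 < φ)
    (hφ' : φ < Real.pi / (M + 1)) (hx0 : x0 = v M φ) (B : ℝ) :
    ∃ K, 0 ≤ K ∧ ∀ n : ℕ, 1 ≤ n → ∀ X Y : ℝ, 0 < X → 0 < Y →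
      n * |Real.log X - Real.log x0| ≤ B → n * |Real.log Y - Real.log x0| ≤ B → ∀ r > 0,
      (n : ℝ) ^ (M - 1) * ‖∫ θ in (-(Real.pi / (M + 1)))..(Real.pi / ((M : ℝ) + 1)),
        contourDensity M ν n (Real.log (n ^ M * X)) θ *
          verticalIntegral M ν n (Real.log (n ^ M * Y)) (saddleContour M n φ).re θ‖ ≤
      K * (4 * r ^ (1 / 2 : ℝ) + r ^ (-(1 / 2) : ℝ) *
        ∫ y, Real.exp (-(n * saddleDrop M φ x0 y / 4))) := by
  have hp : 0 < Real.pi / ((M : ℝ) + 1) := by positivity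
  have hx0' : 0 < x0 := hx0 ▸ v_pos hM hφ hφ'
  obtain ⟨K, hK, hratio⟩ := exists_norm_weightF_ratio_le hM ν hφ hφ' hx0
  obtain ⟨κ, hκ, hdist⟩ := exists_mul_le_abs_saddleCurve_re_sub hM hφ hφ'
  obtain ⟨R₁, hR₁⟩ := isCompact_Icc.exists_bound_of_continuousOn (continuousOn_saddleCurve hM)
  obtain ⟨R₂, hR₂⟩ := isCompact_Icc.exists_bound_of_continuousOn (continuousOn_saddleCurveDeriv hM)
  set R := max R₁ R₂
  set c := (saddleCurve M φ).re
  have hc : 0 ≤ c := (saddleCurve_re_pos hM hφ hφ').le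
  have hcR : c ≤ R := (Complex.re_le_norm _).trans
    ((hR₁ φ ⟨by linarith, hφ'.le⟩).trans (le_max_left _ _))
  have hR : 0 ≤ R := hc.trans hcR
  set Q := R * K * x0⁻¹ * Real.exp (2 * (R + 1) * B)
  have hQ : 0 ≤ Q := by positivity
  set G : ℝ → ℝ := fun θ => κ ^ (-(1 / 2) : ℝ) * (rootCut 1 (θ - φ) + rootCut 1 (θ + φ) + 1)
  have hG : IntervalIntegrable G volume (-(Real.pi / (M + 1))) (Real.pi / ((M : ℝ) + 1)) :=
    ((((integrable_rootCut one_pos).comp_sub_right φ).add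
      ((integrable_rootCut one_pos).comp_add_right φ)).intervalIntegrable.add
        intervalIntegrable_const).const_mul _
  have hG0 : 0 ≤ ∫ θ in (-(Real.pi / (M + 1)))..(Real.pi / ((M : ℝ) + 1)), G θ :=
    intervalIntegral.integral_nonneg (by linarith) fun θ _ => by
      have := rootCut_nonneg 1 (θ - φ)
      have := rootCut_nonneg 1 (θ + φ)
      positivity
  refine ⟨Q * ∫ θ in (-(Real.pi / (M + 1)))..(Real.pi / ((M : ℝ) + 1)), G θ, by positivity,
    fun n hn X Y hX hY hXB hYB r hr => ?_⟩
  have hn' : (0 : ℝ) < n := by exact_mod_cast hn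
  set J := 4 * r ^ (1 / 2 : ℝ) + r ^ (-(1 / 2) : ℝ) *
        ∫ y, Real.exp (-(n * saddleDrop M φ x0 y / 4))
  have hJ : 0 ≤ J := by
    have : 0 ≤ ∫ y, Real.exp (-(n * saddleDrop M φ x0 y / 4)) :=
      integral_nonneg fun y => (Real.exp_pos _).le
    positivity
  have hpow : (n : ℝ) ^ (M - 1) * (n * ((n : ℝ) ^ M)⁻¹) = 1 := by
    rw [← mul_assoc, ← pow_succ, Nat.sub_add_cancel hM, mul_inv_cancel₀ (by positivity)]
  have hmain := intervalIntegral.norm_integral_le_of_norm_le (μ := volume)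
    (f := fun θ => contourDensity M ν n (Real.log (n ^ M * X)) θ *
          verticalIntegral M ν n (Real.log (n ^ M * Y)) (saddleContour M n φ).re θ)
    (g := fun θ => n * ((n : ℝ) ^ M)⁻¹ * Q * J * G θ)
    (by linarith : -(Real.pi / ((M : ℝ) + 1)) ≤ Real.pi / ((M : ℝ) + 1)) ?_ (hG.const_mul _)
  · rw [intervalIntegral.integral_const_mul] at hmain
    refine (mul_le_mul_of_nonneg_left hmain (by positivity)).trans_eq ?_
    linear_combination
      (Q * J * ∫ θ in (-(Real.pi / (M + 1)))..(Real.pi / ((M : ℝ) + 1)), G θ) * hpow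
  · filter_upwards [Measure.ae_ne (volume : Measure ℝ) φ,
      Measure.ae_ne (volume : Measure ℝ) (-φ)] with θ h1 h2 hθ
    have hne : φ ≠ |θ| := fun h => by
      rcases abs_choice θ with h' | h' <;> rw [h'] at h
      · exact h1 h.symm
      · exact h2 (by linarith)
    have hθ' : |θ| ≤ Real.pi / (M + 1) := abs_le.2 ⟨hθ.1.le, hθ.2⟩
    have hre : (saddleCurve M θ).re ≠ c := fun h => hne ((saddleCurve_re_eq_iff hM hφ hφ' hθ').1 h)
    have hθR : ‖saddleCurve M θ‖ ≤ R := (hR₁ θ ⟨hθ.1.le, hθ.2⟩).trans (le_max_left _ _)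
    have hθD : ‖saddleCurveDeriv M θ‖ ≤ R := (hR₂ θ ⟨hθ.1.le, hθ.2⟩).trans (le_max_right _ _)
    have hP : |(saddleCurve M θ).re - c| ^ (-(1 / 2) : ℝ) ≤ G θ := by
      have h3 : 0 < |(|θ| - φ)| := abs_pos.2 (sub_ne_zero.2 hne.symm)
      refine (Real.rpow_le_rpow_of_nonpos (by positivity) (hdist θ hθ') (by norm_num)).trans ?_
      rw [Real.mul_rpow hκ.le h3.le]
      exact mul_le_mul_of_nonneg_left (rpow_abs_abs_sub_le φ θ) (by positivity)
    rw [verticalIntegral_eq hn, ← integral_const_mul]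
    refine (norm_integral_le_rootCut (x0 := x0) hM hφ hφ' hn hr (b := (saddleCurve M θ).im)
      (A := n * ((n : ℝ) ^ M)⁻¹ * Q * |(saddleCurve M θ).re - c| ^ (-(1 / 2) : ℝ)) (by positivity)
      fun y hy => ?_).trans ?_
    · have hzr : ((c : ℂ) + y * I).re = c := by simp
      have hzi : ((c : ℂ) + y * I).im = y := by simp
      have := norm_contourDensity_mul_le (ν := ν) (z := c + y * I) (θ := θ)
        (d := Real.exp (-(n * saddleDrop M φ x0 y / 4)))
        hn hx0' hX hY hzr hc hcR (saddleCurve_re_nonneg hM hθ')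
        ((Complex.re_le_norm _).trans hθR) hθD hXB hYB hre (by rwa [hzi])
        (weightF_saddleContour_ne_zero hM hn hθ') (Real.exp_pos _).le hK.le (hratio n hn y θ hθ')
      rwa [hzi] at this
    · calc n * ((n : ℝ) ^ M)⁻¹ * Q * |(saddleCurve M θ).re - c| ^ (-(1 / 2) : ℝ) * J
          ≤ n * ((n : ℝ) ^ M)⁻¹ * Q * G θ * J := by gcongr
        _ = _ := by ring

end

end

section

lemma Ksin_eq_sinc (ξ η : ℝ) : Ksin ξ η = Real.sinc (Real.pi * (ξ - η)) := by
  rw [Ksin]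
  split_ifs with h
  · simp [h]
  · rw [Real.sinc_of_ne_zero (mul_ne_zero Real.pi_ne_zero (sub_ne_zero.2 h))]

section

variable {M : ℕ} {φ : ℝ}

lemma ρbulk_pos (hM : 1 ≤ M) (hφ : 0 < φ) (hφ' : φ < Real.pi / (M + 1)) : 0 < ρbulk M φ := by
  have h1 := sin_nat_mul_pos hM hφ hφ'.le
  have h2 := sin_add_one_mul_pos hφ hφ'
  have h3 := sin_pos_of_le hM hφ hφ'.le
  have := Real.pi_pos
  rw [ρbulk]
  positivity

lemma saddleCurve_im_eq (hM : 1 ≤ M) (hφ : 0 < φ) (hφ' : φ < Real.pi / (M + 1)) :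
    (saddleCurve M φ).im = Real.pi * ρbulk M φ * v M φ := by
  have h1 := sin_nat_mul_pos hM hφ hφ'.le
  have h2 := sin_add_one_mul_pos hφ hφ'
  have h3 := sin_pos_of_le hM hφ hφ'.le
  obtain ⟨m, rfl⟩ : ∃ m, M = m + 1 := ⟨M - 1, by omega⟩
  rw [saddleCurve_im, saddleRadius_eq hM hφ hφ'.le, ρbulk, v, Nat.add_sub_cancel]
  have := Real.pi_pos
  field_simp
  ring

lemma saddleCurve_re_eq (hM : 1 ≤ M) (hφ : 0 < φ) (hφ' : φ < Real.pi / (M + 1)) :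
    (saddleCurve M φ).re = Real.pi * ρbulk M φ * v M φ * (Real.cos φ / Real.sin φ) := by
  have h3 := sin_pos_of_le hM hφ hφ'.le
  rw [← saddleCurve_im_eq hM hφ hφ', saddleCurve_im, saddleCurve_re]
  field_simp

end

section

variable {α : Type*} {l : Filter α} {N : α → ℕ} {u : α → ℝ} {u0 x0 ρ : ℝ}

lemma tendsto_add_div_natCast_mul (hN : Tendsto N l atTop) (hu : Tendsto u l (nhds u0)) :
    Tendsto (fun a => x0 + u a / (N a * ρ)) l (nhds x0) := by
  have h := hu.div_atTop ((tendsto_natCast_atTop_atTop (R := ℝ)).comp hN)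
  have h2 := (h.div_const ρ).const_add x0
  simpa [div_div] using h2

lemma tendsto_natCast_mul_log_sub (hx0 : 0 < x0) (hN : Tendsto N l atTop)
    (hu : Tendsto u l (nhds u0)) :
    Tendsto (fun a => N a * (Real.log (x0 + u a / (N a * ρ)) - Real.log x0)) l
      (nhds (u0 / ρ * x0⁻¹)) := by
  have hd : ContinuousAt (dslope Real.log x0) x0 :=
    continuousAt_dslope_same.2 (Real.differentiableAt_log hx0.ne')
  have h1 := hd.tendsto.comp (tendsto_add_div_natCast_mul (x0 := x0) (ρ := ρ) hN hu)
  rw [dslope_same, Real.deriv_log] at h1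
  refine ((hu.div_const ρ).mul h1).congr' ?_
  filter_upwards [hN.eventually_ge_atTop 1] with a ha
  have ha' : (0 : ℝ) < N a := by exact_mod_cast ha
  rw [← sub_smul_dslope Real.log x0, Function.comp, smul_eq_mul]
  field_simp
  ring

end

section

variable {M n : ℕ} {φ x0 : ℝ}

lemma prefactor_mul_residue_eq (hM : 1 ≤ M) (hn : 1 ≤ n) {ρ E X Y : ℝ} (hX : 0 < X) (hY : 0 < Y) :
    ((E * ((n : ℝ) ^ (M - 1) / ρ) : ℝ) : ℂ) * (Complex.exp (-Real.log (n ^ M * Y)) *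
      (Complex.exp ((saddleContour M n φ).re *
          (Real.log (n ^ M * X) - Real.log (n ^ M * Y) : ℝ)) *
        ((saddleContour M n φ).im / Real.pi * (Real.sinc ((saddleContour M n φ).im *
          (Real.log (n ^ M * X) - Real.log (n ^ M * Y))) : ℂ)))) =
    ((E * ((saddleCurve M φ).im / (Real.pi * ρ) / Y) * (
      Real.exp ((saddleCurve M φ).re * (n * (Real.log X - Real.log x0) -
        n * (Real.log Y - Real.log x0)) - 1 / 4 * (Real.log X - Real.log Y)) *
      Real.sinc ((saddleCurve M φ).im * (n * (Real.log X - Real.log x0) -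
        n * (Real.log Y - Real.log x0)))) : ℝ) : ℂ) := by
  have hn' : (0 : ℝ) < n := by exact_mod_cast hn
  have hL : Real.log (n ^ M * X) - Real.log (n ^ M * Y) = Real.log X - Real.log Y := by
    rw [Real.log_mul (by positivity) hX.ne', Real.log_mul (by positivity) hY.ne']
    ring
  have hpow : (n : ℝ) ^ (M - 1) * n = n ^ M := by rw [← pow_succ, Nat.sub_add_cancel hM]
  rw [hL]
  have e1 : Complex.exp (-Real.log (n ^ M * Y)) = ((((n : ℝ) ^ M * Y)⁻¹ : ℝ) : ℂ) := by
    rw [← Real.exp_log (by positivity : 0 < (n : ℝ) ^ M * Y), ← Real.exp_neg, Real.log_exp]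
    push_cast
    rfl
  rw [e1, saddleContour_re, saddleContour_im, ← Complex.ofReal_mul, ← Complex.ofReal_exp]
  norm_cast
  have a1 : (n * (saddleCurve M φ).re - 1 / 4) * (Real.log X - Real.log Y) =
      (saddleCurve M φ).re * (n * (Real.log X - Real.log x0) -
        n * (Real.log Y - Real.log x0)) - 1 / 4 * (Real.log X - Real.log Y) := by ring
  have a2 : n * (saddleCurve M φ).im * (Real.log X - Real.log Y) =
      (saddleCurve M φ).im * (n * (Real.log X - Real.log x0) -
        n * (Real.log Y - Real.log x0)) := by ring
  rw [a1, a2, Nat.cast_pow, Nat.cast_pow, ← hpow]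
  field_simp

lemma tendsto_main_term (hM : 1 ≤ M) (hφ : 0 < φ) (hφ' : φ < Real.pi / (M + 1))
    (hx0 : x0 = v M φ) (p0 : ℝ × ℝ) {X Y : ℕ × ℝ × ℝ → ℝ}
    (hX : Tendsto X (atTop ×ˢ nhds p0) (nhds x0)) (hY : Tendsto Y (atTop ×ˢ nhds p0) (nhds x0))
    (hlX : Tendsto (fun q => q.1 * (Real.log (X q) - Real.log x0)) (atTop ×ˢ nhds p0)
      (nhds (p0.1 / ρbulk M φ * x0⁻¹)))
    (hlY : Tendsto (fun q => q.1 * (Real.log (Y q) - Real.log x0)) (atTop ×ˢ nhds p0)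
      (nhds (p0.2 / ρbulk M φ * x0⁻¹))) :
    Tendsto (fun q : ℕ × ℝ × ℝ =>
      Real.exp (-Real.pi * (q.2.1 - q.2.2) * (Real.cos φ / Real.sin φ)) *
        ((saddleCurve M φ).im / (Real.pi * ρbulk M φ) / Y q) * (
      Real.exp ((saddleCurve M φ).re * (q.1 * (Real.log (X q) - Real.log x0) -
        q.1 * (Real.log (Y q) - Real.log x0)) - 1 / 4 * (Real.log (X q) - Real.log (Y q))) *
      Real.sinc ((saddleCurve M φ).im * (q.1 * (Real.log (X q) - Real.log x0) -
        q.1 * (Real.log (Y q) - Real.log x0))))) (atTop ×ˢ nhds p0)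
      (nhds (Ksin p0.1 p0.2)) := by
  have hx0' : 0 < x0 := hx0 ▸ v_pos hM hφ hφ'
  have hρ := ρbulk_pos hM hφ hφ'
  have hp : Tendsto (fun q : ℕ × ℝ × ℝ => q.2) (atTop ×ˢ nhds p0) (nhds p0) := tendsto_snd
  have h1 : Tendsto (fun q : ℕ × ℝ × ℝ => q.2.1) (atTop ×ˢ nhds p0) (nhds p0.1) :=
    (continuous_fst.tendsto p0).comp hp
  have h2 : Tendsto (fun q : ℕ × ℝ × ℝ => q.2.2) (atTop ×ˢ nhds p0) (nhds p0.2) :=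
    (continuous_snd.tendsto p0).comp hp
  have hd := hlX.sub hlY
  have hlog := ((Real.continuousAt_log hx0'.ne').tendsto.comp hX).sub
    ((Real.continuousAt_log hx0'.ne').tendsto.comp hY)
  have t1 := (Real.continuous_exp.tendsto _).comp
    (((h1.sub h2).const_mul (-Real.pi)).mul_const (Real.cos φ / Real.sin φ))
  have t2 := (tendsto_const_nhds
    (x := (saddleCurve M φ).im / (Real.pi * ρbulk M φ))).div hY hx0'.ne'
  have t3 := (Real.continuous_exp.tendsto _).comp
    ((hd.const_mul (saddleCurve M φ).re).sub (hlog.const_mul (1 / 4)))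
  have t4 := (Real.continuous_sinc.tendsto _).comp (hd.const_mul (saddleCurve M φ).im)
  have h := (t1.mul t2).mul (t3.mul t4)
  refine Tendsto.mono_right (Tendsto.congr (fun q => rfl) h) (le_of_eq (congrArg nhds ?_))
  have hpi := Real.pi_pos
  rw [Ksin_eq_sinc, saddleCurve_re_eq hM hφ hφ', saddleCurve_im_eq hM hφ hφ', ← hx0]
  have e1 : Real.pi * ρbulk M φ * x0 * (p0.1 / ρbulk M φ * x0⁻¹ - p0.2 / ρbulk M φ * x0⁻¹) =
      Real.pi * (p0.1 - p0.2) := by field_simp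
  have e2 : Real.pi * ρbulk M φ * x0 * (Real.cos φ / Real.sin φ) *
      (p0.1 / ρbulk M φ * x0⁻¹ - p0.2 / ρbulk M φ * x0⁻¹) - 1 / 4 * (Real.log x0 - Real.log x0) =
      -(-Real.pi * (p0.1 - p0.2) * (Real.cos φ / Real.sin φ)) := by
    linear_combination (Real.cos φ / Real.sin φ) * e1
  rw [e1, e2, Real.exp_neg]
  field_simp

lemma tendsto_error_term (hM : 1 ≤ M) (ν : ℕ → ℕ) (hφ : 0 < φ) (hφ' : φ < Real.pi / (M + 1))
    (hx0 : x0 = v M φ) (p0 : ℝ × ℝ) {X Y : ℕ × ℝ × ℝ → ℝ}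
    (hX : Tendsto X (atTop ×ˢ nhds p0) (nhds x0)) (hY : Tendsto Y (atTop ×ˢ nhds p0) (nhds x0))
    {a b : ℝ}
    (hlX : Tendsto (fun q => q.1 * (Real.log (X q) - Real.log x0)) (atTop ×ˢ nhds p0) (nhds a))
    (hlY : Tendsto (fun q => q.1 * (Real.log (Y q) - Real.log x0)) (atTop ×ˢ nhds p0) (nhds b)) :
    Tendsto (fun q : ℕ × ℝ × ℝ => (q.1 : ℝ) ^ (M - 1) *
      ‖∫ θ in (-(Real.pi / (M + 1)))..(Real.pi / ((M : ℝ) + 1)),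
        contourDensity M ν q.1 (Real.log (q.1 ^ M * X q)) θ *
          verticalIntegral M ν q.1 (Real.log (q.1 ^ M * Y q)) (saddleContour M q.1 φ).re θ‖)
      (atTop ×ˢ nhds p0) (nhds 0) := by
  have hx0' : 0 < x0 := hx0 ▸ v_pos hM hφ hφ'
  obtain ⟨K, hK, hbound⟩ :=
    exists_norm_integral_contour_le hM ν hφ hφ' hx0 (max (|a| + 1) (|b| + 1))
  have hr := ((tendsto_integral_exp_saddleDrop (x0 := x0) hM hφ hφ').add
    (tendsto_one_div_add_atTop_nhds_zero_nat (𝕜 := ℝ))).comp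
      (tendsto_fst (f := (atTop : Filter ℕ)) (g := nhds p0))
  have hlim : Tendsto (fun q : ℕ × ℝ × ℝ => K * (5 * √((∫ y, Real.exp
      (-(q.1 * saddleDrop M φ x0 y / 4))) + 1 / (q.1 + 1)))) (atTop ×ˢ nhds p0) (nhds 0) := by
    simpa using (((Real.continuous_sqrt.tendsto _).comp hr).const_mul 5).const_mul K
  refine squeeze_zero' (Eventually.of_forall fun q => by positivity) ?_ hlim
  filter_upwards [(tendsto_fst (f := (atTop : Filter ℕ)) (g := nhds p0)).eventually_ge_atTop 1,
    hX.eventually_const_lt hx0', hY.eventually_const_lt hx0',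
    hlX.abs.eventually_le_const (lt_add_one |a|),
    hlY.abs.eventually_le_const (lt_add_one |b|)] with q hn hXq hYq hlXq hlYq
  rw [abs_mul, Nat.abs_cast] at hlXq hlYq
  have hI : 0 ≤ ∫ y, Real.exp (-(q.1 * saddleDrop M φ x0 y / 4)) :=
    integral_nonneg fun y => (Real.exp_pos _).le
  have hr0 : 0 < (∫ y, Real.exp (-(q.1 * saddleDrop M φ x0 y / 4))) + 1 / ((q.1 : ℝ) + 1) := by
    positivity
  refine (hbound q.1 hn (X q) (Y q) hXq hYq (hlXq.trans (le_max_left _ _))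
    (hlYq.trans (le_max_right _ _)) _ hr0).trans (mul_le_mul_of_nonneg_left ?_ hK)
  set r := (∫ y, Real.exp (-(q.1 * saddleDrop M φ x0 y / 4))) + 1 / ((q.1 : ℝ) + 1) with hrdef
  have h1 : ∫ y, Real.exp (-(q.1 * saddleDrop M φ x0 y / 4)) ≤ r := by
    rw [hrdef]
    have : 0 ≤ 1 / ((q.1 : ℝ) + 1) := by positivity
    linarith
  have h2 : r ^ (-(1 / 2) : ℝ) * r = r ^ (1 / 2 : ℝ) := by
    rw [← Real.rpow_add_one hr0.ne']
    norm_num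
  rw [Real.sqrt_eq_rpow]
  nlinarith [mul_le_mul_of_nonneg_left h1 (Real.rpow_nonneg hr0.le (-(1 / 2)))]

end

end

lemma tendstoUniformlyOn_of_forall_tendsto {f : ℝ × ℝ → ℂ} (hf : Continuous f)
    {F : ℕ → ℝ × ℝ → ℂ}
    (h : ∀ p, Tendsto (fun q : ℕ × ℝ × ℝ => F q.1 q.2) (atTop ×ˢ nhds p) (nhds (f p)))
    {S : Set (ℝ × ℝ)} (hS : IsCompact S) : TendstoUniformlyOn F f atTop S := by
  rw [← tendstoLocallyUniformlyOn_iff_tendstoUniformlyOn_of_compact hS,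
    tendstoLocallyUniformlyOn_iff_forall_tendsto]
  intro p _
  have h1 : Tendsto (fun q : ℕ × ℝ × ℝ => f q.2) (atTop ×ˢ nhds p) (nhds (f p)) :=
    (hf.tendsto p).comp tendsto_snd
  have h2 := (h1.prodMk_nhds (h p)).mono_right (nhds_le_uniformity (f p))
  exact h2.mono_left (Filter.prod_mono le_rfl nhdsWithin_le_nhds)

/-- Bulk universality for singular values of products of Ginibre matrices. -/
theorem bulk_universality_Ginibre
    (M : ℕ) (hM : 1 ≤ M) (ν : ℕ → ℕ) (hν0 : ν 0 = 0)
    (x0 : ℝ) (hx0 : x0 ∈ Set.Ioo (0 : ℝ) (((M : ℝ) + 1) ^ (M + 1) / (M : ℝ) ^ M))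
    (φ : ℝ) (hφ : φ ∈ Set.Ioo (0 : ℝ) (Real.pi / ((M : ℝ) + 1)))
    (hpar : x0 = v M φ)
    (S : Set (ℝ × ℝ)) (hS : IsCompact S) :
    TendstoUniformlyOn
      (fun (n : ℕ) (p : ℝ × ℝ) =>
        ((Real.exp (-Real.pi * (p.1 - p.2) * (Real.cos φ / Real.sin φ)) *
            ((n : ℝ) ^ (M - 1) / ρbulk M φ) : ℝ) : ℂ) *
          Kn M ν n ((n : ℝ) ^ M * (x0 + p.1 / (n * ρbulk M φ)))
            ((n : ℝ) ^ M * (x0 + p.2 / (n * ρbulk M φ))))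
      (fun p => ((Ksin p.1 p.2 : ℝ) : ℂ)) atTop S := by
  have hρ := ρbulk_pos hM hφ.1 hφ.2
  refine tendstoUniformlyOn_of_forall_tendsto ?_ (fun p0 => ?_) hS
  · simp only [Ksin_eq_sinc]
    exact Complex.continuous_ofReal.comp (Real.continuous_sinc.comp (by fun_prop))
  have hN : Tendsto (fun q : ℕ × ℝ × ℝ => q.1) (atTop ×ˢ nhds p0) atTop := tendsto_fst
  have hp : Tendsto (fun q : ℕ × ℝ × ℝ => q.2) (atTop ×ˢ nhds p0) (nhds p0) := tendsto_snd
  have h1 : Tendsto (fun q : ℕ × ℝ × ℝ => q.2.1) (atTop ×ˢ nhds p0) (nhds p0.1) :=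
    (continuous_fst.tendsto p0).comp hp
  have h2 : Tendsto (fun q : ℕ × ℝ × ℝ => q.2.2) (atTop ×ˢ nhds p0) (nhds p0.2) :=
    (continuous_snd.tendsto p0).comp hp
  have hX := tendsto_add_div_natCast_mul (x0 := x0) (ρ := ρbulk M φ) hN h1
  have hY := tendsto_add_div_natCast_mul (x0 := x0) (ρ := ρbulk M φ) hN h2
  have hlX := tendsto_natCast_mul_log_sub (ρ := ρbulk M φ) hx0.1 hN h1
  have hlY := tendsto_natCast_mul_log_sub (ρ := ρbulk M φ) hx0.1 hN h2
  have hmain := (Complex.continuous_ofReal.tendsto _).comp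
    (tendsto_main_term hM hφ.1 hφ.2 hpar p0 hX hY hlX hlY)
  have herr := tendsto_error_term hM ν hφ.1 hφ.2 hpar p0 hX hY hlX hlY
  have hE : Tendsto (fun q : ℕ × ℝ × ℝ =>
      Real.exp (-Real.pi * (q.2.1 - q.2.2) * (Real.cos φ / Real.sin φ)) / ρbulk M φ /
        (4 * Real.pi ^ 2)) (atTop ×ˢ nhds p0) (nhds _) :=
    ((((Real.continuous_exp.tendsto _).comp
      (((h1.sub h2).const_mul (-Real.pi)).mul_const (Real.cos φ / Real.sin φ))).div_const
        _).div_const _)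
  have hzero := hE.mul herr
  rw [mul_zero] at hzero
  have hsum := hmain.add (squeeze_zero_norm' (f := fun q : ℕ × ℝ × ℝ =>
    ((Real.exp (-Real.pi * (q.2.1 - q.2.2) * (Real.cos φ / Real.sin φ)) *
      ((q.1 : ℝ) ^ (M - 1) / ρbulk M φ) : ℝ) : ℂ) *
      ((1 / (2 * (Real.pi : ℂ) * Complex.I) ^ 2) * (I *
      ∫ θ in (-(Real.pi / (M + 1)))..(Real.pi / ((M : ℝ) + 1)),
        contourDensity M ν q.1 (Real.log (q.1 ^ M * (x0 + q.2.1 / (q.1 * ρbulk M φ)))) θ *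
          verticalIntegral M ν q.1 (Real.log (q.1 ^ M * (x0 + q.2.2 / (q.1 * ρbulk M φ))))
            (saddleContour M q.1 φ).re θ))) (Eventually.of_forall fun q => ?_) hzero)
  · rw [add_zero] at hsum
    refine hsum.congr' ?_
    filter_upwards [hN.eventually_ge_atTop 1, hX.eventually_const_lt hx0.1,
      hY.eventually_const_lt hx0.1] with q hn hXq hYq
    rw [Kn_eq hM hν0 hn hφ.1 hφ.2]
    refine Eq.trans ?_ (mul_add _ _ _).symm
    rw [prefactor_mul_residue_eq (x0 := x0) hM hn hXq hYq]
    rfl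
  · rw [norm_mul, norm_mul, norm_mul, Complex.norm_real, Real.norm_of_nonneg (by positivity)]
    simp only [norm_div, norm_pow, norm_mul, Complex.norm_I, Complex.norm_real, norm_one,
      Complex.norm_ofNat, Real.norm_of_nonneg Real.pi_pos.le]
    refine le_of_eq ?_
    field_simp
    ring
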